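/- (Carleman estimate for the adjoint damped beam operator, Theorem 1.1.) There exist constants C > 0, s₀ ≥ 1 and λ₀ ≥ 1 (depending on d, L, T, η, θ) such that for every smooth function ψ : ℝ × [0,T] → ℝ that is P-periodic in x, and for all s ≥ s₀ and λ ≥ λ₀: s⁷λ⁸∫∫ ξ⁷ψ²e^{−2sφ} + s⁵λ⁶∫∫ ξ⁵(∂ₓψ)²e^{−2sφ} + s³λ⁴∫∫ ξ³((∂ₓₓψ)² + (∂ₜψ)²)e^{−2sφ} + sλ²∫∫ ξ((∂ₜₓψ)² + (∂ₓₓₓψ)²)e^{−2sφ} + s⁻¹∫∫ ξ⁻¹((∂ₜₜψ)² + (∂ₜₓₓψ)² + (∂ₓₓₓₓψ)²)e^{−2sφ} ≤ C∫∫ (∂ₜₜψ + ∂ₜₓₓψ + ∂ₓₓₓₓψ)² e^{−2sφ} + C s⁷λ⁸ ∫₀ᵀ∫_ω ξ⁷ψ² e^{−2sφ} dx dt, where the last integral is taken over ω × (0,T). -/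

import Mathlib

open Real Set MeasureTheory intervalIntegral

noncomputable section

/-- Partial derivative in the space variable `x`. -/
def pdx (f : ℝ → ℝ → ℝ) (x t : ℝ) : ℝ := deriv (fun y => f y t) x

/-- Partial derivative in the time variable `t`. -/
def pdt (f : ℝ → ℝ → ℝ) (x t : ℝ) : ℝ := deriv (fun τ => f x τ) t

/-- The space-time integral `∫₀ᵀ ∫_{-L}^{d+L} F(x,t) dx dt`. -/
def II (d L T : ℝ) (F : ℝ → ℝ → ℝ) : ℝ :=
  ∫ t in (0:ℝ)..T, ∫ x in (-L)..(d + L), F x t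

/-- The space-time integral over `ω × (0,T)` where `ω = (-L,0) ∪ (d, d+L)`. -/
def IIω (d L T : ℝ) (F : ℝ → ℝ → ℝ) : ℝ :=
  ∫ t in (0:ℝ)..T, ((∫ x in (-L)..(0:ℝ), F x t) + ∫ x in d..(d + L), F x t)

/-- The Carleman weight `φ(x,t) = θ(t)(e^{6λM} - e^{λ(η(x)+4M)})`. -/
def phiW (θ η : ℝ → ℝ) (M lam : ℝ) (x t : ℝ) : ℝ :=
  θ t * (Real.exp (6 * lam * M) - Real.exp (lam * (η x + 4 * M)))

/-- The Carleman weight `ξ(x,t) = θ(t) e^{λ(η(x)+4M)}`. -/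
def xiW (θ η : ℝ → ℝ) (M lam : ℝ) (x t : ℝ) : ℝ :=
  θ t * Real.exp (lam * (η x + 4 * M))

open Topology Filter

/-- Continuous on the strip `ℝ × (0,T)` and bounded by a power of `θ` on one period. -/
structure PolyGrowth (d L T : ℝ) (θ : ℝ → ℝ) (F : ℝ → ℝ → ℝ) : Prop where
  cont : ContinuousOn (fun p : ℝ × ℝ => F p.1 p.2) (univ ×ˢ Ioo 0 T)
  bound : ∃ K : ℝ, 0 ≤ K ∧ ∃ m : ℕ,
    ∀ x ∈ Icc (-L) (d + L), ∀ t ∈ Ioo (0:ℝ) T, |F x t| ≤ K * θ t ^ m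

/-- Continuous on the strip `ℝ × (0,T)` and decaying faster than any power of `θ⁻¹`. -/
structure RapidDecay (d L T : ℝ) (θ : ℝ → ℝ) (F : ℝ → ℝ → ℝ) : Prop where
  cont : ContinuousOn (fun p : ℝ × ℝ => F p.1 p.2) (univ ×ˢ Ioo 0 T)
  bound : ∀ m : ℕ, ∃ K : ℝ, 0 ≤ K ∧
    ∀ x ∈ Icc (-L) (d + L), ∀ t ∈ Ioo (0:ℝ) T, |F x t| * θ t ^ m ≤ K

section Growth

variable {d L T : ℝ} {θ : ℝ → ℝ} {F G : ℝ → ℝ → ℝ}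

theorem PolyGrowth.add (hθ : ∀ t ∈ Ioo (0:ℝ) T, 1 ≤ θ t)
    (hF : PolyGrowth d L T θ F) (hG : PolyGrowth d L T θ G) :
    PolyGrowth d L T θ (fun x t => F x t + G x t) := by
  refine ⟨hF.cont.add hG.cont, ?_⟩
  obtain ⟨K₁, hK₁, m₁, h₁⟩ := hF.bound
  obtain ⟨K₂, hK₂, m₂, h₂⟩ := hG.bound
  refine ⟨K₁ + K₂, by positivity, m₁ + m₂, fun x hx t ht => ?_⟩
  have h1 : θ t ^ m₁ ≤ θ t ^ (m₁ + m₂) := pow_le_pow_right₀ (hθ t ht) (by omega)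
  have h2 : θ t ^ m₂ ≤ θ t ^ (m₁ + m₂) := pow_le_pow_right₀ (hθ t ht) (by omega)
  calc |F x t + G x t| ≤ |F x t| + |G x t| := abs_add_le _ _
    _ ≤ K₁ * θ t ^ m₁ + K₂ * θ t ^ m₂ := add_le_add (h₁ x hx t ht) (h₂ x hx t ht)
    _ ≤ K₁ * θ t ^ (m₁ + m₂) + K₂ * θ t ^ (m₁ + m₂) := by gcongr
    _ = _ := by ring

theorem PolyGrowth.neg (hF : PolyGrowth d L T θ F) :
    PolyGrowth d L T θ (fun x t => -F x t) :=
  ⟨hF.cont.neg, by simpa only [abs_neg] using hF.bound⟩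

theorem PolyGrowth.sub (hθ : ∀ t ∈ Ioo (0:ℝ) T, 1 ≤ θ t)
    (hF : PolyGrowth d L T θ F) (hG : PolyGrowth d L T θ G) :
    PolyGrowth d L T θ (fun x t => F x t - G x t) := by
  simpa only [sub_eq_add_neg] using hF.add hθ hG.neg

theorem PolyGrowth.mul (hF : PolyGrowth d L T θ F) (hG : PolyGrowth d L T θ G) :
    PolyGrowth d L T θ (fun x t => F x t * G x t) := by
  refine ⟨hF.cont.mul hG.cont, ?_⟩
  obtain ⟨K₁, hK₁, m₁, h₁⟩ := hF.bound
  obtain ⟨K₂, hK₂, m₂, h₂⟩ := hG.bound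
  refine ⟨K₁ * K₂, by positivity, m₁ + m₂, fun x hx t ht => ?_⟩
  rw [abs_mul]
  calc |F x t| * |G x t| ≤ (K₁ * θ t ^ m₁) * (K₂ * θ t ^ m₂) :=
        mul_le_mul (h₁ x hx t ht) (h₂ x hx t ht) (abs_nonneg _)
          ((abs_nonneg _).trans (h₁ x hx t ht))
    _ = _ := by ring

theorem PolyGrowth.const (r : ℝ) : PolyGrowth d L T θ (fun _ _ => r) :=
  ⟨continuousOn_const, |r|, abs_nonneg _, 0, fun x _ t _ => by simp⟩

theorem PolyGrowth.pow (hF : PolyGrowth d L T θ F) (n : ℕ) :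
    PolyGrowth d L T θ (fun x t => F x t ^ n) := by
  induction n with
  | zero => simpa using PolyGrowth.const 1
  | succ n ih => simpa only [pow_succ] using ih.mul hF

theorem PolyGrowth.of_continuous (hF : Continuous (fun p : ℝ × ℝ => F p.1 p.2)) :
    PolyGrowth d L T θ F := by
  refine ⟨hF.continuousOn, ?_⟩
  obtain ⟨K, hK⟩ := ((isCompact_Icc (a := -L) (b := d + L)).prod
    (isCompact_Icc (a := (0:ℝ)) (b := T))).exists_bound_of_continuousOn hF.continuousOn
  refine ⟨|K|, abs_nonneg _, 0, fun x hx t ht => ?_⟩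
  simpa using (hK (x, t) ⟨hx, ht.1.le, ht.2.le⟩).trans (le_abs_self K)

theorem PolyGrowth.of_space {f : ℝ → ℝ} (hf : Continuous f) :
    PolyGrowth d L T θ (fun x _ => f x) :=
  .of_continuous (hf.comp continuous_fst)

theorem RapidDecay.toPolyGrowth (hF : RapidDecay d L T θ F) : PolyGrowth d L T θ F := by
  obtain ⟨K, hK, h⟩ := hF.bound 0
  exact ⟨hF.cont, K, hK, 0, fun x hx t ht => by simpa using h x hx t ht⟩

theorem RapidDecay.add (hθ : ∀ t ∈ Ioo (0:ℝ) T, 1 ≤ θ t)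
    (hF : RapidDecay d L T θ F) (hG : RapidDecay d L T θ G) :
    RapidDecay d L T θ (fun x t => F x t + G x t) := by
  refine ⟨hF.cont.add hG.cont, fun m => ?_⟩
  obtain ⟨K₁, hK₁, h₁⟩ := hF.bound m
  obtain ⟨K₂, hK₂, h₂⟩ := hG.bound m
  refine ⟨K₁ + K₂, by positivity, fun x hx t ht => ?_⟩
  have h0 : 0 ≤ θ t := zero_le_one.trans (hθ t ht)
  calc |F x t + G x t| * θ t ^ m ≤ (|F x t| + |G x t|) * θ t ^ m := by
        gcongr; exact abs_add_le _ _
    _ = |F x t| * θ t ^ m + |G x t| * θ t ^ m := by ring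
    _ ≤ _ := add_le_add (h₁ x hx t ht) (h₂ x hx t ht)

theorem RapidDecay.neg (hF : RapidDecay d L T θ F) :
    RapidDecay d L T θ (fun x t => -F x t) :=
  ⟨hF.cont.neg, by simpa only [abs_neg] using hF.bound⟩

theorem RapidDecay.sub (hθ : ∀ t ∈ Ioo (0:ℝ) T, 1 ≤ θ t)
    (hF : RapidDecay d L T θ F) (hG : RapidDecay d L T θ G) :
    RapidDecay d L T θ (fun x t => F x t - G x t) := by
  simpa only [sub_eq_add_neg] using hF.add hθ hG.neg

theorem PolyGrowth.mul_rapidDecay (hθ : ∀ t ∈ Ioo (0:ℝ) T, 1 ≤ θ t)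
    (hF : PolyGrowth d L T θ F) (hG : RapidDecay d L T θ G) :
    RapidDecay d L T θ (fun x t => F x t * G x t) := by
  refine ⟨hF.cont.mul hG.cont, fun m => ?_⟩
  obtain ⟨K₁, hK₁, m₁, h₁⟩ := hF.bound
  obtain ⟨K₂, hK₂, h₂⟩ := hG.bound (m₁ + m)
  refine ⟨K₁ * K₂, by positivity, fun x hx t ht => ?_⟩
  have h0 : 0 ≤ θ t := zero_le_one.trans (hθ t ht)
  rw [abs_mul]
  calc |F x t| * |G x t| * θ t ^ m ≤ (K₁ * θ t ^ m₁) * |G x t| * θ t ^ m := by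
        gcongr; exact h₁ x hx t ht
    _ = K₁ * (|G x t| * θ t ^ (m₁ + m)) := by ring
    _ ≤ K₁ * K₂ := by gcongr; exact h₂ x hx t ht

theorem RapidDecay.sq (hθ : ∀ t ∈ Ioo (0:ℝ) T, 1 ≤ θ t) (hF : RapidDecay d L T θ F) :
    RapidDecay d L T θ (fun x t => F x t ^ 2) := by
  simpa only [pow_two] using hF.toPolyGrowth.mul_rapidDecay hθ hF

theorem RapidDecay.integrableOn (hF : RapidDecay d L T θ F) :
    IntegrableOn (fun p : ℝ × ℝ => F p.1 p.2) (Icc (-L) (d + L) ×ˢ Ioo 0 T)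
      (volume.prod volume) := by
  obtain ⟨K, hK, h⟩ := hF.bound 0
  have hm : MeasurableSet (Icc (-L) (d + L) ×ˢ Ioo (0:ℝ) T) :=
    measurableSet_Icc.prod measurableSet_Ioo
  refine ⟨(hF.cont.mono (prod_mono_left (subset_univ _))).aestronglyMeasurable hm,
    HasFiniteIntegral.restrict_of_bounded K ?_ ?_⟩
  · rw [Measure.prod_prod]
    exact ENNReal.mul_lt_top (by simp) (by simp)
  · refine (ae_restrict_mem hm).mono fun p hp => ?_
    simpa using h p.1 hp.1 p.2 hp.2

theorem II_eq_setIntegral (hd : 0 < d) (hL : 0 < L) (hT : 0 < T) (F : ℝ → ℝ → ℝ) :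
    II d L T F = ∫ t in Ioo 0 T, ∫ x in Icc (-L) (d + L), F x t := by
  unfold II
  rw [intervalIntegral.integral_of_le hT.le, integral_Ioc_eq_integral_Ioo]
  refine integral_congr_ae (Eventually.of_forall fun t => ?_)
  simp only
  rw [intervalIntegral.integral_of_le (by linarith), integral_Icc_eq_integral_Ioc]

theorem RapidDecay.II_eq_swap (hd : 0 < d) (hL : 0 < L) (hT : 0 < T)
    (hF : RapidDecay d L T θ F) :
    II d L T F = ∫ x in Icc (-L) (d + L), ∫ t in Ioo 0 T, F x t := by
  rw [II_eq_setIntegral hd hL hT]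
  refine (integral_integral_swap (f := F) ?_).symm
  rw [Measure.prod_restrict]
  exact hF.integrableOn

theorem RapidDecay.II_eq_prod (hd : 0 < d) (hL : 0 < L) (hT : 0 < T)
    (hF : RapidDecay d L T θ F) :
    II d L T F = ∫ p in Icc (-L) (d + L) ×ˢ Ioo 0 T, F p.1 p.2 ∂(volume.prod volume) := by
  rw [hF.II_eq_swap hd hL hT]
  exact (setIntegral_prod _ hF.integrableOn).symm

theorem II_add (hd : 0 < d) (hL : 0 < L) (hT : 0 < T) (hθ : ∀ t ∈ Ioo (0:ℝ) T, 1 ≤ θ t)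
    (hF : RapidDecay d L T θ F) (hG : RapidDecay d L T θ G) :
    II d L T (fun x t => F x t + G x t) = II d L T F + II d L T G := by
  rw [hF.II_eq_prod hd hL hT, hG.II_eq_prod hd hL hT, (hF.add hθ hG).II_eq_prod hd hL hT]
  exact integral_add hF.integrableOn hG.integrableOn

theorem II_const_mul (r : ℝ) (F : ℝ → ℝ → ℝ) :
    II d L T (fun x t => r * F x t) = r * II d L T F := by
  simp [II, intervalIntegral.integral_const_mul]

theorem II_mono (hd : 0 < d) (hL : 0 < L) (hT : 0 < T)
    (hF : RapidDecay d L T θ F) (hG : RapidDecay d L T θ G)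
    (h : ∀ x ∈ Icc (-L) (d + L), ∀ t ∈ Ioo (0:ℝ) T, F x t ≤ G x t) :
    II d L T F ≤ II d L T G := by
  rw [hF.II_eq_prod hd hL hT, hG.II_eq_prod hd hL hT]
  exact setIntegral_mono_on hF.integrableOn hG.integrableOn
    (measurableSet_Icc.prod measurableSet_Ioo) fun p hp => h p.1 hp.1 p.2 hp.2

theorem II_congr (hd : 0 < d) (hL : 0 < L) (hT : 0 < T)
    (h : ∀ x, ∀ t ∈ Ioo (0:ℝ) T, F x t = G x t) :
    II d L T F = II d L T G := by
  rw [II_eq_setIntegral hd hL hT, II_eq_setIntegral hd hL hT]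
  refine setIntegral_congr_fun measurableSet_Ioo fun t ht => ?_
  simp only [h _ t ht]

theorem continuous_slice_space (hF : ContinuousOn (fun p : ℝ × ℝ => F p.1 p.2) (univ ×ˢ Ioo 0 T))
    {t : ℝ} (ht : t ∈ Ioo 0 T) : Continuous fun x => F x t := by
  rw [← continuousOn_univ]
  exact hF.comp (f := fun x : ℝ => (x, t)) (by fun_prop) fun x _ => ⟨mem_univ _, ht⟩

theorem continuousOn_slice_time
    (hF : ContinuousOn (fun p : ℝ × ℝ => F p.1 p.2) (univ ×ˢ Ioo 0 T)) (x : ℝ) :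
    ContinuousOn (fun t => F x t) (Ioo 0 T) :=
  hF.comp (f := fun t : ℝ => (x, t)) (by fun_prop) fun t ht => ⟨mem_univ _, ht⟩

theorem II_space_deriv_eq_zero (hd : 0 < d) (hL : 0 < L) (hT : 0 < T) {X Xx : ℝ → ℝ → ℝ}
    (hXx : RapidDecay d L T θ Xx)
    (hder : ∀ x, ∀ t ∈ Ioo (0:ℝ) T, HasDerivAt (fun y => X y t) (Xx x t) x)
    (hper : ∀ t ∈ Ioo (0:ℝ) T, X (-L) t = X (d + L) t) :
    II d L T Xx = 0 := by
  rw [II_eq_setIntegral hd hL hT]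
  refine (setIntegral_congr_fun (g := fun _ => (0:ℝ)) measurableSet_Ioo fun t ht => ?_).trans
    (by simp)
  simp only
  rw [integral_Icc_eq_integral_Ioc, ← intervalIntegral.integral_of_le (by linarith),
    intervalIntegral.integral_eq_sub_of_hasDerivAt (fun x _ => hder x t ht)
      (continuous_slice_space hXx.cont ht).continuousOn.intervalIntegrable, hper t ht, sub_self]

theorem RapidDecay.tendsto_zero (hF : RapidDecay d L T θ F) {x : ℝ} (hx : x ∈ Icc (-L) (d + L))
    (hθ : ∀ t ∈ Ioo (0:ℝ) T, 1 ≤ θ t)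
    {l : Filter ℝ} (hl : ∀ᶠ t in l, t ∈ Ioo 0 T) (hlim : Tendsto θ l atTop) :
    Tendsto (fun t => F x t) l (𝓝 0) := by
  obtain ⟨K, hK, h⟩ := hF.bound 1
  have h1 : Tendsto (fun t => K * (θ t)⁻¹) l (𝓝 0) := by
    simpa using (tendsto_inv_atTop_zero.comp hlim).const_mul K
  refine squeeze_zero_norm' (hl.mono fun t ht => ?_) h1
  have h0 : 0 < θ t := zero_lt_one.trans_le (hθ t ht)
  rw [Real.norm_eq_abs, ← div_eq_mul_inv, le_div_iff₀ h0]
  simpa using h x hx t ht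

theorem II_time_deriv_eq_zero (hd : 0 < d) (hL : 0 < L) (hT : 0 < T)
    (hθ : ∀ t ∈ Ioo (0:ℝ) T, 1 ≤ θ t)
    (hθ₀ : Tendsto θ (𝓝[>] 0) atTop) (hθT : Tendsto θ (𝓝[<] T) atTop)
    {Y Yt : ℝ → ℝ → ℝ} (hY : RapidDecay d L T θ Y) (hYt : RapidDecay d L T θ Yt)
    (hder : ∀ x, ∀ t ∈ Ioo (0:ℝ) T, HasDerivAt (fun τ => Y x τ) (Yt x t) t) :
    II d L T Yt = 0 := by
  rw [hYt.II_eq_swap hd hL hT]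
  refine (setIntegral_congr_fun (g := fun _ => (0:ℝ)) measurableSet_Icc fun x hx => ?_).trans
    (by simp)
  simp only
  obtain ⟨K, hK, h⟩ := hYt.bound 0
  have hint : IntegrableOn (fun t => Yt x t) (Ioo 0 T) :=
    ⟨(continuousOn_slice_time hYt.cont x).aestronglyMeasurable measurableSet_Ioo,
      HasFiniteIntegral.restrict_of_bounded K (by simp)
      ((ae_restrict_mem measurableSet_Ioo).mono fun t ht => by simpa using h x hx t ht)⟩
  rw [← integral_Ioc_eq_integral_Ioo, ← intervalIntegral.integral_of_le hT.le,
    intervalIntegral.integral_eq_sub_of_hasDerivAt_of_tendsto hT (fun t ht => hder x t ht)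
      ((intervalIntegrable_iff_integrableOn_Ioo_of_le hT.le).2 hint)
      (hY.tendsto_zero hx hθ (Ioo_mem_nhdsGT hT) hθ₀)
      (hY.tendsto_zero hx hθ (Ioo_mem_nhdsLT hT) hθT), sub_self]

end Growth

section Algebra

theorem mul_le_eps_sq {ε : ℝ} (hε : 0 < ε) (a b : ℝ) : a * b ≤ ε * a ^ 2 + (4 * ε)⁻¹ * b ^ 2 := by
  have h : ε * a ^ 2 + (4 * ε)⁻¹ * b ^ 2 - a * b = ε * (a - (2 * ε)⁻¹ * b) ^ 2 := by
    field_simp; ring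
  have := mul_nonneg hε.le (sq_nonneg (a - (2 * ε)⁻¹ * b))
  linarith

theorem sq_le_of_abs_le {x y : ℝ} (h : |x| ≤ y) : x ^ 2 ≤ y ^ 2 := by
  rw [← sq_abs]; exact pow_le_pow_left₀ (abs_nonneg _) h 2

/-- Pointwise form of the local gradient estimate; the last line is the `x`-derivative of
`σ ρᵏ f fₓ` for conjugated functions. -/
theorem space_local_pointwise {K ε : ℝ} (hK : 1 ≤ K) (hε : 0 < ε) (k : ℕ) :
    ∃ C, 0 ≤ C ∧ ∀ ρ lam σ σ1 h f fx fxx : ℝ, 1 ≤ lam → lam ≤ ρ → 0 ≤ σ → σ ^ 2 ≤ K * σ →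
      σ1 ^ 2 ≤ K * σ → |h| ≤ K →
      σ * ρ ^ k * fx ^ 2 ≤ ε * (ρ ^ k * (ρ⁻¹ ^ 2 * fxx ^ 2 + fx ^ 2))
        + C * (σ * ρ ^ (k + 2) * f ^ 2)
        + (σ1 * ρ ^ k * (f * fx) + k * lam * h * σ * ρ ^ k * (f * fx)
          + σ * ρ ^ k * ((fx + h * ρ * f) * fx + f * (fxx + h * ρ * fx))) := by
  refine ⟨(4 * ε)⁻¹ * (K + 3 * (K + k ^ 2 * K ^ 3 + 4 * K ^ 3)), by positivity, ?_⟩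
  intro ρ lam σ σ1 h f fx fxx hlam hρ hσ hσ2 hσ1 hh
  have hρ0 : 0 < ρ := by linarith
  have hρ1 : 1 ≤ ρ := by linarith
  have hρ2 : 1 ≤ ρ ^ 2 := one_le_pow₀ hρ1
  have hl2 : lam ^ 2 ≤ ρ ^ 2 := by gcongr
  have hh2 : h ^ 2 ≤ K ^ 2 := sq_le_of_abs_le hh
  set B := σ1 + k * lam * h * σ + 2 * σ * h * ρ with hB
  have hB2 : B ^ 2 ≤ 3 * (K + k ^ 2 * K ^ 3 + 4 * K ^ 3) * (σ * ρ ^ 2) := by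
    have h1 : B ^ 2 ≤ 3 * (σ1 ^ 2 + (k * lam * h * σ) ^ 2 + (2 * σ * h * ρ) ^ 2) := by
      nlinarith [sq_nonneg (σ1 - k * lam * h * σ), sq_nonneg (σ1 - 2 * σ * h * ρ),
        sq_nonneg (k * lam * h * σ - 2 * σ * h * ρ)]
    have h2 : σ1 ^ 2 ≤ K * (σ * ρ ^ 2) := by
      calc σ1 ^ 2 ≤ K * σ := hσ1
        _ = K * (σ * 1) := by ring
        _ ≤ _ := by gcongr
    have h3 : (k * lam * h * σ) ^ 2 ≤ k ^ 2 * K ^ 3 * (σ * ρ ^ 2) := by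
      calc (k * lam * h * σ) ^ 2 = k ^ 2 * lam ^ 2 * h ^ 2 * σ ^ 2 := by ring
        _ ≤ k ^ 2 * ρ ^ 2 * K ^ 2 * (K * σ) := by gcongr
        _ = _ := by ring
    have h4 : (2 * σ * h * ρ) ^ 2 ≤ 4 * K ^ 3 * (σ * ρ ^ 2) := by
      calc (2 * σ * h * ρ) ^ 2 = 4 * σ ^ 2 * h ^ 2 * ρ ^ 2 := by ring
        _ ≤ 4 * (K * σ) * K ^ 2 * ρ ^ 2 := by gcongr
        _ = _ := by ring
    linarith
  have y1 := mul_le_eps_sq hε (ρ⁻¹ * fxx) (-(σ * ρ * f))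
  have y2 := mul_le_eps_sq hε fx (-(B * f))
  have e1 : ρ⁻¹ * fxx * -(σ * ρ * f) = -(σ * f * fxx) := by field_simp
  have z1 : (σ * ρ * f) ^ 2 ≤ K * (σ * ρ ^ 2 * f ^ 2) := by
    calc (σ * ρ * f) ^ 2 = σ ^ 2 * (ρ ^ 2 * f ^ 2) := by ring
      _ ≤ K * σ * (ρ ^ 2 * f ^ 2) := by gcongr
      _ = _ := by ring
  have z2 : (B * f) ^ 2 ≤ 3 * (K + k ^ 2 * K ^ 3 + 4 * K ^ 3) * (σ * ρ ^ 2 * f ^ 2) := by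
    calc (B * f) ^ 2 = B ^ 2 * f ^ 2 := by ring
      _ ≤ 3 * (K + k ^ 2 * K ^ 3 + 4 * K ^ 3) * (σ * ρ ^ 2) * f ^ 2 := by gcongr
      _ = _ := by ring
  have hi : 0 ≤ (4 * ε)⁻¹ := by positivity
  have z1' := mul_le_mul_of_nonneg_left z1 hi
  have z2' := mul_le_mul_of_nonneg_left z2 hi
  rw [e1, neg_sq] at y1
  rw [neg_sq] at y2
  have key : 0 ≤ ε * (ρ⁻¹ ^ 2 * fxx ^ 2 + fx ^ 2)
      + (4 * ε)⁻¹ * (K + 3 * (K + k ^ 2 * K ^ 3 + 4 * K ^ 3)) * (σ * ρ ^ 2 * f ^ 2)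
      + (σ * f * fxx + B * f * fx) := by
    linear_combination y1 + y2 + z1' + z2'
  have := mul_nonneg (pow_nonneg hρ0.le k) key
  rw [hB] at this
  linear_combination this

/-- Pointwise form of the first order estimate; the first bracket on the right is the
`x`-derivative of `ρᵏ⁺¹ η' f²` for conjugated functions. -/
theorem space_static_pointwise {K c : ℝ} (hc : 0 < c) (k : ℕ)
    {ρ lam σ h h2 f fx : ℝ} (hlam : 1 ≤ lam) (hρ : 1 ≤ ρ) (hKρ : 2 * K ≤ c * ρ)
    (hcσ : c ≤ h ^ 2 + σ) (hh : |h| ≤ K) (hh2 : |h2| ≤ K) :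
    c * (ρ ^ (k + 2) * f ^ 2) ≤
      (((k + 1) * lam * h ^ 2 + h2) * ρ ^ (k + 1) * f ^ 2
        + 2 * ρ ^ (k + 1) * h * (f * (fx + h * ρ * f)))
      + 2 * (σ * ρ ^ (k + 2) * f ^ 2) + 2 * K ^ 2 / c * (ρ ^ k * fx ^ 2) := by
  have hρ0 : 0 < ρ := by linarith
  have hhs : h ^ 2 ≤ K ^ 2 := sq_le_of_abs_le hh
  have y := mul_le_eps_sq (ε := c / 2) (by positivity) (ρ * f) (-(2 * h * fx))
  have e1 : (4 * (c / 2))⁻¹ * (-(2 * h * fx)) ^ 2 = 2 / c * h ^ 2 * fx ^ 2 := by field_simp; ring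
  rw [e1] at y
  have z1 : 2 / c * h ^ 2 * fx ^ 2 ≤ 2 / c * K ^ 2 * fx ^ 2 := by gcongr
  have z2 : 0 ≤ (c / 2 * ρ + h2) * (ρ * f ^ 2) := by
    have := (abs_le.1 hh2).1
    exact mul_nonneg (by linarith) (by positivity)
  have z3 : 0 ≤ (k + 1) * lam * h ^ 2 * (ρ * f ^ 2) := by positivity
  have z4 : 0 ≤ (h ^ 2 + σ - c) * (ρ ^ 2 * f ^ 2) := mul_nonneg (by linarith) (by positivity)
  have key : 0 ≤ ((k + 1) * lam * h ^ 2 + h2) * ρ * f ^ 2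
        + 2 * ρ * h * (f * (fx + h * ρ * f))
      + 2 * (σ * ρ ^ 2 * f ^ 2) + 2 / c * K ^ 2 * fx ^ 2 - c * (ρ ^ 2 * f ^ 2) := by
    linear_combination y + z1 + z2 + z3 + 2 * z4
  have := mul_nonneg (pow_nonneg hρ0.le k) key
  linear_combination this

/-- Pointwise form of the local time-derivative estimate; the last line is the `t`-derivative of
`σ ρ³ f fₜ` for conjugated functions. -/
theorem time_local_pointwise {K ε : ℝ} (hK : 1 ≤ K) (hε : 0 < ε) :
    ∃ C, 0 ≤ C ∧ ∀ ρ σ rt lt f ft ftt : ℝ, 1 ≤ ρ → 0 ≤ σ → σ ^ 2 ≤ K * σ →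
      |rt| ≤ K * ρ ^ 2 → |lt| ≤ K * ρ ^ 2 →
      σ * ρ ^ 3 * ft ^ 2 ≤ ε * (ρ⁻¹ * ftt ^ 2 + ρ ^ 3 * ft ^ 2)
        + C * (σ * ρ ^ 7 * f ^ 2)
        + (3 * σ * ρ ^ 2 * rt * (f * ft)
          + σ * ρ ^ 3 * ((ft - lt * f) * ft + f * (ftt - lt * ft))) := by
  refine ⟨(4 * ε)⁻¹ * (K + 25 * K ^ 3), by positivity, ?_⟩
  intro ρ σ rt lt f ft ftt hρ hσ hσ2 hrt hlt
  have hρ0 : 0 < ρ := by linarith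
  set B := 3 * rt * ρ⁻¹ - 2 * lt with hB
  have hBa : |B| ≤ 5 * K * ρ ^ 2 := by
    have h1 : |rt * ρ⁻¹| ≤ K * ρ ^ 2 := by
      rw [abs_mul, abs_of_pos (inv_pos.2 hρ0)]
      calc |rt| * ρ⁻¹ ≤ |rt| * 1 := by
            gcongr; exact inv_le_one_of_one_le₀ hρ
        _ ≤ _ := by linarith
    rw [abs_le] at *
    constructor <;> rw [hB] <;> nlinarith [h1.1, h1.2, hlt.1, hlt.2]
  have hB2 : B ^ 2 ≤ 25 * K ^ 2 * ρ ^ 4 := (sq_le_of_abs_le hBa).trans_eq (by ring)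
  have y1 := mul_le_eps_sq hε (ρ⁻¹ ^ 2 * ftt) (-(σ * ρ ^ 2 * f))
  have y2 := mul_le_eps_sq hε ft (-(σ * B * f))
  have e1 : ρ⁻¹ ^ 2 * ftt * -(σ * ρ ^ 2 * f) = -(σ * f * ftt) := by field_simp
  have z1 : (σ * ρ ^ 2 * f) ^ 2 ≤ K * (σ * ρ ^ 4 * f ^ 2) := by
    calc (σ * ρ ^ 2 * f) ^ 2 = σ ^ 2 * (ρ ^ 4 * f ^ 2) := by ring
      _ ≤ K * σ * (ρ ^ 4 * f ^ 2) := by gcongr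
      _ = _ := by ring
  have z2 : (σ * B * f) ^ 2 ≤ 25 * K ^ 3 * (σ * ρ ^ 4 * f ^ 2) := by
    calc (σ * B * f) ^ 2 = σ ^ 2 * B ^ 2 * f ^ 2 := by ring
      _ ≤ (K * σ) * (25 * K ^ 2 * ρ ^ 4) * f ^ 2 := by gcongr
      _ = _ := by ring
  have hi : 0 ≤ (4 * ε)⁻¹ := by positivity
  have z1' := mul_le_mul_of_nonneg_left z1 hi
  have z2' := mul_le_mul_of_nonneg_left z2 hi
  rw [e1, neg_sq] at y1
  rw [neg_sq] at y2
  have key : 0 ≤ ε * (ρ⁻¹ ^ 4 * ftt ^ 2 + ft ^ 2)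
      + (4 * ε)⁻¹ * (K + 25 * K ^ 3) * (σ * ρ ^ 4 * f ^ 2)
      + (σ * f * ftt + σ * B * f * ft) := by
    linear_combination y1 + y2 + z1' + z2'
  have := mul_nonneg (pow_nonneg hρ0.le 3) key
  have e2 : ρ ^ 3 * (ε * (ρ⁻¹ ^ 4 * ftt ^ 2 + ft ^ 2)
      + (4 * ε)⁻¹ * (K + 25 * K ^ 3) * (σ * ρ ^ 4 * f ^ 2)
      + (σ * f * ftt + σ * B * f * ft)) = ε * (ρ⁻¹ * ftt ^ 2 + ρ ^ 3 * ft ^ 2)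
        + (4 * ε)⁻¹ * (K + 25 * K ^ 3) * (σ * ρ ^ 7 * f ^ 2)
        + (3 * σ * ρ ^ 2 * rt * (f * ft)
          + σ * ρ ^ 3 * ((ft - lt * f) * ft + f * (ftt - lt * ft))) - σ * ρ ^ 3 * ft ^ 2 := by
    rw [hB]; field_simp; ring
  linarith

end Algebra

section ParabolicAlgebra

theorem commutator_identity (lam ρ rt h h2 h3 β p px pt pxx pxt q qx qt qxx qxt : ℝ) :
    2 * ((pxx + h ^ 2 * ρ ^ 2 * p + β * qt) * (pt / 2 - 2 * h * ρ * px - (lam * h ^ 2 + h2) * ρ * p)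
      + (qxx + h ^ 2 * ρ ^ 2 * q - β * pt) * (qt / 2 - 2 * h * ρ * qx - (lam * h ^ 2 + h2) * ρ * q))
    = 4 * (lam * h ^ 2 + h2) * ρ * (px ^ 2 + qx ^ 2)
      + 4 * h ^ 2 * (lam * h ^ 2 + h2) * ρ ^ 3 * (p ^ 2 + q ^ 2)
      + 2 * (h3 + 3 * lam * h * h2 + lam ^ 2 * h ^ 3) * ρ * (px * p + qx * q)
      - h ^ 2 * ρ * rt * (p ^ 2 + q ^ 2) - 2 * β * h * rt * (qx * p - px * q)
      + ((pxx * pt + px * pxt + (qxx * qt + qx * qxt))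
      - (2 * h2 * ρ + 2 * h * (lam * h * ρ)) * (px ^ 2 + qx ^ 2)
      - 2 * h * ρ * (2 * px * pxx + 2 * qx * qxx)
      - (2 * (2 * lam * h * h2 + h3) * ρ + 2 * (lam * h ^ 2 + h2) * (lam * h * ρ))
        * (px * p + qx * q)
      - 2 * (lam * h ^ 2 + h2) * ρ * (pxx * p + px ^ 2 + qxx * q + qx ^ 2)
      - (6 * h ^ 2 * h2 * ρ ^ 3 + 6 * h ^ 3 * ρ ^ 2 * (lam * h * ρ)) * (p ^ 2 + q ^ 2)
      - 2 * h ^ 3 * ρ ^ 3 * (2 * p * px + 2 * q * qx)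
      - 2 * β * (h2 * ρ + h * (lam * h * ρ)) * (qt * p - pt * q)
      - 2 * β * h * ρ * (qxt * p + qt * px - pxt * q - pt * qx))
      + (-(px * pxt + qx * qxt) + h ^ 2 * ρ * rt * (p ^ 2 + q ^ 2)
      + h ^ 2 * ρ ^ 2 * (p * pt + q * qt) + 2 * β * h * rt * (qx * p - px * q)
      + 2 * β * h * ρ * (qxt * p + qx * pt - pxt * q - px * qt)) := by
  ring

theorem sq_mul_abs_le {ρ : ℝ} (hρ : 0 ≤ ρ) (a b c d : ℝ) :
    ρ ^ 2 * |a * b + c * d| ≤ (ρ * (a ^ 2 + c ^ 2) + ρ ^ 3 * (b ^ 2 + d ^ 2)) / 2 := by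
  rw [← abs_of_nonneg (sq_nonneg ρ), ← abs_mul, abs_le]
  constructor
  · linarith [mul_nonneg hρ (add_nonneg (sq_nonneg (a + ρ * b)) (sq_nonneg (c + ρ * d)))]
  · linarith [mul_nonneg hρ (add_nonneg (sq_nonneg (a - ρ * b)) (sq_nonneg (c - ρ * d)))]

set_option maxHeartbeats 1000000 in
theorem commutator_lower_bound {K c s lam ρ rt lt h h2 h3 σ β p px q qx : ℝ}
    (hβ : β ^ 2 = 3 / 4) (hK : 1 ≤ K) (hc : 0 < c) (hc1 : c ≤ 1)
    (hs : 9 * K ^ 3 ≤ c ^ 2 * s) (hlam1 : 1 ≤ lam) (hlam : 8 * K ^ 3 ≤ c ^ 2 * lam)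
    (hρ : s * lam ≤ ρ) (hcσ : c ≤ h ^ 2 + σ) (hσ : 0 ≤ σ)
    (hh : |h| ≤ K) (hh2 : |h2| ≤ K) (hh3 : |h3| ≤ K)
    (hrt : |rt| * (s * lam) ≤ K * ρ ^ 2) (hlt : lt ^ 2 * s ≤ K * ρ ^ 3) :
    2 * c ^ 2 * (lam * (ρ * (px ^ 2 + qx ^ 2) + ρ ^ 3 * (p ^ 2 + q ^ 2)))
      - 8 * (lam * σ * (ρ * (px ^ 2 + qx ^ 2) + ρ ^ 3 * (p ^ 2 + q ^ 2)))
    ≤ 4 * (lam * h ^ 2 + h2) * ρ * (px ^ 2 + qx ^ 2)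
      + 4 * h ^ 2 * (lam * h ^ 2 + h2) * ρ ^ 3 * (p ^ 2 + q ^ 2)
      + 2 * (h3 + 3 * lam * h * h2 + lam ^ 2 * h ^ 3) * ρ * (px * p + qx * q)
      - h ^ 2 * ρ * rt * (p ^ 2 + q ^ 2) - 2 * β * h * rt * (qx * p - px * q)
      - 2 * lt ^ 2 * (p ^ 2 + q ^ 2) := by
  have hK3 : K ≤ K ^ 3 := le_self_pow₀ hK (by norm_num)
  have hK32 : K ^ 2 ≤ K ^ 3 := pow_le_pow_right₀ hK (by norm_num)
  have hc2 : c ^ 2 ≤ 1 := pow_le_one₀ hc.le hc1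
  have hs1 : 1 ≤ s := by
    have : 1 ≤ K ^ 3 := one_le_pow₀ hK
    by_contra! hlt1
    have : c ^ 2 * s ≤ 1 * 1 := by
      rcases le_or_gt 0 s with h0 | h0
      · gcongr
      · nlinarith [sq_nonneg c]
    linarith
  have hs0 : 0 < s := by linarith
  have hl0 : 0 < lam := by linarith
  have hρl : lam ≤ ρ := by nlinarith
  have hρ0 : 0 < ρ := by linarith
  have hhs : h ^ 2 ≤ K ^ 2 := sq_le_of_abs_le hh
  obtain ⟨N0, hN0⟩ : ∃ N0, N0 = p ^ 2 + q ^ 2 := ⟨_, rfl⟩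
  obtain ⟨N1, hN1⟩ : ∃ N1, N1 = px ^ 2 + qx ^ 2 := ⟨_, rfl⟩
  obtain ⟨H2, hH2⟩ : ∃ H2, H2 = h3 + 3 * lam * h * h2 + lam ^ 2 * h ^ 3 := ⟨_, rfl⟩
  obtain ⟨B, hB⟩ : ∃ B, B = ρ * N1 + ρ ^ 3 * N0 := ⟨_, rfl⟩
  rw [← hN0, ← hN1, ← hH2, ← hB]
  have hN0' : 0 ≤ N0 := by rw [hN0]; positivity
  have hN1' : 0 ≤ N1 := by rw [hN1]; positivity
  have hB0 : 0 ≤ B := by rw [hB]; positivity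
  have cross1 : ρ ^ 2 * |px * p + qx * q| ≤ B / 2 := by
    rw [hB, hN0, hN1]; exact sq_mul_abs_le hρ0.le px p qx q
  have cross2 : ρ ^ 2 * |qx * p - px * q| ≤ B / 2 := by
    have := sq_mul_abs_le hρ0.le qx p px (-q)
    rw [hB, hN0, hN1]
    rwa [mul_neg, ← sub_eq_add_neg, neg_sq, add_comm (qx ^ 2)] at this
  have hN0B : ρ ^ 3 * N0 ≤ B := by rw [hB]; nlinarith [mul_nonneg hρ0.le hN1']
  have hH2a : |H2| ≤ 5 * K ^ 3 * lam ^ 2 := by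
    have hl2 : 1 ≤ lam ^ 2 := one_le_pow₀ hlam1
    have hl12 : lam ≤ lam ^ 2 := le_self_pow₀ hlam1 (by norm_num)
    calc |H2| = |h3 + 3 * lam * h * h2 + lam ^ 2 * h ^ 3| := by rw [hH2]
      _ ≤ |h3| + |3 * lam * h * h2| + |lam ^ 2 * h ^ 3| := abs_add_three _ _ _
      _ = |h3| + 3 * lam * |h| * |h2| + lam ^ 2 * |h| ^ 3 := by
          simp [abs_mul, abs_pow, abs_of_pos hl0]
      _ ≤ K + 3 * lam * K * K + lam ^ 2 * K ^ 3 := by gcongr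
      _ ≤ K ^ 3 * lam ^ 2 + 3 * lam ^ 2 * K ^ 3 + lam ^ 2 * K ^ 3 := by
          have : K * 1 ≤ K ^ 3 * lam ^ 2 := by gcongr
          have : 3 * lam * (K ^ 2) ≤ 3 * lam ^ 2 * K ^ 3 := by gcongr
          linarith
      _ = _ := by ring
  have E1 : s * |2 * H2 * ρ * (px * p + qx * q)| ≤ 5 * K ^ 3 * lam * B := by
    rw [abs_mul, abs_mul, abs_mul, abs_of_pos hρ0, abs_of_pos (zero_lt_two' ℝ)]
    calc s * (2 * |H2| * ρ * |px * p + qx * q|)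
        ≤ s * (2 * (5 * K ^ 3 * lam ^ 2) * ρ * |px * p + qx * q|) := by gcongr
      _ = 10 * K ^ 3 * lam * (s * lam) * ρ * |px * p + qx * q| := by ring
      _ ≤ 10 * K ^ 3 * lam * ρ * ρ * |px * p + qx * q| := by gcongr
      _ = 10 * K ^ 3 * lam * (ρ ^ 2 * |px * p + qx * q|) := by ring
      _ ≤ 10 * K ^ 3 * lam * (B / 2) := by gcongr
      _ = _ := by ring
  have hrt' : s * |rt| ≤ K * ρ ^ 2 :=
    le_trans (by nlinarith [mul_nonneg hs0.le (abs_nonneg rt)]) hrt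
  have E2 : s * (h ^ 2 * ρ * rt * N0) ≤ K ^ 3 * lam * B := by
    calc s * (h ^ 2 * ρ * rt * N0) ≤ s * (h ^ 2 * ρ * |rt| * N0) := by
          gcongr; exact le_abs_self _
      _ = h ^ 2 * ρ * (s * |rt|) * N0 := by ring
      _ ≤ K ^ 2 * ρ * (K * ρ ^ 2) * N0 := by gcongr
      _ = K ^ 3 * 1 * (ρ ^ 3 * N0) := by ring
      _ ≤ K ^ 3 * lam * B := by gcongr
  have hβa : |β| ≤ 1 := abs_le_one_iff_mul_self_le_one.2 (by nlinarith)
  have E3 : s * |2 * β * h * rt * (qx * p - px * q)| ≤ K ^ 3 * lam * B := by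
    rw [abs_mul, abs_mul, abs_mul, abs_mul, abs_of_pos (zero_lt_two' ℝ)]
    calc s * (2 * |β| * |h| * |rt| * |qx * p - px * q|)
        = 2 * |β| * |h| * (s * |rt|) * |qx * p - px * q| := by ring
      _ ≤ 2 * 1 * K * (K * ρ ^ 2) * |qx * p - px * q| := by gcongr
      _ = 2 * K ^ 2 * (ρ ^ 2 * |qx * p - px * q|) := by ring
      _ ≤ 2 * K ^ 2 * (B / 2) := by gcongr
      _ = K ^ 2 * 1 * B := by ring
      _ ≤ K ^ 3 * lam * B := by gcongr
  have E4 : s * (2 * lt ^ 2 * N0) ≤ 2 * K ^ 3 * lam * B := by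
    calc s * (2 * lt ^ 2 * N0) = 2 * (lt ^ 2 * s) * N0 := by ring
      _ ≤ 2 * (K * ρ ^ 3) * N0 := by gcongr
      _ = 2 * K * 1 * (ρ ^ 3 * N0) := by ring
      _ ≤ 2 * K ^ 3 * lam * B := by gcongr
  have Esum : |2 * H2 * ρ * (px * p + qx * q)| + h ^ 2 * ρ * rt * N0
      + |2 * β * h * rt * (qx * p - px * q)| + 2 * lt ^ 2 * N0 ≤ c ^ 2 * (lam * B) := by
    refine le_of_mul_le_mul_left ?_ hs0
    have : 9 * K ^ 3 * (lam * B) ≤ c ^ 2 * s * (lam * B) := by gcongr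
    linarith
  have M1 : 4 * (lam * (c - σ) - K) * (ρ * N1) ≤ 4 * (lam * h ^ 2 + h2) * ρ * N1 := by
    have h1 := (abs_le.1 hh2).1
    have h2' : lam * (c - σ) ≤ lam * h ^ 2 := by gcongr; linarith
    have : 0 ≤ (lam * h ^ 2 + h2 - (lam * (c - σ) - K)) * (ρ * N1) :=
      mul_nonneg (by linarith) (by positivity)
    linarith
  have M2 : 4 * (lam * (c ^ 2 - 2 * σ) - K ^ 3) * (ρ ^ 3 * N0)
      ≤ 4 * h ^ 2 * (lam * h ^ 2 + h2) * ρ ^ 3 * N0 := by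
    have h4 : c ^ 2 - 2 * σ ≤ (h ^ 2) ^ 2 := by nlinarith [sq_nonneg (h ^ 2 - c)]
    have h4' : lam * (c ^ 2 - 2 * σ) ≤ lam * (h ^ 2) ^ 2 := by gcongr
    have h5 : -K ^ 3 ≤ h ^ 2 * h2 := by
      have : |h ^ 2 * h2| ≤ K ^ 3 := by
        rw [abs_mul, abs_of_nonneg (sq_nonneg h)]
        calc h ^ 2 * |h2| ≤ K ^ 2 * K := by gcongr
          _ = _ := by ring
      linarith [(abs_le.1 this).1]
    have : 0 ≤ (lam * (h ^ 2) ^ 2 + h ^ 2 * h2 - (lam * (c ^ 2 - 2 * σ) - K ^ 3)) * (ρ ^ 3 * N0) :=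
      mul_nonneg (by linarith) (by positivity)
    linarith
  have M3 : 4 * c ^ 2 * (lam * B) - 8 * (lam * σ * B) - 4 * K ^ 3 * B
      ≤ 4 * (lam * (c - σ) - K) * (ρ * N1) + 4 * (lam * (c ^ 2 - 2 * σ) - K ^ 3) * (ρ ^ 3 * N0) := by
    have h1 : c ^ 2 ≤ c := by nlinarith
    have h2' : lam * (c ^ 2 - 2 * σ) ≤ lam * (c - σ) := by gcongr; linarith
    have : 0 ≤ (lam * (c - σ) - K - (lam * (c ^ 2 - 2 * σ) - K ^ 3)) * (ρ * N1) :=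
      mul_nonneg (by linarith) (by positivity)
    rw [hB]; linarith
  have M4 : 8 * K ^ 3 * B ≤ c ^ 2 * (lam * B) := by
    rw [← mul_assoc]; gcongr
  have a1 := neg_abs_le (2 * H2 * ρ * (px * p + qx * q))
  have a2 := le_abs_self (2 * β * h * rt * (qx * p - px * q))
  have hp : 0 ≤ c ^ 2 * (lam * B) := by positivity
  linarith

/-- Lower bound for the conjugated complex parabolic operator. Here `p + iq` is the conjugated
function, `R₁ + iR₂` its image, and the terms `Xx`, `Yt` are the divergence terms
of the commutator identity. -/
theorem conjugated_lower_bound {K c s lam ρ rt lt h h2 h3 σ β F : ℝ}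
    {p px pt pxx pxt q qx qt qxx qxt Xx Yt : ℝ}
    (hβ : β ^ 2 = 3 / 4) (hK : 1 ≤ K) (hc : 0 < c) (hc1 : c ≤ 1)
    (hs : 9 * K ^ 3 ≤ c ^ 2 * s) (hlam1 : 1 ≤ lam) (hlam : 8 * K ^ 3 ≤ c ^ 2 * lam)
    (hρ : s * lam ≤ ρ) (hcσ : c ≤ h ^ 2 + σ) (hσ : 0 ≤ σ)
    (hh : |h| ≤ K) (hh2 : |h2| ≤ K) (hh3 : |h3| ≤ K)
    (hrt : |rt| * (s * lam) ≤ K * ρ ^ 2) (hlt : lt ^ 2 * s ≤ K * ρ ^ 3)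
    (hR₁ : pxx + h ^ 2 * ρ ^ 2 * p + β * qt + (pt / 2 - 2 * h * ρ * px
      - (lam * h ^ 2 + h2) * ρ * p) = F / 2 - lt * (p / 2 + β * q))
    (hR₂ : qxx + h ^ 2 * ρ ^ 2 * q - β * pt + (qt / 2 - 2 * h * ρ * qx
      - (lam * h ^ 2 + h2) * ρ * q) = -β * F - lt * (q / 2 - β * p))
    (hX : Xx = (pxx * pt + px * pxt + (qxx * qt + qx * qxt))
      - (2 * h2 * ρ + 2 * h * (lam * h * ρ)) * (px ^ 2 + qx ^ 2)
      - 2 * h * ρ * (2 * px * pxx + 2 * qx * qxx)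
      - (2 * (2 * lam * h * h2 + h3) * ρ + 2 * (lam * h ^ 2 + h2) * (lam * h * ρ))
        * (px * p + qx * q)
      - 2 * (lam * h ^ 2 + h2) * ρ * (pxx * p + px ^ 2 + qxx * q + qx ^ 2)
      - (6 * h ^ 2 * h2 * ρ ^ 3 + 6 * h ^ 3 * ρ ^ 2 * (lam * h * ρ)) * (p ^ 2 + q ^ 2)
      - 2 * h ^ 3 * ρ ^ 3 * (2 * p * px + 2 * q * qx)
      - 2 * β * (h2 * ρ + h * (lam * h * ρ)) * (qt * p - pt * q)
      - 2 * β * h * ρ * (qxt * p + qt * px - pxt * q - pt * qx))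
    (hY : Yt = -(px * pxt + qx * qxt) + h ^ 2 * ρ * rt * (p ^ 2 + q ^ 2)
      + h ^ 2 * ρ ^ 2 * (p * pt + q * qt) + 2 * β * h * rt * (qx * p - px * q)
      + 2 * β * h * ρ * (qxt * p + qx * pt - pxt * q - px * qt)) :
    (pt / 2 - 2 * h * ρ * px - (lam * h ^ 2 + h2) * ρ * p) ^ 2
      + (qt / 2 - 2 * h * ρ * qx - (lam * h ^ 2 + h2) * ρ * q) ^ 2
      + 2 * c ^ 2 * (lam * (ρ * (px ^ 2 + qx ^ 2) + ρ ^ 3 * (p ^ 2 + q ^ 2)))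
    ≤ 2 * F ^ 2 + 8 * (lam * σ * (ρ * (px ^ 2 + qx ^ 2) + ρ ^ 3 * (p ^ 2 + q ^ 2)))
      - (Xx + Yt) := by
  have ident := commutator_identity lam ρ rt h h2 h3 β p px pt pxx pxt q qx qt qxx qxt
  rw [← hX, ← hY] at ident
  have low := commutator_lower_bound (p := p) (px := px) (q := q) (qx := qx)
    hβ hK hc hc1 hs hlam1 hlam hρ hcσ hσ hh hh2 hh3 hrt hlt
  clear hX hY
  generalize hA₁ : pt / 2 - 2 * h * ρ * px - (lam * h ^ 2 + h2) * ρ * p = A₁ at *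
  generalize hA₂ : qt / 2 - 2 * h * ρ * qx - (lam * h ^ 2 + h2) * ρ * q = A₂ at *
  generalize hS₁ : pxx + h ^ 2 * ρ ^ 2 * p + β * qt = S₁ at *
  generalize hS₂ : qxx + h ^ 2 * ρ ^ 2 * q - β * pt = S₂ at *
  have hR : (S₁ + A₁) ^ 2 + (S₂ + A₂) ^ 2 ≤ 2 * F ^ 2 + 2 * lt ^ 2 * (p ^ 2 + q ^ 2) := by
    rw [hR₁, hR₂]
    have : (F / 2 - lt * (p / 2 + β * q)) ^ 2 + (-β * F - lt * (q / 2 - β * p)) ^ 2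
        = (F - lt * p) ^ 2 + (lt * q) ^ 2 := by
      linear_combination (F ^ 2 + lt ^ 2 * (p ^ 2 + q ^ 2) - 2 * F * lt * p) * hβ
    rw [this]
    linarith [sq_nonneg (F + lt * p), sq_nonneg (lt * q)]
  linarith [sq_nonneg S₁, sq_nonneg S₂]

end ParabolicAlgebra

section ParabolicRecovery

theorem recover_component {K lam ρ lt h h2 a a1 at' : ℝ} (hK : 1 ≤ K) (hlam1 : 1 ≤ lam)
    (hρl : lam ≤ ρ) (hh : |h| ≤ K) (hh2 : |h2| ≤ K) (hlt : lt ^ 2 ≤ K * ρ ^ 3) :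
    lam * (ρ⁻¹ * at' ^ 2 + ρ * a1 ^ 2 + ρ ^ 3 * a ^ 2) ≤
      260 * K ^ 4 * (((at' - lt * a) / 2 - 2 * h * ρ * (a1 + h * ρ * a)
        - (lam * h ^ 2 + h2) * ρ * a) ^ 2
        + lam * (ρ * (a1 + h * ρ * a) ^ 2 + ρ ^ 3 * a ^ 2)) := by
  have hρ0 : 0 < ρ := by linarith
  have hρ1 : 1 ≤ ρ := by linarith
  have hhs : h ^ 2 ≤ K ^ 2 := sq_le_of_abs_le hh
  have hK4 : 1 ≤ K ^ 4 := one_le_pow₀ hK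
  have hK14 : K ≤ K ^ 4 := le_self_pow₀ hK (by norm_num)
  have hK24 : K ^ 2 ≤ K ^ 4 := pow_le_pow_right₀ hK (by norm_num)
  obtain ⟨px, hpx⟩ : ∃ px, px = a1 + h * ρ * a := ⟨_, rfl⟩
  obtain ⟨H1, hH1⟩ : ∃ H1, H1 = lam * h ^ 2 + h2 := ⟨_, rfl⟩
  obtain ⟨A, hA⟩ : ∃ A, A = (at' - lt * a) / 2 - 2 * h * ρ * px - H1 * ρ * a := ⟨_, rfl⟩
  rw [← hpx, ← hH1, ← hA]
  have hH1a : |H1| ≤ 2 * K ^ 2 * lam := by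
    rw [hH1]
    calc |lam * h ^ 2 + h2| ≤ |lam * h ^ 2| + |h2| := abs_add_le _ _
      _ = lam * h ^ 2 + |h2| := by rw [abs_of_nonneg (by positivity)]
      _ ≤ lam * K ^ 2 + K * 1 := by rw [mul_one]; gcongr
      _ ≤ lam * K ^ 2 + K ^ 2 * lam := by gcongr; exact le_self_pow₀ hK (by norm_num)
      _ = _ := by ring
  have hH1s : H1 ^ 2 ≤ 4 * K ^ 4 * ρ ^ 2 := by
    calc H1 ^ 2 ≤ (2 * K ^ 2 * lam) ^ 2 := sq_le_of_abs_le hH1a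
      _ = 4 * K ^ 4 * lam ^ 2 := by ring
      _ ≤ _ := by gcongr
  have hat : at' = 2 * A + 4 * (h * ρ * px) + 2 * (H1 * ρ * a) + lt * a := by rw [hA]; ring
  have hat2 : at' ^ 2 ≤ 16 * A ^ 2 + 64 * (h * ρ * px) ^ 2 + 16 * (H1 * ρ * a) ^ 2
      + 4 * (lt * a) ^ 2 := by
    rw [hat]
    linarith [sq_nonneg (2 * A - 4 * (h * ρ * px)), sq_nonneg (2 * A - 2 * (H1 * ρ * a)),
      sq_nonneg (2 * A - lt * a), sq_nonneg (4 * (h * ρ * px) - 2 * (H1 * ρ * a)),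
      sq_nonneg (4 * (h * ρ * px) - lt * a), sq_nonneg (2 * (H1 * ρ * a) - lt * a)]
  have hhp : (h * ρ * px) ^ 2 ≤ K ^ 4 * (ρ ^ 2 * px ^ 2) := by
    calc (h * ρ * px) ^ 2 = h ^ 2 * (ρ ^ 2 * px ^ 2) := by ring
      _ ≤ K ^ 2 * (ρ ^ 2 * px ^ 2) := by gcongr
      _ ≤ _ := by gcongr
  have hHp : (H1 * ρ * a) ^ 2 ≤ 4 * K ^ 4 * (ρ ^ 4 * a ^ 2) := by
    calc (H1 * ρ * a) ^ 2 = H1 ^ 2 * (ρ ^ 2 * a ^ 2) := by ring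
      _ ≤ 4 * K ^ 4 * ρ ^ 2 * (ρ ^ 2 * a ^ 2) := by gcongr
      _ = _ := by ring
  have hlp : (lt * a) ^ 2 ≤ K ^ 4 * (ρ ^ 4 * a ^ 2) := by
    calc (lt * a) ^ 2 = lt ^ 2 * a ^ 2 := by ring
      _ ≤ K * ρ ^ 3 * a ^ 2 := by gcongr
      _ ≤ K ^ 4 * ρ ^ 4 * a ^ 2 := by gcongr; norm_num
      _ = _ := by ring
  have hA1 : lam * ρ⁻¹ * A ^ 2 ≤ A ^ 2 := by
    have : lam * ρ⁻¹ ≤ 1 := by rw [← div_eq_mul_inv]; exact (div_le_one hρ0).2 hρl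
    nlinarith [sq_nonneg A]
  have t1 : lam * (ρ⁻¹ * at' ^ 2) ≤ 16 * A ^ 2 + 132 * K ^ 4 * (lam * (ρ * px ^ 2 + ρ ^ 3 * a ^ 2)) := by
    have h0 : at' ^ 2 ≤ 16 * A ^ 2 + 132 * K ^ 4 * (ρ ^ 2 * px ^ 2 + ρ ^ 4 * a ^ 2) := by
      have n1 : 0 ≤ K ^ 4 * (ρ ^ 2 * px ^ 2) := by positivity
      have n2 : 0 ≤ K ^ 4 * (ρ ^ 4 * a ^ 2) := by positivity
      linarith
    have h1 : lam * ρ⁻¹ * at' ^ 2 ≤ lam * ρ⁻¹ * (16 * A ^ 2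
        + 132 * K ^ 4 * (ρ ^ 2 * px ^ 2 + ρ ^ 4 * a ^ 2)) := by gcongr
    have e : lam * ρ⁻¹ * (16 * A ^ 2 + 132 * K ^ 4 * (ρ ^ 2 * px ^ 2 + ρ ^ 4 * a ^ 2))
        = 16 * (lam * ρ⁻¹ * A ^ 2) + 132 * K ^ 4 * (lam * (ρ * px ^ 2 + ρ ^ 3 * a ^ 2)) := by
      field_simp
    rw [e] at h1
    linarith
  have t2 : lam * (ρ * a1 ^ 2) ≤ 2 * K ^ 4 * (lam * (ρ * px ^ 2 + ρ ^ 3 * a ^ 2)) := by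
    have h1 : a1 ^ 2 ≤ 2 * px ^ 2 + 2 * (h ^ 2 * (ρ ^ 2 * a ^ 2)) := by
      have : a1 = px - h * ρ * a := by rw [hpx]; ring
      rw [this]; linarith [sq_nonneg (px + h * ρ * a)]
    have h2' : h ^ 2 * (ρ ^ 2 * a ^ 2) ≤ K ^ 4 * (ρ ^ 2 * a ^ 2) := by
      gcongr; exact hhs.trans hK24
    have h3 : px ^ 2 ≤ K ^ 4 * px ^ 2 := le_mul_of_one_le_left (sq_nonneg _) hK4
    calc lam * (ρ * a1 ^ 2)
        ≤ lam * (ρ * (2 * (K ^ 4 * px ^ 2) + 2 * (K ^ 4 * (ρ ^ 2 * a ^ 2)))) := by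
          gcongr; linarith
      _ = _ := by ring
  have t3 : lam * (ρ ^ 3 * a ^ 2) ≤ K ^ 4 * (lam * (ρ * px ^ 2 + ρ ^ 3 * a ^ 2)) := by
    have h1 : lam * (ρ ^ 3 * a ^ 2) ≤ lam * (ρ * px ^ 2 + ρ ^ 3 * a ^ 2) := by
      gcongr; linarith [mul_nonneg hρ0.le (sq_nonneg px)]
    exact h1.trans (le_mul_of_one_le_left (by positivity) hK4)
  have t4 : 0 ≤ K ^ 4 * (lam * (ρ * px ^ 2 + ρ ^ 3 * a ^ 2)) := by positivity
  have t5 : A ^ 2 ≤ K ^ 4 * A ^ 2 := le_mul_of_one_le_left (sq_nonneg _) hK4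
  linarith [sq_nonneg A]

theorem add_sq_le_rotated {β : ℝ} (hβ : β ^ 2 = 3 / 4) (u v : ℝ) :
    v ^ 2 + u ^ 2 ≤ 2 * ((v + u / 2) ^ 2 + (-β * u) ^ 2) := by
  have : 2 * ((v + u / 2) ^ 2 + (-β * u) ^ 2) = 2 * (v + u / 2) ^ 2 + 2 * β ^ 2 * u ^ 2 := by ring
  rw [this, hβ]
  linarith [sq_nonneg (v + u)]

theorem rotated_le_add_sq {β : ℝ} (hβ : β ^ 2 = 3 / 4) (u v : ℝ) :
    (v + u / 2) ^ 2 + (-β * u) ^ 2 ≤ 2 * (v ^ 2 + u ^ 2) := by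
  have : (v + u / 2) ^ 2 + (-β * u) ^ 2 = (v + u / 2) ^ 2 + β ^ 2 * u ^ 2 := by ring
  rw [this, hβ]
  linarith [sq_nonneg (v - u), sq_nonneg u, sq_nonneg v]

/-- The conjugated quantities control the original ones, for the complex unknown
`(v + u/2) - iβu` with `u = ψₓₓ` and `v = ψₜ`. -/
theorem recover_pointwise {K lam ρ lt h h2 β u u1 ut u11 v v1 vt : ℝ} (hβ : β ^ 2 = 3 / 4)
    (hK : 1 ≤ K) (hlam1 : 1 ≤ lam)
    (hρl : lam ≤ ρ) (hh : |h| ≤ K) (hh2 : |h2| ≤ K) (hlt : lt ^ 2 ≤ K * ρ ^ 3)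
    {p px pt q qx qt : ℝ} (hp : p = v + u / 2) (hq : q = -β * u)
    (hpx : px = (v1 + u1 / 2) + h * ρ * p) (hqx : qx = -β * u1 + h * ρ * q)
    (hpt : pt = (vt + ut / 2) - lt * p) (hqt : qt = -β * ut - lt * q) :
    lam * (ρ⁻¹ * (vt ^ 2 + ut ^ 2 + u11 ^ 2) + ρ * (v1 ^ 2 + u1 ^ 2) + ρ ^ 3 * (v ^ 2 + u ^ 2)) ≤
      2080 * K ^ 4 * ((pt / 2 - 2 * h * ρ * px - (lam * h ^ 2 + h2) * ρ * p) ^ 2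
        + (qt / 2 - 2 * h * ρ * qx - (lam * h ^ 2 + h2) * ρ * q) ^ 2
        + lam * (ρ * (px ^ 2 + qx ^ 2) + ρ ^ 3 * (p ^ 2 + q ^ 2)))
      + 3 * (vt + ut + u11) ^ 2 := by
  have hρ0 : 0 < ρ := by linarith
  have r1 := recover_component (a := p) (a1 := v1 + u1 / 2) (at' := vt + ut / 2)
    hK hlam1 hρl hh hh2 hlt
  have r2 := recover_component (a := q) (a1 := -β * u1) (at' := -β * ut)
    hK hlam1 hρl hh hh2 hlt
  rw [← hpx, ← hpt] at r1
  rw [← hqx, ← hqt] at r2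
  have a0 := add_sq_le_rotated hβ u v
  have a1 := add_sq_le_rotated hβ u1 v1
  have a2 := add_sq_le_rotated hβ ut vt
  rw [← hp, ← hq] at a0
  have b0 : lam * (ρ ^ 3 * (v ^ 2 + u ^ 2)) ≤ lam * (ρ ^ 3 * (2 * (p ^ 2 + q ^ 2))) := by gcongr
  have b1 : lam * (ρ * (v1 ^ 2 + u1 ^ 2))
      ≤ lam * (ρ * (2 * ((v1 + u1 / 2) ^ 2 + (-β * u1) ^ 2))) := by gcongr
  have b2 : lam * (ρ⁻¹ * (vt ^ 2 + ut ^ 2))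
      ≤ lam * (ρ⁻¹ * (2 * ((vt + ut / 2) ^ 2 + (-β * ut) ^ 2))) := by gcongr
  have b3 : lam * (ρ⁻¹ * u11 ^ 2)
      ≤ 3 * (vt + ut + u11) ^ 2 + 3 * (lam * (ρ⁻¹ * (vt ^ 2 + ut ^ 2))) := by
    have h0 : lam * ρ⁻¹ ≤ 1 := by rw [← div_eq_mul_inv]; exact (div_le_one hρ0).2 hρl
    have h1 : u11 ^ 2 ≤ 3 * ((vt + ut + u11) ^ 2 + vt ^ 2 + ut ^ 2) := by
      have e : u11 = (vt + ut + u11) - vt - ut := by ring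
      generalize vt + ut + u11 = F at *
      rw [e]
      linarith [sq_nonneg (F + vt), sq_nonneg (F + ut), sq_nonneg (vt - ut)]
    have h2' : lam * ρ⁻¹ * (vt + ut + u11) ^ 2 ≤ 1 * (vt + ut + u11) ^ 2 := by gcongr
    have h3 : lam * ρ⁻¹ * u11 ^ 2 ≤ lam * ρ⁻¹ * (3 * ((vt + ut + u11) ^ 2 + vt ^ 2 + ut ^ 2)) := by
      gcongr
    linarith
  have c0 : 0 ≤ lam * (ρ ^ 3 * (p ^ 2 + q ^ 2)) := by positivity
  have c1 : 0 ≤ lam * (ρ * ((v1 + u1 / 2) ^ 2 + (-β * u1) ^ 2)) := by positivity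
  generalize (pt / 2 - 2 * h * ρ * px - (lam * h ^ 2 + h2) * ρ * p) ^ 2 = A₁ at *
  generalize (qt / 2 - 2 * h * ρ * qx - (lam * h ^ 2 + h2) * ρ * q) ^ 2 = A₂ at *
  linarith

theorem conjugated_local_le {K ρ h β u u1 v v1 p px q qx : ℝ} (hβ : β ^ 2 = 3 / 4)
    (hK : 1 ≤ K) (hρ0 : 0 ≤ ρ) (hh : |h| ≤ K) (hp : p = v + u / 2) (hq : q = -β * u)
    (hpx : px = (v1 + u1 / 2) + h * ρ * p) (hqx : qx = -β * u1 + h * ρ * q) :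
    ρ * (px ^ 2 + qx ^ 2) + ρ ^ 3 * (p ^ 2 + q ^ 2)
      ≤ 6 * K ^ 2 * (ρ * (v1 ^ 2 + u1 ^ 2) + ρ ^ 3 * (v ^ 2 + u ^ 2)) := by
  have hhs : h ^ 2 ≤ K ^ 2 := sq_le_of_abs_le hh
  have hK2 : 1 ≤ K ^ 2 := one_le_pow₀ hK
  have a0 := rotated_le_add_sq hβ u v
  have a1 := rotated_le_add_sq hβ u1 v1
  rw [← hp, ← hq] at a0
  have n1 : px ^ 2 + qx ^ 2 ≤ 2 * ((v1 + u1 / 2) ^ 2 + (-β * u1) ^ 2)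
      + 2 * (h ^ 2 * (ρ ^ 2 * (p ^ 2 + q ^ 2))) := by
    rw [hpx, hqx]
    linarith [sq_nonneg ((v1 + u1 / 2) - h * ρ * p), sq_nonneg (-β * u1 - h * ρ * q)]
  have n2 : h ^ 2 * (ρ ^ 2 * (p ^ 2 + q ^ 2)) ≤ K ^ 2 * (ρ ^ 2 * (2 * (v ^ 2 + u ^ 2))) := by
    gcongr
  have n3 : 4 * (v1 ^ 2 + u1 ^ 2) ≤ K ^ 2 * (4 * (v1 ^ 2 + u1 ^ 2)) :=
    le_mul_of_one_le_left (by positivity) hK2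
  have n4 : 2 * (v ^ 2 + u ^ 2) ≤ K ^ 2 * (2 * (v ^ 2 + u ^ 2)) :=
    le_mul_of_one_le_left (by positivity) hK2
  have m1 : ρ * (px ^ 2 + qx ^ 2) ≤ ρ * (K ^ 2 * (4 * (v1 ^ 2 + u1 ^ 2))
      + 2 * (K ^ 2 * (ρ ^ 2 * (2 * (v ^ 2 + u ^ 2))))) :=
    mul_le_mul_of_nonneg_left (by linarith) hρ0
  have m2 : ρ ^ 3 * (p ^ 2 + q ^ 2) ≤ ρ ^ 3 * (K ^ 2 * (2 * (v ^ 2 + u ^ 2))) :=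
    mul_le_mul_of_nonneg_left (by linarith) (pow_nonneg hρ0 3)
  have m3 : 0 ≤ ρ * (K ^ 2 * (v1 ^ 2 + u1 ^ 2)) := by positivity
  linarith

/-- The pointwise parabolic Carleman inequality, before rewriting the divergence terms. -/
theorem parabolic_combine {K c lam σ F A N R D G : ℝ} (hK : 1 ≤ K) (hc : 0 < c) (hc1 : c ≤ 1)
    (hlam : 0 ≤ lam) (hσ : 0 ≤ σ) (hA : 0 ≤ A) (hN : 0 ≤ N) (hR : 0 ≤ R)
    (h1 : A + 2 * c ^ 2 * (lam * N) ≤ 2 * F ^ 2 + 8 * (lam * σ * N) - D)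
    (h2 : G ≤ 2080 * K ^ 4 * (A + lam * N) + 3 * F ^ 2) (h3 : N ≤ 6 * K ^ 2 * R) :
    G ≤ (100000 * K ^ 6 / c ^ 2) * (F ^ 2 + lam * (σ * R)) - 2080 * K ^ 4 / c ^ 2 * D := by
  have hc2 : c ^ 2 ≤ 1 := pow_le_one₀ hc.le hc1
  have hK46 : K ^ 4 ≤ K ^ 6 := pow_le_pow_right₀ hK (by norm_num)
  have hK6 : 1 ≤ K ^ 6 := one_le_pow₀ hK
  have n1 : lam * σ * N ≤ lam * σ * (6 * K ^ 2 * R) :=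
    mul_le_mul_of_nonneg_left h3 (mul_nonneg hlam hσ)
  have n2 : c ^ 2 * A ≤ A := mul_le_of_le_one_left hA hc2
  have n3 : 0 ≤ c ^ 2 * (lam * N) := by positivity
  have n4 : c ^ 2 * (A + lam * N) ≤ 2 * F ^ 2 + 8 * (lam * σ * (6 * K ^ 2 * R)) - D := by linarith
  have n5 := mul_le_mul_of_nonneg_left n4 (by positivity : 0 ≤ 2080 * K ^ 4)
  have n6 : c ^ 2 * G ≤ c ^ 2 * (2080 * K ^ 4 * (A + lam * N) + 3 * F ^ 2) := by gcongr
  have n7 : c ^ 2 * F ^ 2 ≤ K ^ 6 * F ^ 2 := by gcongr; linarith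
  have n8 : K ^ 4 * F ^ 2 ≤ K ^ 6 * F ^ 2 := by gcongr
  have n9 : 0 ≤ K ^ 6 * F ^ 2 := by positivity
  have n10 : 0 ≤ K ^ 6 * (lam * (σ * R)) := by positivity
  have e : 100000 * K ^ 6 / c ^ 2 * (F ^ 2 + lam * (σ * R)) - 2080 * K ^ 4 / c ^ 2 * D
      = (100000 * K ^ 6 * (F ^ 2 + lam * (σ * R)) - 2080 * K ^ 4 * D) / c ^ 2 := by ring
  rw [e, le_div_iff₀ (by positivity)]
  linarith

/-- The pointwise parabolic Carleman inequality: `Xx` and `Yt` are an `x`-derivative and a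
`t`-derivative. -/
theorem parabolic_pointwise {K c s lam ρ rt lt h h2 h3 σ β : ℝ}
    {u u1 ut u11 v v1 vt : ℝ} {p px pt pxx pxt q qx qt qxx qxt Xx Yt : ℝ}
    (hβ : β ^ 2 = 3 / 4) (hK : 1 ≤ K) (hc : 0 < c) (hc1 : c ≤ 1)
    (hs1 : 1 ≤ s) (hs : 9 * K ^ 3 ≤ c ^ 2 * s) (hlam1 : 1 ≤ lam) (hlam : 8 * K ^ 3 ≤ c ^ 2 * lam)
    (hρ : s * lam ≤ ρ) (hcσ : c ≤ h ^ 2 + σ) (hσ : 0 ≤ σ)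
    (hh : |h| ≤ K) (hh2 : |h2| ≤ K) (hh3 : |h3| ≤ K)
    (hrt : |rt| * (s * lam) ≤ K * ρ ^ 2) (hlt : lt ^ 2 * s ≤ K * ρ ^ 3)
    (hp : p = v + u / 2) (hq : q = -β * u)
    (hpx : px = (v1 + u1 / 2) + h * ρ * p) (hqx : qx = -β * u1 + h * ρ * q)
    (hpt : pt = (vt + ut / 2) - lt * p) (hqt : qt = -β * ut - lt * q)
    (hpxx : pxx = (ut + h * ρ * v1 + (u11 + h * ρ * u1) / 2)
      + (h2 * ρ + h * (lam * h * ρ)) * p + h * ρ * px)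
    (hqxx : qxx = -β * (u11 + h * ρ * u1) + (h2 * ρ + h * (lam * h * ρ)) * q + h * ρ * qx)
    (hX : Xx = (pxx * pt + px * pxt + (qxx * qt + qx * qxt))
      - (2 * h2 * ρ + 2 * h * (lam * h * ρ)) * (px ^ 2 + qx ^ 2)
      - 2 * h * ρ * (2 * px * pxx + 2 * qx * qxx)
      - (2 * (2 * lam * h * h2 + h3) * ρ + 2 * (lam * h ^ 2 + h2) * (lam * h * ρ))
        * (px * p + qx * q)
      - 2 * (lam * h ^ 2 + h2) * ρ * (pxx * p + px ^ 2 + qxx * q + qx ^ 2)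
      - (6 * h ^ 2 * h2 * ρ ^ 3 + 6 * h ^ 3 * ρ ^ 2 * (lam * h * ρ)) * (p ^ 2 + q ^ 2)
      - 2 * h ^ 3 * ρ ^ 3 * (2 * p * px + 2 * q * qx)
      - 2 * β * (h2 * ρ + h * (lam * h * ρ)) * (qt * p - pt * q)
      - 2 * β * h * ρ * (qxt * p + qt * px - pxt * q - pt * qx))
    (hY : Yt = -(px * pxt + qx * qxt) + h ^ 2 * ρ * rt * (p ^ 2 + q ^ 2)
      + h ^ 2 * ρ ^ 2 * (p * pt + q * qt) + 2 * β * h * rt * (qx * p - px * q)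
      + 2 * β * h * ρ * (qxt * p + qx * pt - pxt * q - px * qt)) :
    lam * (ρ⁻¹ * (vt ^ 2 + ut ^ 2 + u11 ^ 2) + ρ * (v1 ^ 2 + u1 ^ 2) + ρ ^ 3 * (v ^ 2 + u ^ 2)) ≤
      (100000 * K ^ 6 / c ^ 2) * ((vt + ut + u11) ^ 2
          + lam * (σ * (ρ * (v1 ^ 2 + u1 ^ 2) + ρ ^ 3 * (v ^ 2 + u ^ 2))))
        - 2080 * K ^ 4 / c ^ 2 * (Xx + Yt) := by
  have hρl : lam ≤ ρ := (le_mul_of_one_le_left (by linarith) hs1).trans hρ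
  have hρ0 : 0 ≤ ρ := by linarith
  have hlt' : lt ^ 2 ≤ K * ρ ^ 3 := (le_mul_of_one_le_right (sq_nonneg _) hs1).trans hlt
  have hR₁ : pxx + h ^ 2 * ρ ^ 2 * p + β * qt + (pt / 2 - 2 * h * ρ * px
      - (lam * h ^ 2 + h2) * ρ * p) = (vt + ut + u11) / 2 - lt * (p / 2 + β * q) := by
    rw [hpxx, hqt, hpt, hpx]
    linear_combination -ut * hβ
  have hR₂ : qxx + h ^ 2 * ρ ^ 2 * q - β * pt + (qt / 2 - 2 * h * ρ * qx
      - (lam * h ^ 2 + h2) * ρ * q) = -β * (vt + ut + u11) - lt * (q / 2 - β * p) := by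
    rw [hqxx, hqt, hpt, hqx]
    ring
  have h1 := conjugated_lower_bound hβ hK hc hc1 hs hlam1 hlam hρ hcσ hσ hh hh2 hh3 hrt hlt
    hR₁ hR₂ hX hY
  have h2' := recover_pointwise (u11 := u11) hβ hK hlam1 hρl hh hh2 hlt' hp hq hpx hqx hpt hqt
  have h3' := conjugated_local_le hβ hK hρ0 hh hp hq hpx hqx
  exact parabolic_combine hK hc hc1 (by linarith) hσ (by positivity) (by positivity)
    (by positivity) h1 h2' h3'

end ParabolicRecovery

section SmoothPeriodic

/-- Smooth functions of `(x,t)` which are `P`-periodic in `x`. -/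
structure SmoothPeriodic (P : ℝ) (f : ℝ → ℝ → ℝ) : Prop where
  smooth : ContDiff ℝ (⊤ : ℕ∞) (fun p : ℝ × ℝ => f p.1 p.2)
  per : ∀ t, Function.Periodic (fun x => f x t) P

namespace SmoothPeriodic

variable {P : ℝ} {f g : ℝ → ℝ → ℝ}

theorem hasDerivAt_fderiv_fst (hf : SmoothPeriodic P f) (x t : ℝ) :
    HasDerivAt (fun y => f y t) (fderiv ℝ (fun p : ℝ × ℝ => f p.1 p.2) (x, t) (1, 0)) x :=
  ((hf.smooth.differentiable (by simp)) (x, t)).hasFDerivAt.comp_hasDerivAt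
    (f := fun y : ℝ => (y, t)) x ((hasDerivAt_id x).prodMk (hasDerivAt_const x t))

theorem hasDerivAt_fderiv_snd (hf : SmoothPeriodic P f) (x t : ℝ) :
    HasDerivAt (fun τ => f x τ) (fderiv ℝ (fun p : ℝ × ℝ => f p.1 p.2) (x, t) (0, 1)) t :=
  ((hf.smooth.differentiable (by simp)) (x, t)).hasFDerivAt.comp_hasDerivAt
    (f := fun τ : ℝ => (x, τ)) t ((hasDerivAt_const t x).prodMk (hasDerivAt_id t))

theorem hasDerivAt_x (hf : SmoothPeriodic P f) (x t : ℝ) :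
    HasDerivAt (fun y => f y t) (pdx f x t) x :=
  (hf.hasDerivAt_fderiv_fst x t).differentiableAt.hasDerivAt

theorem hasDerivAt_t (hf : SmoothPeriodic P f) (x t : ℝ) :
    HasDerivAt (fun τ => f x τ) (pdt f x t) t :=
  (hf.hasDerivAt_fderiv_snd x t).differentiableAt.hasDerivAt

theorem pdx_eq (hf : SmoothPeriodic P f) (x t : ℝ) :
    pdx f x t = fderiv ℝ (fun p : ℝ × ℝ => f p.1 p.2) (x, t) (1, 0) :=
  (hf.hasDerivAt_fderiv_fst x t).deriv

theorem pdt_eq (hf : SmoothPeriodic P f) (x t : ℝ) :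
    pdt f x t = fderiv ℝ (fun p : ℝ × ℝ => f p.1 p.2) (x, t) (0, 1) :=
  (hf.hasDerivAt_fderiv_snd x t).deriv

theorem pdx (hf : SmoothPeriodic P f) : SmoothPeriodic P (pdx f) := by
  refine ⟨?_, fun t x => ?_⟩
  · have : (fun p : ℝ × ℝ => _root_.pdx f p.1 p.2)
        = fun p => fderiv ℝ (fun p : ℝ × ℝ => f p.1 p.2) p (1, 0) := by
      funext p; exact hf.pdx_eq p.1 p.2
    rw [this]
    exact (hf.smooth.fderiv_right (m := (⊤ : ℕ∞)) (by simp)).clm_apply contDiff_const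
  · have h1 := (hf.hasDerivAt_x (x + P) t).comp_add_const x P
    have h2 : (fun y => f (y + P) t) = fun y => f y t := by
      funext y; exact hf.per t y
    rw [h2] at h1
    exact h1.unique (hf.hasDerivAt_x x t)

theorem pdt (hf : SmoothPeriodic P f) : SmoothPeriodic P (pdt f) := by
  refine ⟨?_, fun t x => ?_⟩
  · have : (fun p : ℝ × ℝ => _root_.pdt f p.1 p.2)
        = fun p => fderiv ℝ (fun p : ℝ × ℝ => f p.1 p.2) p (0, 1) := by
      funext p; exact hf.pdt_eq p.1 p.2
    rw [this]
    exact (hf.smooth.fderiv_right (m := (⊤ : ℕ∞)) (by simp)).clm_apply contDiff_const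
  · have h2 : (fun τ => f (x + P) τ) = fun τ => f x τ := by
      funext τ; exact hf.per τ x
    simp only [_root_.pdt, h2]

theorem pdx_pdt (hf : SmoothPeriodic P f) : _root_.pdx (_root_.pdt f) = _root_.pdt (_root_.pdx f) := by
  funext x t
  have hd : DifferentiableAt ℝ (fderiv ℝ (fun p : ℝ × ℝ => f p.1 p.2)) (x, t) :=
    (hf.smooth.fderiv_right (m := (⊤ : ℕ∞)) (by simp)).differentiable (by simp) _
  have e1 : (fun p : ℝ × ℝ => _root_.pdt f p.1 p.2)
        = fun p => fderiv ℝ (fun p : ℝ × ℝ => f p.1 p.2) p (0, 1) := by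
      funext p; exact hf.pdt_eq p.1 p.2
  have e2 : (fun p : ℝ × ℝ => _root_.pdx f p.1 p.2)
        = fun p => fderiv ℝ (fun p : ℝ × ℝ => f p.1 p.2) p (1, 0) := by
      funext p; exact hf.pdx_eq p.1 p.2
  rw [hf.pdt.pdx_eq, hf.pdx.pdt_eq, e1, e2, fderiv_clm_apply hd (by fun_prop),
    fderiv_clm_apply hd (by fun_prop)]
  have hs : IsSymmSndFDerivAt ℝ (fun p : ℝ × ℝ => f p.1 p.2) (x, t) :=
    hf.smooth.contDiffAt.isSymmSndFDerivAt
      (by simp only [minSmoothness_of_isRCLikeNormedField]; exact WithTop.coe_le_coe.2 (le_top : (2 : ℕ∞) ≤ ⊤))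
  simpa using hs (1, 0) (0, 1)

theorem polyGrowth (hf : SmoothPeriodic P f) {d L T : ℝ} {θ : ℝ → ℝ} : PolyGrowth d L T θ f :=
  .of_continuous hf.smooth.continuous

theorem eq_endpoints {d L : ℝ} (hf : SmoothPeriodic (d + 2 * L) f) (t : ℝ) :
    f (-L) t = f (d + L) t := by
  have := hf.per t (-L)
  simp only at this
  rw [← this]; congr 1; ring

theorem add (hf : SmoothPeriodic P f) (hg : SmoothPeriodic P g) :
    SmoothPeriodic P (fun x t => f x t + g x t) :=
  ⟨hf.smooth.add hg.smooth, fun t x => by simp [hf.per t x, hg.per t x]⟩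

end SmoothPeriodic

end SmoothPeriodic

section Weight

/-- The properties of a Carleman weight `W = e^{-sφ}` that the estimates use: `ρ = sλξ`,
`W` solves `Wₓ = η' ρ W` and `Wₜ = -lt W`, and `σ` is a cutoff supported off the set where
`η'` is bounded below. The functions `h`, `h2`, `h3` are the derivatives of `η`. -/
structure CarlemanWeight (d L T K c s lam : ℝ) where
  θ : ℝ → ℝ
  W : ℝ → ℝ → ℝ
  ρ : ℝ → ℝ → ℝ
  rt : ℝ → ℝ → ℝ
  lt : ℝ → ℝ → ℝ
  h : ℝ → ℝ
  h2 : ℝ → ℝ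
  h3 : ℝ → ℝ
  σ : ℝ → ℝ
  σ1 : ℝ → ℝ
  one_le_θ : ∀ t ∈ Ioo (0:ℝ) T, 1 ≤ θ t
  tendsto_zero : Tendsto θ (𝓝[>] 0) atTop
  tendsto_T : Tendsto θ (𝓝[<] T) atTop
  decay : RapidDecay d L T θ W
  growth_ρ : PolyGrowth d L T θ ρ
  growth_rt : PolyGrowth d L T θ rt
  growth_lt : PolyGrowth d L T θ lt
  cont_h : Continuous h
  cont_h2 : Continuous h2
  cont_h3 : Continuous h3
  cont_σ : Continuous σ
  cont_σ1 : Continuous σ1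
  W_x : ∀ x, ∀ t ∈ Ioo (0:ℝ) T, HasDerivAt (fun y => W y t) (h x * ρ x t * W x t) x
  W_t : ∀ x, ∀ t ∈ Ioo (0:ℝ) T, HasDerivAt (fun τ => W x τ) (-(lt x t * W x t)) t
  ρ_x : ∀ x, ∀ t ∈ Ioo (0:ℝ) T, HasDerivAt (fun y => ρ y t) (lam * h x * ρ x t) x
  ρ_t : ∀ x, ∀ t ∈ Ioo (0:ℝ) T, HasDerivAt (fun τ => ρ x τ) (rt x t) t
  lt_x : ∀ x, ∀ t ∈ Ioo (0:ℝ) T, HasDerivAt (fun y => lt y t) (-(h x * rt x t)) x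
  h_x : ∀ x, HasDerivAt h (h2 x) x
  h2_x : ∀ x, HasDerivAt h2 (h3 x) x
  σ_x : ∀ x, HasDerivAt σ (σ1 x) x
  W_per : ∀ t, W (-L) t = W (d + L) t
  ρ_per : ∀ t, ρ (-L) t = ρ (d + L) t
  lt_per : ∀ t, lt (-L) t = lt (d + L) t
  h_per : h (-L) = h (d + L)
  h2_per : h2 (-L) = h2 (d + L)
  σ_per : σ (-L) = σ (d + L)
  lam_le : 1 ≤ lam
  s_le : 1 ≤ s
  ρ_ge : ∀ x ∈ Icc (-L) (d + L), ∀ t ∈ Ioo (0:ℝ) T, s * lam ≤ ρ x t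
  ρ_pos : ∀ x, ∀ t ∈ Ioo (0:ℝ) T, 0 < ρ x t
  rt_le : ∀ x ∈ Icc (-L) (d + L), ∀ t ∈ Ioo (0:ℝ) T, |rt x t| * (s * lam) ≤ K * ρ x t ^ 2
  lt_le : ∀ x ∈ Icc (-L) (d + L), ∀ t ∈ Ioo (0:ℝ) T, |lt x t| ≤ K * ρ x t ^ 2
  lt_sq_le : ∀ x ∈ Icc (-L) (d + L), ∀ t ∈ Ioo (0:ℝ) T, lt x t ^ 2 * s ≤ K * ρ x t ^ 3
  h_le : ∀ x ∈ Icc (-L) (d + L), |h x| ≤ K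
  h2_le : ∀ x ∈ Icc (-L) (d + L), |h2 x| ≤ K
  h3_le : ∀ x ∈ Icc (-L) (d + L), |h3 x| ≤ K
  σ_nonneg : ∀ x, 0 ≤ σ x
  σ_sq_le : ∀ x ∈ Icc (-L) (d + L), σ x ^ 2 ≤ K * σ x
  σ1_sq_le : ∀ x ∈ Icc (-L) (d + L), σ1 x ^ 2 ≤ K * σ x
  le_σ : ∀ x ∈ Icc (-L) (d + L), c ≤ h x ^ 2 + σ x

namespace CarlemanWeight

variable {d L T K c s lam : ℝ} {f : ℝ → ℝ → ℝ}

theorem one_le_s_mul_lam (w : CarlemanWeight d L T K c s lam) : 1 ≤ s * lam :=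
  one_le_mul_of_one_le_of_one_le w.s_le w.lam_le

theorem lam_le_ρ (w : CarlemanWeight d L T K c s lam) {x t : ℝ} (hx : x ∈ Icc (-L) (d + L))
    (ht : t ∈ Ioo (0:ℝ) T) : lam ≤ w.ρ x t :=
  (le_mul_of_one_le_left (zero_le_one.trans w.lam_le) w.s_le).trans (w.ρ_ge x hx t ht)

theorem rt_le' (w : CarlemanWeight d L T K c s lam) {x t : ℝ} (hx : x ∈ Icc (-L) (d + L))
    (ht : t ∈ Ioo (0:ℝ) T) : |w.rt x t| ≤ K * w.ρ x t ^ 2 :=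
  (le_mul_of_one_le_right (abs_nonneg _) w.one_le_s_mul_lam).trans (w.rt_le x hx t ht)

theorem growth_inv (w : CarlemanWeight d L T K c s lam) :
    PolyGrowth d L T w.θ (fun x t => (w.ρ x t)⁻¹) := by
  refine ⟨w.growth_ρ.cont.inv₀ fun p hp => (w.ρ_pos p.1 p.2 hp.2).ne', 1, zero_le_one, 0,
    fun x hx t ht => ?_⟩
  rw [abs_of_pos (inv_pos.2 (w.ρ_pos x t ht))]
  simpa using inv_le_one_of_one_le₀ (w.one_le_s_mul_lam.trans (w.ρ_ge x hx t ht))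

/-- Multiplication by the weight. -/
def hat (w : CarlemanWeight d L T K c s lam) (f : ℝ → ℝ → ℝ) (x t : ℝ) : ℝ := f x t * w.W x t

theorem rapid_hat (w : CarlemanWeight d L T K c s lam) (hf : SmoothPeriodic (d + 2 * L) f) :
    RapidDecay d L T w.θ (w.hat f) :=
  hf.polyGrowth.mul_rapidDecay w.one_le_θ w.decay

theorem hat_per (w : CarlemanWeight d L T K c s lam) (hf : SmoothPeriodic (d + 2 * L) f) (t : ℝ) :
    w.hat f (-L) t = w.hat f (d + L) t := by
  simp only [hat, hf.eq_endpoints t, w.W_per t]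

theorem hat_x (w : CarlemanWeight d L T K c s lam) (hf : SmoothPeriodic (d + 2 * L) f) (x : ℝ)
    {t : ℝ} (ht : t ∈ Ioo (0:ℝ) T) :
    HasDerivAt (fun y => w.hat f y t)
      (w.hat (pdx f) x t + w.h x * w.ρ x t * w.hat f x t) x := by
  refine ((hf.hasDerivAt_x x t).mul (w.W_x x t ht)).congr_deriv ?_
  simp only [hat]; ring

theorem hat_t (w : CarlemanWeight d L T K c s lam) (hf : SmoothPeriodic (d + 2 * L) f) (x : ℝ)
    {t : ℝ} (ht : t ∈ Ioo (0:ℝ) T) :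
    HasDerivAt (fun τ => w.hat f x τ)
      (w.hat (pdt f) x t - w.lt x t * w.hat f x t) t := by
  refine ((hf.hasDerivAt_t x t).mul (w.W_t x t ht)).congr_deriv ?_
  simp only [hat]; ring

theorem space_local {ε : ℝ} (hd : 0 < d) (hL : 0 < L) (hT : 0 < T) (hK : 1 ≤ K) (hε : 0 < ε)
    (k : ℕ) :
    ∃ C, 0 ≤ C ∧ ∀ (s lam : ℝ) (w : CarlemanWeight d L T K c s lam) (f : ℝ → ℝ → ℝ),
      SmoothPeriodic (d + 2 * L) f →
      II d L T (fun x t => w.σ x * w.ρ x t ^ k * w.hat (pdx f) x t ^ 2)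
        ≤ ε * II d L T (fun x t => w.ρ x t ^ k *
            ((w.ρ x t)⁻¹ ^ 2 * w.hat (pdx (pdx f)) x t ^ 2 + w.hat (pdx f) x t ^ 2))
          + C * II d L T (fun x t => w.σ x * w.ρ x t ^ (k + 2) * w.hat f x t ^ 2) := by
  obtain ⟨C, hC, h⟩ := space_local_pointwise hK hε k
  refine ⟨C, hC, fun s lam w f hf => ?_⟩
  have g0 := w.one_le_θ
  have g1 := w.rapid_hat hf
  have g2 := w.rapid_hat hf.pdx
  have g3 := w.rapid_hat hf.pdx.pdx
  have p1 := w.growth_ρ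
  have p2 := w.growth_inv
  have p3 : PolyGrowth d L T w.θ (fun x _ => w.h x) := .of_space w.cont_h
  have p4 : PolyGrowth d L T w.θ (fun x _ => w.σ x) := .of_space w.cont_σ
  have p5 : PolyGrowth d L T w.θ (fun x _ => w.σ1 x) := .of_space w.cont_σ1
  set D : ℝ → ℝ → ℝ := fun x t =>
    w.σ1 x * w.ρ x t ^ k * (w.hat f x t * w.hat (pdx f) x t)
      + k * lam * w.h x * w.σ x * w.ρ x t ^ k * (w.hat f x t * w.hat (pdx f) x t)
      + w.σ x * w.ρ x t ^ k *
        ((w.hat (pdx f) x t + w.h x * w.ρ x t * w.hat f x t) * w.hat (pdx f) x t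
          + w.hat f x t * (w.hat (pdx (pdx f)) x t + w.h x * w.ρ x t * w.hat (pdx f) x t)) with hD
  have r1 : RapidDecay d L T w.θ (fun x t => w.σ x * w.ρ x t ^ k * w.hat (pdx f) x t ^ 2) := by
    repeat' first
      | assumption | exact RapidDecay.toPolyGrowth (by assumption) | apply RapidDecay.add g0
      | apply RapidDecay.sq g0 | apply PolyGrowth.mul_rapidDecay g0 | apply PolyGrowth.mul
      | apply PolyGrowth.pow
  have r2 : RapidDecay d L T w.θ (fun x t => w.ρ x t ^ k *
      ((w.ρ x t)⁻¹ ^ 2 * w.hat (pdx (pdx f)) x t ^ 2 + w.hat (pdx f) x t ^ 2)) := by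
    repeat' first
      | assumption | exact RapidDecay.toPolyGrowth (by assumption) | apply RapidDecay.add g0
      | apply RapidDecay.sq g0 | apply PolyGrowth.mul_rapidDecay g0 | apply PolyGrowth.mul
      | apply PolyGrowth.pow
  have r3 : RapidDecay d L T w.θ (fun x t => w.σ x * w.ρ x t ^ (k + 2) * w.hat f x t ^ 2) := by
    repeat' first
      | assumption | exact RapidDecay.toPolyGrowth (by assumption) | apply RapidDecay.add g0
      | apply RapidDecay.sq g0 | apply PolyGrowth.mul_rapidDecay g0 | apply PolyGrowth.mul
      | apply PolyGrowth.pow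
  have r4 : RapidDecay d L T w.θ D := by
    repeat' first
      | assumption | exact RapidDecay.toPolyGrowth (by assumption) | apply RapidDecay.sub g0
      | apply RapidDecay.add g0 | apply RapidDecay.sq g0 | apply PolyGrowth.mul_rapidDecay g0
      | apply PolyGrowth.sub g0 | apply PolyGrowth.add g0 | apply PolyGrowth.mul
      | apply PolyGrowth.pow | apply PolyGrowth.const
  have e1 := (PolyGrowth.const ε).mul_rapidDecay g0 r2
  have e2 := (PolyGrowth.const C).mul_rapidDecay g0 r3
  have hz : II d L T D = 0 := by
    refine II_space_deriv_eq_zero (θ := w.θ)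
      (X := fun x t => w.σ x * w.ρ x t ^ k * (w.hat f x t * w.hat (pdx f) x t)) hd hL hT r4
      (fun x t ht => ?_) (fun t _ => ?_)
    · refine (((w.σ_x x).mul ((w.ρ_x x t ht).pow k)).mul
        ((w.hat_x hf x ht).mul (w.hat_x hf.pdx x ht))).congr_deriv ?_
      rcases k with _ | k
      · simp [hD]
      · simp [hD]; ring
    · simp only [w.hat_per hf, w.hat_per hf.pdx, w.σ_per, w.ρ_per]
  have := II_mono hd hL hT r1 ((e1.add g0 e2).add g0 r4) fun x hx t ht =>
    h (w.ρ x t) lam (w.σ x) (w.σ1 x) (w.h x) (w.hat f x t) (w.hat (pdx f) x t)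
      (w.hat (pdx (pdx f)) x t) w.lam_le (w.lam_le_ρ hx ht) (w.σ_nonneg x) (w.σ_sq_le x hx)
      (w.σ1_sq_le x hx) (w.h_le x hx)
  rwa [II_add hd hL hT g0 (e1.add g0 e2) r4, II_add hd hL hT g0 e1 e2, II_const_mul, II_const_mul,
    hz, add_zero] at this

theorem space_static (w : CarlemanWeight d L T K c s lam) (hd : 0 < d) (hL : 0 < L) (hT : 0 < T)
    (hc : 0 < c) (hKs : 2 * K ≤ c * s) (k : ℕ) (hf : SmoothPeriodic (d + 2 * L) f) :
    c * II d L T (fun x t => w.ρ x t ^ (k + 2) * w.hat f x t ^ 2)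
      ≤ 2 * II d L T (fun x t => w.σ x * w.ρ x t ^ (k + 2) * w.hat f x t ^ 2)
        + 2 * K ^ 2 / c * II d L T (fun x t => w.ρ x t ^ k * w.hat (pdx f) x t ^ 2) := by
  have g0 := w.one_le_θ
  have g1 := w.rapid_hat hf
  have g2 := w.rapid_hat hf.pdx
  have p1 := w.growth_ρ
  have p3 : PolyGrowth d L T w.θ (fun x _ => w.h x) := .of_space w.cont_h
  have p4 : PolyGrowth d L T w.θ (fun x _ => w.σ x) := .of_space w.cont_σ
  have p5 : PolyGrowth d L T w.θ (fun x _ => w.h2 x) := .of_space w.cont_h2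
  set D : ℝ → ℝ → ℝ := fun x t =>
    ((k + 1) * lam * w.h x ^ 2 + w.h2 x) * w.ρ x t ^ (k + 1) * w.hat f x t ^ 2
      + 2 * w.ρ x t ^ (k + 1) * w.h x *
        (w.hat f x t * (w.hat (pdx f) x t + w.h x * w.ρ x t * w.hat f x t)) with hD
  have r1 : RapidDecay d L T w.θ (fun x t => w.ρ x t ^ (k + 2) * w.hat f x t ^ 2) := by
    repeat' first
      | assumption | exact RapidDecay.toPolyGrowth (by assumption) | apply RapidDecay.add g0
      | apply RapidDecay.sq g0 | apply PolyGrowth.mul_rapidDecay g0 | apply PolyGrowth.mul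
      | apply PolyGrowth.pow
  have r2 : RapidDecay d L T w.θ
      (fun x t => w.σ x * w.ρ x t ^ (k + 2) * w.hat f x t ^ 2) := by
    repeat' first
      | assumption | exact RapidDecay.toPolyGrowth (by assumption) | apply RapidDecay.add g0
      | apply RapidDecay.sq g0 | apply PolyGrowth.mul_rapidDecay g0 | apply PolyGrowth.mul
      | apply PolyGrowth.pow
  have r3 : RapidDecay d L T w.θ (fun x t => w.ρ x t ^ k * w.hat (pdx f) x t ^ 2) := by
    repeat' first
      | assumption | exact RapidDecay.toPolyGrowth (by assumption) | apply RapidDecay.add g0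
      | apply RapidDecay.sq g0 | apply PolyGrowth.mul_rapidDecay g0 | apply PolyGrowth.mul
      | apply PolyGrowth.pow
  have r4 : RapidDecay d L T w.θ D := by
    repeat' first
      | assumption | exact RapidDecay.toPolyGrowth (by assumption) | apply RapidDecay.sub g0
      | apply RapidDecay.add g0 | apply RapidDecay.sq g0 | apply PolyGrowth.mul_rapidDecay g0
      | apply PolyGrowth.sub g0 | apply PolyGrowth.add g0 | apply PolyGrowth.mul
      | apply PolyGrowth.pow | apply PolyGrowth.const
  have e0 := (PolyGrowth.const c).mul_rapidDecay g0 r1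
  have e1 := (PolyGrowth.const 2).mul_rapidDecay g0 r2
  have e2 := (PolyGrowth.const (2 * K ^ 2 / c)).mul_rapidDecay g0 r3
  have hz : II d L T D = 0 := by
    refine II_space_deriv_eq_zero (θ := w.θ)
      (X := fun x t => w.h x * w.ρ x t ^ (k + 1) * w.hat f x t ^ 2) hd hL hT r4
      (fun x t ht => ?_) (fun t _ => ?_)
    · refine (((w.h_x x).mul ((w.ρ_x x t ht).pow (k + 1))).mul
        ((w.hat_x hf x ht).pow 2)).congr_deriv ?_
      simp [hD]; ring
    · simp only [w.hat_per hf, w.h_per, w.ρ_per]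
  have := II_mono hd hL hT e0 ((r4.add g0 e1).add g0 e2) fun x hx t ht => by
    have hρ : s ≤ w.ρ x t :=
      (le_mul_of_one_le_right (zero_le_one.trans w.s_le) w.lam_le).trans (w.ρ_ge x hx t ht)
    exact space_static_pointwise hc k w.lam_le (w.s_le.trans hρ)
      (hKs.trans (mul_le_mul_of_nonneg_left hρ hc.le)) (w.le_σ x hx) (w.h_le x hx) (w.h2_le x hx)
  rwa [II_add hd hL hT g0 (r4.add g0 e1) e2, II_add hd hL hT g0 r4 e1, II_const_mul, II_const_mul,
    II_const_mul, hz, zero_add] at this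

theorem time_local {ε : ℝ} (hd : 0 < d) (hL : 0 < L) (hT : 0 < T) (hK : 1 ≤ K) (hε : 0 < ε) :
    ∃ C, 0 ≤ C ∧ ∀ (s lam : ℝ) (w : CarlemanWeight d L T K c s lam) (f : ℝ → ℝ → ℝ),
      SmoothPeriodic (d + 2 * L) f →
      II d L T (fun x t => w.σ x * w.ρ x t ^ 3 * w.hat (pdt f) x t ^ 2)
        ≤ ε * II d L T (fun x t => (w.ρ x t)⁻¹ * w.hat (pdt (pdt f)) x t ^ 2
            + w.ρ x t ^ 3 * w.hat (pdt f) x t ^ 2)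
          + C * II d L T (fun x t => w.σ x * w.ρ x t ^ 7 * w.hat f x t ^ 2) := by
  obtain ⟨C, hC, h⟩ := time_local_pointwise hK hε
  refine ⟨C, hC, fun s lam w f hf => ?_⟩
  have g0 := w.one_le_θ
  have g1 := w.rapid_hat hf
  have g2 := w.rapid_hat hf.pdt
  have g3 := w.rapid_hat hf.pdt.pdt
  have p1 := w.growth_ρ
  have p2 := w.growth_inv
  have p3 := w.growth_rt
  have p4 := w.growth_lt
  have p5 : PolyGrowth d L T w.θ (fun x _ => w.σ x) := .of_space w.cont_σ
  set D : ℝ → ℝ → ℝ := fun x t =>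
    3 * w.σ x * w.ρ x t ^ 2 * w.rt x t * (w.hat f x t * w.hat (pdt f) x t)
      + w.σ x * w.ρ x t ^ 3 *
        ((w.hat (pdt f) x t - w.lt x t * w.hat f x t) * w.hat (pdt f) x t
          + w.hat f x t * (w.hat (pdt (pdt f)) x t - w.lt x t * w.hat (pdt f) x t)) with hD
  have r0 : RapidDecay d L T w.θ
      (fun x t => w.σ x * w.ρ x t ^ 3 * (w.hat f x t * w.hat (pdt f) x t)) := by
    repeat' first
      | assumption | exact RapidDecay.toPolyGrowth (by assumption) | apply RapidDecay.add g0
      | apply RapidDecay.sq g0 | apply PolyGrowth.mul_rapidDecay g0 | apply PolyGrowth.mul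
      | apply PolyGrowth.pow
  have r1 : RapidDecay d L T w.θ (fun x t => w.σ x * w.ρ x t ^ 3 * w.hat (pdt f) x t ^ 2) := by
    repeat' first
      | assumption | exact RapidDecay.toPolyGrowth (by assumption) | apply RapidDecay.add g0
      | apply RapidDecay.sq g0 | apply PolyGrowth.mul_rapidDecay g0 | apply PolyGrowth.mul
      | apply PolyGrowth.pow
  have r2 : RapidDecay d L T w.θ (fun x t => (w.ρ x t)⁻¹ * w.hat (pdt (pdt f)) x t ^ 2
      + w.ρ x t ^ 3 * w.hat (pdt f) x t ^ 2) := by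
    repeat' first
      | assumption | exact RapidDecay.toPolyGrowth (by assumption) | apply RapidDecay.add g0
      | apply RapidDecay.sq g0 | apply PolyGrowth.mul_rapidDecay g0 | apply PolyGrowth.mul
      | apply PolyGrowth.pow
  have r3 : RapidDecay d L T w.θ (fun x t => w.σ x * w.ρ x t ^ 7 * w.hat f x t ^ 2) := by
    repeat' first
      | assumption | exact RapidDecay.toPolyGrowth (by assumption) | apply RapidDecay.add g0
      | apply RapidDecay.sq g0 | apply PolyGrowth.mul_rapidDecay g0 | apply PolyGrowth.mul
      | apply PolyGrowth.pow
  have r4 : RapidDecay d L T w.θ D := by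
    repeat' first
      | assumption | exact RapidDecay.toPolyGrowth (by assumption) | apply RapidDecay.sub g0
      | apply RapidDecay.add g0 | apply RapidDecay.sq g0 | apply PolyGrowth.mul_rapidDecay g0
      | apply PolyGrowth.sub g0 | apply PolyGrowth.add g0 | apply PolyGrowth.mul
      | apply PolyGrowth.pow | apply PolyGrowth.const
  have e1 := (PolyGrowth.const ε).mul_rapidDecay g0 r2
  have e2 := (PolyGrowth.const C).mul_rapidDecay g0 r3
  have hz : II d L T D = 0 := by
    refine II_time_deriv_eq_zero hd hL hT g0 w.tendsto_zero w.tendsto_T r0 r4 fun x t ht => ?_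
    refine ((((w.ρ_t x t ht).pow 3).const_mul (w.σ x)).mul
      ((w.hat_t hf x ht).mul (w.hat_t hf.pdt x ht))).congr_deriv ?_
    simp only [hD, Pi.pow_apply, Pi.mul_apply, Nat.cast_ofNat, Nat.add_one_sub_one]; ring
  have := II_mono hd hL hT r1 ((e1.add g0 e2).add g0 r4) fun x hx t ht =>
    h (w.ρ x t) (w.σ x) (w.rt x t) (w.lt x t) (w.hat f x t) (w.hat (pdt f) x t)
      (w.hat (pdt (pdt f)) x t) (w.lam_le.trans (w.lam_le_ρ hx ht)) (w.σ_nonneg x)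
      (w.σ_sq_le x hx) (w.rt_le' hx ht) (w.lt_le x hx t ht)
  rwa [II_add hd hL hT g0 (e1.add g0 e2) r4, II_add hd hL hT g0 e1 e2, II_const_mul, II_const_mul,
    hz, add_zero] at this

end CarlemanWeight

end Weight

section Parabolic

namespace CarlemanWeight

variable {d L T K c s lam : ℝ} {u v : ℝ → ℝ → ℝ}

theorem parabolic (w : CarlemanWeight d L T K c s lam) (hd : 0 < d) (hL : 0 < L) (hT : 0 < T)
    (hK : 1 ≤ K) (hc : 0 < c) (hc1 : c ≤ 1) (hs : 9 * K ^ 3 ≤ c ^ 2 * s)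
    (hlam : 8 * K ^ 3 ≤ c ^ 2 * lam) (hu : SmoothPeriodic (d + 2 * L) u)
    (hv : SmoothPeriodic (d + 2 * L) v) (huv : pdx (pdx v) = pdt u) :
    lam * II d L T (fun x t =>
        (w.ρ x t)⁻¹ * (w.hat (pdt v) x t ^ 2 + w.hat (pdt u) x t ^ 2 + w.hat (pdx (pdx u)) x t ^ 2)
        + w.ρ x t * (w.hat (pdx v) x t ^ 2 + w.hat (pdx u) x t ^ 2)
        + w.ρ x t ^ 3 * (w.hat v x t ^ 2 + w.hat u x t ^ 2))
      ≤ (100000 * K ^ 6 / c ^ 2) *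
        (II d L T (fun x t =>
            (w.hat (pdt v) x t + w.hat (pdt u) x t + w.hat (pdx (pdx u)) x t) ^ 2)
          + lam * II d L T (fun x t => w.σ x *
            (w.ρ x t * (w.hat (pdx v) x t ^ 2 + w.hat (pdx u) x t ^ 2)
              + w.ρ x t ^ 3 * (w.hat v x t ^ 2 + w.hat u x t ^ 2)))) := by
  obtain ⟨β, hβ⟩ : ∃ β : ℝ, β ^ 2 = 3 / 4 := ⟨√(3 / 4), Real.sq_sqrt (by norm_num)⟩
  have g0 := w.one_le_θ
  have a1 := w.rapid_hat hu
  have a2 := w.rapid_hat hu.pdx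
  have a3 := w.rapid_hat hu.pdt
  have a4 := w.rapid_hat hu.pdx.pdx
  have a5 := w.rapid_hat hu.pdt.pdx
  have b1 := w.rapid_hat hv
  have b2 := w.rapid_hat hv.pdx
  have b3 := w.rapid_hat hv.pdt
  have b5 := w.rapid_hat hv.pdt.pdx
  have p1 := w.growth_ρ
  have p2 := w.growth_inv
  have p3 := w.growth_rt
  have p4 := w.growth_lt
  have p5 : PolyGrowth d L T w.θ (fun x _ => w.σ x) := .of_space w.cont_σ
  have p6 : PolyGrowth d L T w.θ (fun x _ => w.h x) := .of_space w.cont_h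
  have p7 : PolyGrowth d L T w.θ (fun x _ => w.h2 x) := .of_space w.cont_h2
  have p8 : PolyGrowth d L T w.θ (fun x _ => w.h3 x) := .of_space w.cont_h3
  obtain ⟨p, hp⟩ : ∃ p : ℝ → ℝ → ℝ, p = fun x t => w.hat v x t + (1 / 2) * w.hat u x t := ⟨_, rfl⟩
  obtain ⟨q, hq⟩ : ∃ q : ℝ → ℝ → ℝ, q = fun x t => -β * w.hat u x t := ⟨_, rfl⟩
  obtain ⟨px, hpx⟩ : ∃ px : ℝ → ℝ → ℝ, px = fun x t =>
    w.hat (pdx v) x t + (1 / 2) * w.hat (pdx u) x t + w.h x * w.ρ x t * p x t := ⟨_, rfl⟩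
  obtain ⟨qx, hqx⟩ : ∃ qx : ℝ → ℝ → ℝ, qx = fun x t =>
    -β * w.hat (pdx u) x t + w.h x * w.ρ x t * q x t := ⟨_, rfl⟩
  obtain ⟨pt, hpt⟩ : ∃ pt : ℝ → ℝ → ℝ, pt = fun x t =>
    w.hat (pdt v) x t + (1 / 2) * w.hat (pdt u) x t - w.lt x t * p x t := ⟨_, rfl⟩
  obtain ⟨qt, hqt⟩ : ∃ qt : ℝ → ℝ → ℝ, qt = fun x t =>
    -β * w.hat (pdt u) x t - w.lt x t * q x t := ⟨_, rfl⟩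
  obtain ⟨pxx, hpxx⟩ : ∃ pxx : ℝ → ℝ → ℝ, pxx = fun x t =>
    w.hat (pdt u) x t + w.h x * w.ρ x t * w.hat (pdx v) x t
      + (1 / 2) * (w.hat (pdx (pdx u)) x t + w.h x * w.ρ x t * w.hat (pdx u) x t)
      + (w.h2 x * w.ρ x t + w.h x * (lam * w.h x * w.ρ x t)) * p x t
      + w.h x * w.ρ x t * px x t := ⟨_, rfl⟩
  obtain ⟨qxx, hqxx⟩ : ∃ qxx : ℝ → ℝ → ℝ, qxx = fun x t =>
    -β * (w.hat (pdx (pdx u)) x t + w.h x * w.ρ x t * w.hat (pdx u) x t)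
      + (w.h2 x * w.ρ x t + w.h x * (lam * w.h x * w.ρ x t)) * q x t
      + w.h x * w.ρ x t * qx x t := ⟨_, rfl⟩
  obtain ⟨pxt, hpxt⟩ : ∃ pxt : ℝ → ℝ → ℝ, pxt = fun x t =>
    w.hat (pdx (pdt v)) x t + w.h x * w.ρ x t * w.hat (pdt v) x t
      + (1 / 2) * (w.hat (pdx (pdt u)) x t + w.h x * w.ρ x t * w.hat (pdt u) x t)
      + w.h x * w.rt x t * p x t - w.lt x t * px x t := ⟨_, rfl⟩
  obtain ⟨qxt, hqxt⟩ : ∃ qxt : ℝ → ℝ → ℝ, qxt = fun x t =>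
    -β * (w.hat (pdx (pdt u)) x t + w.h x * w.ρ x t * w.hat (pdt u) x t)
      + w.h x * w.rt x t * q x t - w.lt x t * qx x t := ⟨_, rfl⟩
  have dp_x : ∀ x, ∀ t ∈ Ioo (0:ℝ) T, HasDerivAt (fun y => p y t) (px x t) x := fun x t ht => by
    simp only [hpx, hp]
    refine ((w.hat_x hv x ht).add ((w.hat_x hu x ht).const_mul (1 / 2))).congr_deriv ?_
    ring
  have dq_x : ∀ x, ∀ t ∈ Ioo (0:ℝ) T, HasDerivAt (fun y => q y t) (qx x t) x := fun x t ht => by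
    simp only [hqx, hq]
    refine ((w.hat_x hu x ht).const_mul (-β)).congr_deriv ?_
    ring
  have dp_t : ∀ x, ∀ t ∈ Ioo (0:ℝ) T, HasDerivAt (fun τ => p x τ) (pt x t) t := fun x t ht => by
    simp only [hpt, hp]
    refine ((w.hat_t hv x ht).add ((w.hat_t hu x ht).const_mul (1 / 2))).congr_deriv ?_
    ring
  have dq_t : ∀ x, ∀ t ∈ Ioo (0:ℝ) T, HasDerivAt (fun τ => q x τ) (qt x t) t := fun x t ht => by
    simp only [hqt, hq]
    refine ((w.hat_t hu x ht).const_mul (-β)).congr_deriv ?_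
    ring
  have dpx_x : ∀ x, ∀ t ∈ Ioo (0:ℝ) T, HasDerivAt (fun y => px y t) (pxx x t) x :=
    fun x t ht => by
      have := dp_x x t ht
      simp only [hpxx]
      rw [hpx]
      refine (((w.hat_x hv.pdx x ht).add ((w.hat_x hu.pdx x ht).const_mul (1 / 2))).add
        (((w.h_x x).mul (w.ρ_x x t ht)).mul this)).congr_deriv ?_
      simp only [huv, hpx, Pi.mul_apply]
      ring
  have dqx_x : ∀ x, ∀ t ∈ Ioo (0:ℝ) T, HasDerivAt (fun y => qx y t) (qxx x t) x :=
    fun x t ht => by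
      have := dq_x x t ht
      simp only [hqxx]
      rw [hqx]
      refine (((w.hat_x hu.pdx x ht).const_mul (-β)).add
        (((w.h_x x).mul (w.ρ_x x t ht)).mul this)).congr_deriv ?_
      simp only [hqx, Pi.mul_apply]
      ring
  have dpt_x : ∀ x, ∀ t ∈ Ioo (0:ℝ) T, HasDerivAt (fun y => pt y t) (pxt x t) x :=
    fun x t ht => by
      have := dp_x x t ht
      simp only [hpxt]
      rw [hpt]
      refine (((w.hat_x hv.pdt x ht).add ((w.hat_x hu.pdt x ht).const_mul (1 / 2))).sub
        ((w.lt_x x t ht).mul this)).congr_deriv ?_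
      ring
  have dqt_x : ∀ x, ∀ t ∈ Ioo (0:ℝ) T, HasDerivAt (fun y => qt y t) (qxt x t) x :=
    fun x t ht => by
      have := dq_x x t ht
      simp only [hqxt]
      rw [hqt]
      refine (((w.hat_x hu.pdt x ht).const_mul (-β)).sub
        ((w.lt_x x t ht).mul this)).congr_deriv ?_
      ring
  have dpx_t : ∀ x, ∀ t ∈ Ioo (0:ℝ) T, HasDerivAt (fun τ => px x τ) (pxt x t) t :=
    fun x t ht => by
      have := dp_t x t ht
      simp only [hpxt]
      rw [hpx]
      refine (((w.hat_t hv.pdx x ht).add ((w.hat_t hu.pdx x ht).const_mul (1 / 2))).add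
        (((w.ρ_t x t ht).const_mul (w.h x)).mul this)).congr_deriv ?_
      simp only [hpt, hv.pdx_pdt, hu.pdx_pdt]
      ring
  have dqx_t : ∀ x, ∀ t ∈ Ioo (0:ℝ) T, HasDerivAt (fun τ => qx x τ) (qxt x t) t :=
    fun x t ht => by
      have := dq_t x t ht
      simp only [hqxt]
      rw [hqx]
      refine (((w.hat_t hu.pdx x ht).const_mul (-β)).add
        (((w.ρ_t x t ht).const_mul (w.h x)).mul this)).congr_deriv ?_
      simp only [hqt, hu.pdx_pdt]
      ring
  have rp : RapidDecay d L T w.θ p := by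
    rw [hp]
    repeat' first
      | assumption | exact RapidDecay.toPolyGrowth (by assumption) | apply RapidDecay.sub g0
      | apply RapidDecay.add g0 | apply RapidDecay.neg | apply RapidDecay.sq g0
      | apply PolyGrowth.mul_rapidDecay g0 | apply PolyGrowth.sub g0 | apply PolyGrowth.add g0
      | apply PolyGrowth.mul | apply PolyGrowth.pow | apply PolyGrowth.const
  have rq : RapidDecay d L T w.θ q := by
    rw [hq]
    repeat' first
      | assumption | exact RapidDecay.toPolyGrowth (by assumption) | apply RapidDecay.sub g0
      | apply RapidDecay.add g0 | apply RapidDecay.neg | apply RapidDecay.sq g0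
      | apply PolyGrowth.mul_rapidDecay g0 | apply PolyGrowth.sub g0 | apply PolyGrowth.add g0
      | apply PolyGrowth.mul | apply PolyGrowth.pow | apply PolyGrowth.const
  have rpx : RapidDecay d L T w.θ px := by
    rw [hpx]
    repeat' first
      | assumption | exact RapidDecay.toPolyGrowth (by assumption) | apply RapidDecay.sub g0
      | apply RapidDecay.add g0 | apply RapidDecay.neg | apply RapidDecay.sq g0
      | apply PolyGrowth.mul_rapidDecay g0 | apply PolyGrowth.sub g0 | apply PolyGrowth.add g0
      | apply PolyGrowth.mul | apply PolyGrowth.pow | apply PolyGrowth.const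
  have rqx : RapidDecay d L T w.θ qx := by
    rw [hqx]
    repeat' first
      | assumption | exact RapidDecay.toPolyGrowth (by assumption) | apply RapidDecay.sub g0
      | apply RapidDecay.add g0 | apply RapidDecay.neg | apply RapidDecay.sq g0
      | apply PolyGrowth.mul_rapidDecay g0 | apply PolyGrowth.sub g0 | apply PolyGrowth.add g0
      | apply PolyGrowth.mul | apply PolyGrowth.pow | apply PolyGrowth.const
  have rpt : RapidDecay d L T w.θ pt := by
    rw [hpt]
    repeat' first
      | assumption | exact RapidDecay.toPolyGrowth (by assumption) | apply RapidDecay.sub g0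
      | apply RapidDecay.add g0 | apply RapidDecay.neg | apply RapidDecay.sq g0
      | apply PolyGrowth.mul_rapidDecay g0 | apply PolyGrowth.sub g0 | apply PolyGrowth.add g0
      | apply PolyGrowth.mul | apply PolyGrowth.pow | apply PolyGrowth.const
  have rqt : RapidDecay d L T w.θ qt := by
    rw [hqt]
    repeat' first
      | assumption | exact RapidDecay.toPolyGrowth (by assumption) | apply RapidDecay.sub g0
      | apply RapidDecay.add g0 | apply RapidDecay.neg | apply RapidDecay.sq g0
      | apply PolyGrowth.mul_rapidDecay g0 | apply PolyGrowth.sub g0 | apply PolyGrowth.add g0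
      | apply PolyGrowth.mul | apply PolyGrowth.pow | apply PolyGrowth.const
  have rpxx : RapidDecay d L T w.θ pxx := by
    rw [hpxx]
    repeat' first
      | assumption | exact RapidDecay.toPolyGrowth (by assumption) | apply RapidDecay.sub g0
      | apply RapidDecay.add g0 | apply RapidDecay.neg | apply RapidDecay.sq g0
      | apply PolyGrowth.mul_rapidDecay g0 | apply PolyGrowth.sub g0 | apply PolyGrowth.add g0
      | apply PolyGrowth.mul | apply PolyGrowth.pow | apply PolyGrowth.const
  have rqxx : RapidDecay d L T w.θ qxx := by
    rw [hqxx]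
    repeat' first
      | assumption | exact RapidDecay.toPolyGrowth (by assumption) | apply RapidDecay.sub g0
      | apply RapidDecay.add g0 | apply RapidDecay.neg | apply RapidDecay.sq g0
      | apply PolyGrowth.mul_rapidDecay g0 | apply PolyGrowth.sub g0 | apply PolyGrowth.add g0
      | apply PolyGrowth.mul | apply PolyGrowth.pow | apply PolyGrowth.const
  have rpxt : RapidDecay d L T w.θ pxt := by
    rw [hpxt]
    repeat' first
      | assumption | exact RapidDecay.toPolyGrowth (by assumption) | apply RapidDecay.sub g0
      | apply RapidDecay.add g0 | apply RapidDecay.neg | apply RapidDecay.sq g0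
      | apply PolyGrowth.mul_rapidDecay g0 | apply PolyGrowth.sub g0 | apply PolyGrowth.add g0
      | apply PolyGrowth.mul | apply PolyGrowth.pow | apply PolyGrowth.const
  have rqxt : RapidDecay d L T w.θ qxt := by
    rw [hqxt]
    repeat' first
      | assumption | exact RapidDecay.toPolyGrowth (by assumption) | apply RapidDecay.sub g0
      | apply RapidDecay.add g0 | apply RapidDecay.neg | apply RapidDecay.sq g0
      | apply PolyGrowth.mul_rapidDecay g0 | apply PolyGrowth.sub g0 | apply PolyGrowth.add g0
      | apply PolyGrowth.mul | apply PolyGrowth.pow | apply PolyGrowth.const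
  obtain ⟨X, hX⟩ : ∃ X : ℝ → ℝ → ℝ, X = fun x t =>
    (pxx x t * pt x t + px x t * pxt x t + (qxx x t * qt x t + qx x t * qxt x t))
      - (2 * w.h2 x * w.ρ x t + 2 * w.h x * (lam * w.h x * w.ρ x t)) * (px x t ^ 2 + qx x t ^ 2)
      - 2 * w.h x * w.ρ x t * (2 * px x t * pxx x t + 2 * qx x t * qxx x t)
      - (2 * (2 * lam * w.h x * w.h2 x + w.h3 x) * w.ρ x t
          + 2 * (lam * w.h x ^ 2 + w.h2 x) * (lam * w.h x * w.ρ x t))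
        * (px x t * p x t + qx x t * q x t)
      - 2 * (lam * w.h x ^ 2 + w.h2 x) * w.ρ x t
        * (pxx x t * p x t + px x t ^ 2 + qxx x t * q x t + qx x t ^ 2)
      - (6 * w.h x ^ 2 * w.h2 x * w.ρ x t ^ 3
          + 6 * w.h x ^ 3 * w.ρ x t ^ 2 * (lam * w.h x * w.ρ x t)) * (p x t ^ 2 + q x t ^ 2)
      - 2 * w.h x ^ 3 * w.ρ x t ^ 3 * (2 * p x t * px x t + 2 * q x t * qx x t)
      - 2 * β * (w.h2 x * w.ρ x t + w.h x * (lam * w.h x * w.ρ x t))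
        * (qt x t * p x t - pt x t * q x t)
      - 2 * β * w.h x * w.ρ x t
        * (qxt x t * p x t + qt x t * px x t - pxt x t * q x t - pt x t * qx x t) := ⟨_, rfl⟩
  obtain ⟨Y, hY⟩ : ∃ Y : ℝ → ℝ → ℝ, Y = fun x t =>
    -(px x t * pxt x t + qx x t * qxt x t)
      + w.h x ^ 2 * w.ρ x t * w.rt x t * (p x t ^ 2 + q x t ^ 2)
      + w.h x ^ 2 * w.ρ x t ^ 2 * (p x t * pt x t + q x t * qt x t)
      + 2 * β * w.h x * w.rt x t * (qx x t * p x t - px x t * q x t)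
      + 2 * β * w.h x * w.ρ x t
        * (qxt x t * p x t + qx x t * pt x t - pxt x t * q x t - px x t * qt x t) := ⟨_, rfl⟩
  have rX : RapidDecay d L T w.θ X := by
    rw [hX]
    repeat' first
      | assumption | exact RapidDecay.toPolyGrowth (by assumption) | apply RapidDecay.sub g0
      | apply RapidDecay.add g0 | apply RapidDecay.neg | apply RapidDecay.sq g0
      | apply PolyGrowth.mul_rapidDecay g0 | apply PolyGrowth.sub g0 | apply PolyGrowth.add g0
      | apply PolyGrowth.mul | apply PolyGrowth.pow | apply PolyGrowth.const
  have rY : RapidDecay d L T w.θ Y := by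
    rw [hY]
    repeat' first
      | assumption | exact RapidDecay.toPolyGrowth (by assumption) | apply RapidDecay.sub g0
      | apply RapidDecay.add g0 | apply RapidDecay.neg | apply RapidDecay.sq g0
      | apply PolyGrowth.mul_rapidDecay g0 | apply PolyGrowth.sub g0 | apply PolyGrowth.add g0
      | apply PolyGrowth.mul | apply PolyGrowth.pow | apply PolyGrowth.const
  have zX : II d L T X = 0 := by
    refine II_space_deriv_eq_zero (θ := w.θ) (X := fun x t =>
      (px x t * pt x t + qx x t * qt x t) - 2 * w.h x * w.ρ x t * (px x t ^ 2 + qx x t ^ 2)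
        - 2 * (lam * w.h x ^ 2 + w.h2 x) * w.ρ x t * (px x t * p x t + qx x t * q x t)
        - 2 * w.h x ^ 3 * w.ρ x t ^ 3 * (p x t ^ 2 + q x t ^ 2)
        - 2 * β * w.h x * w.ρ x t * (qt x t * p x t - pt x t * q x t)) hd hL hT rX
      (fun x t ht => ?_) (fun t _ => ?_)
    · have e0 := w.h_x x
      have e1 := w.ρ_x x t ht
      have e2 := dp_x x t ht
      have e3 := dq_x x t ht
      have e4 := dpx_x x t ht
      have e5 := dqx_x x t ht
      have e6 := dpt_x x t ht
      have e7 := dqt_x x t ht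
      refine ((((((e4.mul e6).add (e5.mul e7)).sub
        (((e0.const_mul 2).mul e1).mul ((e4.pow 2).add (e5.pow 2)))).sub
        ((((((e0.pow 2).const_mul lam).add (w.h2_x x)).const_mul 2).mul e1).mul
          ((e4.mul e2).add (e5.mul e3)))).sub
        ((((e0.pow 3).const_mul 2).mul (e1.pow 3)).mul ((e2.pow 2).add (e3.pow 2)))).sub
        (((e0.const_mul (2 * β)).mul e1).mul ((e7.mul e2).sub (e6.mul e3)))).congr_deriv ?_
      simp only [hX, Pi.mul_apply, Pi.add_apply, Pi.sub_apply, Pi.pow_apply, Nat.cast_ofNat,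
        Nat.add_one_sub_one, pow_one]
      ring
    · simp only [hpx, hqx, hpt, hqt, hp, hq, w.hat_per hu, w.hat_per hu.pdx, w.hat_per hu.pdt,
        w.hat_per hv, w.hat_per hv.pdx, w.hat_per hv.pdt, w.h_per, w.h2_per, w.ρ_per, w.lt_per]
  have zY : II d L T Y = 0 := by
    refine II_time_deriv_eq_zero hd hL hT g0 w.tendsto_zero w.tendsto_T (Y := fun x t =>
      (-(1 / 2)) * (px x t ^ 2 + qx x t ^ 2)
        + 1 / 2 * w.h x ^ 2 * w.ρ x t ^ 2 * (p x t ^ 2 + q x t ^ 2)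
        + 2 * β * w.h x * w.ρ x t * (qx x t * p x t - px x t * q x t)) ?_ rY
      (fun x t ht => ?_)
    · repeat' first
        | assumption | exact RapidDecay.toPolyGrowth (by assumption) | apply RapidDecay.sub g0
        | apply RapidDecay.add g0 | apply RapidDecay.neg | apply RapidDecay.sq g0
        | apply PolyGrowth.mul_rapidDecay g0 | apply PolyGrowth.sub g0 | apply PolyGrowth.add g0
        | apply PolyGrowth.mul | apply PolyGrowth.pow | apply PolyGrowth.const
    · have e1 := w.ρ_t x t ht
      have e2 := dp_t x t ht
      have e3 := dq_t x t ht
      have e4 := dpx_t x t ht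
      have e5 := dqx_t x t ht
      refine (((((e4.pow 2).add (e5.pow 2)).const_mul (-(1 / 2))).add
        (((e1.pow 2).const_mul (1 / 2 * w.h x ^ 2)).mul ((e2.pow 2).add (e3.pow 2)))).add
        ((e1.const_mul (2 * β * w.h x)).mul ((e5.mul e2).sub (e4.mul e3)))).congr_deriv ?_
      simp only [hY, Pi.mul_apply, Pi.add_apply, Pi.sub_apply, Pi.pow_apply, Nat.cast_ofNat,
        Nat.add_one_sub_one, pow_one]
      ring
  have r1 : RapidDecay d L T w.θ (fun x t =>
        (w.ρ x t)⁻¹ * (w.hat (pdt v) x t ^ 2 + w.hat (pdt u) x t ^ 2 + w.hat (pdx (pdx u)) x t ^ 2)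
        + w.ρ x t * (w.hat (pdx v) x t ^ 2 + w.hat (pdx u) x t ^ 2)
        + w.ρ x t ^ 3 * (w.hat v x t ^ 2 + w.hat u x t ^ 2)) := by
    repeat' first
      | assumption | exact RapidDecay.toPolyGrowth (by assumption) | apply RapidDecay.sub g0
      | apply RapidDecay.add g0 | apply RapidDecay.neg | apply RapidDecay.sq g0
      | apply PolyGrowth.mul_rapidDecay g0 | apply PolyGrowth.sub g0 | apply PolyGrowth.add g0
      | apply PolyGrowth.mul | apply PolyGrowth.pow
  have r2 : RapidDecay d L T w.θ (fun x t =>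
      (w.hat (pdt v) x t + w.hat (pdt u) x t + w.hat (pdx (pdx u)) x t) ^ 2) := by
    repeat' first
      | assumption | exact RapidDecay.toPolyGrowth (by assumption) | apply RapidDecay.sub g0
      | apply RapidDecay.add g0 | apply RapidDecay.neg | apply RapidDecay.sq g0
  have r3 : RapidDecay d L T w.θ (fun x t => w.σ x *
            (w.ρ x t * (w.hat (pdx v) x t ^ 2 + w.hat (pdx u) x t ^ 2)
              + w.ρ x t ^ 3 * (w.hat v x t ^ 2 + w.hat u x t ^ 2))) := by
    repeat' first
      | assumption | exact RapidDecay.toPolyGrowth (by assumption) | apply RapidDecay.sub g0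
      | apply RapidDecay.add g0 | apply RapidDecay.neg | apply RapidDecay.sq g0
      | apply PolyGrowth.mul_rapidDecay g0 | apply PolyGrowth.sub g0 | apply PolyGrowth.add g0
      | apply PolyGrowth.mul | apply PolyGrowth.pow
  have l1 := (PolyGrowth.const lam).mul_rapidDecay g0 r1
  have l3 := (PolyGrowth.const lam).mul_rapidDecay g0 r3
  have l23 := (PolyGrowth.const (100000 * K ^ 6 / c ^ 2)).mul_rapidDecay g0 (r2.add g0 l3)
  have lD := (PolyGrowth.const (-(2080 * K ^ 4 / c ^ 2))).mul_rapidDecay g0 (rX.add g0 rY)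
  have := II_mono hd hL hT l1 (l23.add g0 lD) fun x hx t ht => by
    have := parabolic_pointwise (h3 := w.h3 x) (pxt := pxt x t) (qxt := qxt x t)
      (u := w.hat u x t) (u1 := w.hat (pdx u) x t) (ut := w.hat (pdt u) x t)
      (u11 := w.hat (pdx (pdx u)) x t) (v := w.hat v x t) (v1 := w.hat (pdx v) x t)
      (vt := w.hat (pdt v) x t) (p := p x t) (q := q x t) (px := px x t) (qx := qx x t)
      (pt := pt x t) (qt := qt x t) (pxx := pxx x t) (qxx := qxx x t)
      hβ hK hc hc1 w.s_le hs w.lam_le hlam (w.ρ_ge x hx t ht)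
      (w.le_σ x hx) (w.σ_nonneg x) (w.h_le x hx) (w.h2_le x hx) (w.h3_le x hx) (w.rt_le x hx t ht)
      (w.lt_sq_le x hx t ht) (by rw [hp]; ring) (by rw [hq]) (by rw [hpx]; ring) (by rw [hqx])
      (by rw [hpt]; ring) (by rw [hqt]) (by rw [hpxx]; ring) (by rw [hqxx]) rfl rfl
    simp only [hX, hY]
    linarith
  rwa [II_const_mul, II_add hd hL hT g0 l23 lD, II_const_mul, II_const_mul,
    II_add hd hL hT g0 r2 l3, II_add hd hL hT g0 rX rY, II_const_mul, zX, zY, add_zero, mul_zero,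
    add_zero] at this

end CarlemanWeight

end Parabolic

section BeamEstimate

/-- Absorption of the local terms of the chain of estimates for the beam operator. -/
theorem exists_absorption_const {A B c C₁ C₂ C₃ C₄ ε₂ ε₃ : ℝ} (hA : 0 < A) (hB : 0 ≤ B)
    (hc : 0 < c) (hC₁ : 0 ≤ C₁) (hC₂ : 0 ≤ C₂) (hC₃ : 0 ≤ C₃) (hC₄ : 0 ≤ C₄)
    (hε₂ : 16 * A * (C₁ + 1) * ε₂ ≤ 1) (hε₃ : 0 ≤ ε₃) (hε₃c : 4 * ε₃ ≤ c)
    (hε₃A : 32 * A * (C₁ + 1) * C₃ * (1 + B / c) * ε₃ ≤ 1) :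
    ∃ D, 0 < D ∧ ∀ z₀ z₁ Z l₀ l₁ l₂ l₃ F : ℝ, 0 ≤ Z → 0 ≤ l₀ → 0 ≤ l₁ → 0 ≤ F →
      Z ≤ A * (F + l₃ + l₂) → c * z₀ ≤ 2 * l₀ + B * z₁ → c * z₁ ≤ 2 * l₁ + B * Z →
      l₃ ≤ 1 / (8 * A) * Z + C₁ * l₂ → l₂ ≤ 2 * ε₂ * Z + C₂ * l₀ + C₃ * l₁ →
      l₁ ≤ ε₃ * (Z + z₁) + C₄ * l₀ → z₀ + z₁ + Z ≤ D * (F + l₀) := by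
  set DZ := 2 * A + 2 * A * (C₁ + 1) * (C₂ + 2 * C₃ * C₄) with hDZ
  set D1 := (1 + 2 * B / c) * DZ + 4 * C₄ / c with hD1
  set D0 := 2 / c + B / c * D1 with hD0
  refine ⟨D0 + D1 + DZ, by positivity, ?_⟩
  intro z₀ z₁ Z l₀ l₁ l₂ l₃ F hZ hl₀ hl₁ hF hP hS0 hS1 hL3 hL2 hL1
  have hz₁ : z₁ ≤ 2 / c * l₁ + B / c * Z := by
    have : z₁ ≤ (2 * l₁ + B * Z) / c := by rw [le_div_iff₀ hc]; linarith
    calc z₁ ≤ _ := this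
      _ = _ := by ring
  have hz₀ : z₀ ≤ 2 / c * l₀ + B / c * z₁ := by
    have : z₀ ≤ (2 * l₀ + B * z₁) / c := by rw [le_div_iff₀ hc]; linarith
    calc z₀ ≤ _ := this
      _ = _ := by ring
  have hl₁' : l₁ ≤ 2 * ε₃ * (1 + B / c) * Z + 2 * C₄ * l₀ := by
    have h1 : ε₃ * z₁ ≤ ε₃ * (2 / c * l₁ + B / c * Z) := mul_le_mul_of_nonneg_left hz₁ hε₃
    have h2 : ε₃ * (2 / c) ≤ 1 / 2 := by
      rw [← mul_div_assoc, div_le_iff₀ hc]; linarith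
    have h3 := mul_le_mul_of_nonneg_right h2 hl₁
    linarith
  have hZ' : Z ≤ 2 * A * F + 2 * A * (C₁ + 1) * (C₂ + 2 * C₃ * C₄) * l₀ := by
    have h1 : A * l₃ ≤ 1 / 8 * Z + A * C₁ * l₂ := by
      have := mul_le_mul_of_nonneg_left hL3 hA.le
      have e : A * (1 / (8 * A) * Z + C₁ * l₂) = 1 / 8 * Z + A * C₁ * l₂ := by field_simp
      linarith
    have h2 : A * (C₁ + 1) * l₂ ≤ A * (C₁ + 1) * (2 * ε₂ * Z + C₂ * l₀ +
        C₃ * (2 * ε₃ * (1 + B / c) * Z + 2 * C₄ * l₀)) := by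
      refine mul_le_mul_of_nonneg_left (hL2.trans ?_) (by positivity)
      have := mul_le_mul_of_nonneg_left hl₁' hC₃
      linarith
    have h3 := mul_le_mul_of_nonneg_right hε₂ hZ
    have h4 := mul_le_mul_of_nonneg_right hε₃A hZ
    linarith
  have hZF : Z ≤ DZ * (F + l₀) := by
    have h1 : 0 ≤ 2 * A * l₀ := by positivity
    have h2 : 0 ≤ 2 * A * (C₁ + 1) * (C₂ + 2 * C₃ * C₄) * F := by positivity
    rw [hDZ]; linarith
  have hz₁F : z₁ ≤ D1 * (F + l₀) := by
    have h1 : 2 * ε₃ * (1 + B / c) * Z ≤ c / 2 * (1 + B / c) * Z := by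
      have : 2 * ε₃ ≤ c / 2 := by linarith
      gcongr
    have h2 : z₁ ≤ (1 + 2 * B / c) * Z + 4 * C₄ / c * l₀ := by
      have := mul_le_mul_of_nonneg_left (hl₁'.trans (add_le_add_left h1 _)) (by positivity : 0 ≤ 2 / c)
      have e : 2 / c * (c / 2 * (1 + B / c) * Z + 2 * C₄ * l₀)
          = (1 + B / c) * Z + 4 * C₄ / c * l₀ := by field_simp; ring
      have e2 : (1 + 2 * B / c) * Z = (1 + B / c) * Z + B / c * Z := by ring
      linarith
    have h3 := mul_le_mul_of_nonneg_left hZF (by positivity : 0 ≤ 1 + 2 * B / c)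
    have h4 : 0 ≤ 4 * C₄ / c * F := by positivity
    rw [hD1]; linarith
  have hz₀F : z₀ ≤ D0 * (F + l₀) := by
    have h3 := mul_le_mul_of_nonneg_left hz₁F (by positivity : 0 ≤ B / c)
    have h4 : 0 ≤ 2 / c * F := by positivity
    rw [hD0]; linarith
  linarith

variable {d L T K c : ℝ}

theorem II_nonneg (hd : 0 < d) (hL : 0 < L) (hT : 0 < T)
    {F : ℝ → ℝ → ℝ} (h : ∀ x ∈ Icc (-L) (d + L), ∀ t ∈ Ioo (0:ℝ) T, 0 ≤ F x t) :
    0 ≤ II d L T F := by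
  rw [II_eq_setIntegral hd hL hT]
  exact setIntegral_nonneg measurableSet_Ioo fun t ht =>
    setIntegral_nonneg measurableSet_Icc fun x hx => h x hx t ht

theorem II_mul_add_sq (hd : 0 < d) (hL : 0 < L) (hT : 0 < T) {θ : ℝ → ℝ} {κ F G : ℝ → ℝ → ℝ}
    (hθ : ∀ t ∈ Ioo (0:ℝ) T, 1 ≤ θ t) (hκ : PolyGrowth d L T θ κ)
    (hF : RapidDecay d L T θ F) (hG : RapidDecay d L T θ G) :
    II d L T (fun x t => κ x t * (F x t ^ 2 + G x t ^ 2))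
      = II d L T (fun x t => κ x t * F x t ^ 2) + II d L T (fun x t => κ x t * G x t ^ 2) := by
  rw [← II_add hd hL hT hθ (hκ.mul_rapidDecay hθ (hF.sq hθ)) (hκ.mul_rapidDecay hθ (hG.sq hθ))]
  simp only [mul_add]

namespace CarlemanWeight

/-- The weighted estimate for the beam operator, with a constant depending on the weight only
through `K` and `c`. -/
theorem beam_estimate (hd : 0 < d) (hL : 0 < L) (hT : 0 < T) (hK : 1 ≤ K) (hc : 0 < c)
    (hc1 : c ≤ 1) :
    ∃ D, 0 < D ∧ ∀ (s lam : ℝ) (w : CarlemanWeight d L T K c s lam) (ψ : ℝ → ℝ → ℝ),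
      9 * K ^ 3 ≤ c ^ 2 * s → 2 * K ≤ c * s → 8 * K ^ 3 ≤ c ^ 2 * lam →
      SmoothPeriodic (d + 2 * L) ψ →
      lam * (II d L T (fun x t => w.ρ x t ^ 7 * w.hat ψ x t ^ 2)
        + II d L T (fun x t => w.ρ x t ^ 5 * w.hat (pdx ψ) x t ^ 2)
        + II d L T (fun x t => w.ρ x t ^ 3 *
            (w.hat (pdx (pdx ψ)) x t ^ 2 + w.hat (pdt ψ) x t ^ 2))
        + II d L T (fun x t => w.ρ x t *
            (w.hat (pdt (pdx ψ)) x t ^ 2 + w.hat (pdx (pdx (pdx ψ))) x t ^ 2))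
        + II d L T (fun x t => (w.ρ x t)⁻¹ *
            (w.hat (pdt (pdt ψ)) x t ^ 2 + w.hat (pdt (pdx (pdx ψ))) x t ^ 2
              + w.hat (pdx (pdx (pdx (pdx ψ)))) x t ^ 2)))
      ≤ D * (II d L T (fun x t => (w.hat (pdt (pdt ψ)) x t + w.hat (pdt (pdx (pdx ψ))) x t
            + w.hat (pdx (pdx (pdx (pdx ψ)))) x t) ^ 2)
          + lam * II d L T (fun x t => w.σ x * w.ρ x t ^ 7 * w.hat ψ x t ^ 2)) := by
  set A := 100000 * K ^ 6 / c ^ 2 with hAdef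
  set B := 2 * K ^ 2 / c with hBdef
  have hA : 0 < A := by positivity
  have hB : 0 ≤ B := by positivity
  obtain ⟨C₁, hC₁, e3⟩ := space_local (c := c) (ε := 1 / (8 * A)) hd hL hT hK (by positivity) 1
  set ε₂ := 1 / (16 * A * (C₁ + 1)) with hε₂
  have hε₂0 : 0 < ε₂ := by positivity
  obtain ⟨C₂, hC₂, e2t⟩ := time_local (c := c) (ε := ε₂) hd hL hT hK hε₂0
  obtain ⟨C₃, hC₃, e2x⟩ := space_local (c := c) (ε := ε₂) hd hL hT hK hε₂0 3
  set ε₃ := min (c / 4) (1 / (32 * A * (C₁ + 1) * (C₃ + 1) * (1 + B / c))) with hε₃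
  have hε₃0 : 0 < ε₃ := by positivity
  obtain ⟨C₄, hC₄, e1⟩ := space_local (c := c) (ε := ε₃) hd hL hT hK hε₃0 5
  obtain ⟨D, hD, H⟩ := exists_absorption_const (ε₂ := ε₂) (ε₃ := ε₃) hA hB hc hC₁ hC₂ hC₃ hC₄
    (by rw [hε₂, mul_one_div_cancel (by positivity)]) hε₃0.le
    (by linarith [min_le_left (c / 4) (1 / (32 * A * (C₁ + 1) * (C₃ + 1) * (1 + B / c)))])
    (by
      have h1 : ε₃ ≤ 1 / (32 * A * (C₁ + 1) * (C₃ + 1) * (1 + B / c)) := min_le_right _ _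
      rw [le_div_iff₀ (by positivity)] at h1
      have h2 : 0 ≤ 32 * A * (C₁ + 1) * (1 + B / c) * ε₃ := by positivity
      linarith)
  refine ⟨D, hD, fun s lam w ψ hs hKs hlam hψ => ?_⟩
  have hlam0 : 0 < lam := zero_lt_one.trans_le w.lam_le
  have g0 := w.one_le_θ
  have txx : pdx (pdx (pdt ψ)) = pdt (pdx (pdx ψ)) := by rw [hψ.pdx_pdt, hψ.pdx.pdx_pdt]
  have f2 := w.rapid_hat hψ.pdx.pdx
  have f3 := w.rapid_hat hψ.pdx.pdx.pdx
  have f4 := w.rapid_hat hψ.pdx.pdx.pdx.pdx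
  have ft := w.rapid_hat hψ.pdt
  have ftt := w.rapid_hat hψ.pdt.pdt
  have ftx := w.rapid_hat hψ.pdx.pdt
  have ftxx := w.rapid_hat hψ.pdx.pdx.pdt
  have p1 := w.growth_ρ
  have p2 := w.growth_inv
  have p4 : PolyGrowth d L T w.θ (fun x _ => w.σ x) := .of_space w.cont_σ
  have hin : ∀ f : ℝ → ℝ → ℝ, ∀ k : ℕ, SmoothPeriodic (d + 2 * L) f →
      II d L T (fun x t => w.ρ x t ^ (k + 2) * ((w.ρ x t)⁻¹ ^ 2 * w.hat (pdx (pdx f)) x t ^ 2 + w.hat (pdx f) x t ^ 2))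
      = II d L T (fun x t => w.ρ x t ^ k * w.hat (pdx (pdx f)) x t ^ 2)
        + II d L T (fun x t => w.ρ x t ^ (k + 2) * w.hat (pdx f) x t ^ 2) := by
    intro f k hf
    rw [← II_add hd hL hT g0 ((p1.pow _).mul_rapidDecay g0 ((w.rapid_hat hf.pdx.pdx).sq g0))
      ((p1.pow _).mul_rapidDecay g0 ((w.rapid_hat hf.pdx).sq g0))]
    refine II_congr hd hL hT fun x t ht => ?_
    have := (w.ρ_pos x t ht).ne'
    field_simp
    ring
  have hin1 : ∀ f : ℝ → ℝ → ℝ, SmoothPeriodic (d + 2 * L) f →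
      II d L T (fun x t => w.ρ x t ^ 1 * ((w.ρ x t)⁻¹ ^ 2 * w.hat (pdx (pdx f)) x t ^ 2 + w.hat (pdx f) x t ^ 2))
      = II d L T (fun x t => (w.ρ x t)⁻¹ * w.hat (pdx (pdx f)) x t ^ 2)
        + II d L T (fun x t => w.ρ x t * w.hat (pdx f) x t ^ 2) := by
    intro f hf
    rw [← II_add hd hL hT g0 (p2.mul_rapidDecay g0 ((w.rapid_hat hf.pdx.pdx).sq g0))
      (p1.mul_rapidDecay g0 ((w.rapid_hat hf.pdx).sq g0))]
    refine II_congr hd hL hT fun x t ht => ?_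
    have := (w.ρ_pos x t ht).ne'
    field_simp
  have a3t := e3 s lam w _ hψ.pdt
  have a3x := e3 s lam w _ hψ.pdx.pdx
  have a2t := e2t s lam w _ hψ
  have a2x := e2x s lam w _ hψ.pdx
  have a1 := e1 s lam w _ hψ
  rw [hin1 _ hψ.pdt, hψ.pdx_pdt, hψ.pdx.pdx_pdt] at a3t
  rw [hin1 _ hψ.pdx.pdx] at a3x
  rw [hin _ 1 hψ.pdx] at a2x
  simp only [pow_one] at a3t a3x a2x
  rw [hin _ 3 hψ] at a1
  rw [II_add hd hL hT g0 (p2.mul_rapidDecay g0 (ftt.sq g0))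
    ((p1.pow 3).mul_rapidDecay g0 (ft.sq g0))] at a2t
  have s0 := w.space_static hd hL hT hc hKs 5 hψ
  have s1 := w.space_static hd hL hT hc hKs 3 hψ.pdx
  have hP := w.parabolic hd hL hT hK hc hc1 hs hlam hψ.pdx.pdx hψ.pdt txx
  rw [hψ.pdx_pdt] at hP
  have r4' := p2.mul_rapidDecay g0 ((ftt.sq g0).add g0 (ftxx.sq g0))
  have r4 := p2.mul_rapidDecay g0 (((ftt.sq g0).add g0 (ftxx.sq g0)).add g0 (f4.sq g0))
  have r3 := p1.mul_rapidDecay g0 ((ftx.sq g0).add g0 (f3.sq g0))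
  have r2 := (p1.pow 3).mul_rapidDecay g0 ((ft.sq g0).add g0 (f2.sq g0))
  have split4 : II d L T (fun x t => (w.ρ x t)⁻¹ *
            (w.hat (pdt (pdt ψ)) x t ^ 2 + w.hat (pdt (pdx (pdx ψ))) x t ^ 2
              + w.hat (pdx (pdx (pdx (pdx ψ)))) x t ^ 2))
      = II d L T (fun x t => (w.ρ x t)⁻¹ * w.hat (pdt (pdt ψ)) x t ^ 2)
        + II d L T (fun x t => (w.ρ x t)⁻¹ * w.hat (pdt (pdx (pdx ψ))) x t ^ 2)
        + II d L T (fun x t => (w.ρ x t)⁻¹ * w.hat (pdx (pdx (pdx (pdx ψ)))) x t ^ 2) := by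
    rw [← II_mul_add_sq hd hL hT g0 p2 ftt ftxx,
      ← II_add hd hL hT g0 r4' (p2.mul_rapidDecay g0 (f4.sq g0))]
    simp only [mul_add]
  have splitσ : II d L T (fun x t => w.σ x *
        (w.ρ x t * (w.hat (pdt (pdx ψ)) x t ^ 2 + w.hat (pdx (pdx (pdx ψ))) x t ^ 2)
          + w.ρ x t ^ 3 * (w.hat (pdt ψ) x t ^ 2 + w.hat (pdx (pdx ψ)) x t ^ 2)))
      = II d L T (fun x t => w.σ x * w.ρ x t * w.hat (pdt (pdx ψ)) x t ^ 2)
        + II d L T (fun x t => w.σ x * w.ρ x t * w.hat (pdx (pdx (pdx ψ))) x t ^ 2)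
        + (II d L T (fun x t => w.σ x * w.ρ x t ^ 3 * w.hat (pdt ψ) x t ^ 2)
        + II d L T (fun x t => w.σ x * w.ρ x t ^ 3 * w.hat (pdx (pdx ψ)) x t ^ 2)) := by
    rw [← II_mul_add_sq hd hL hT g0 (p4.mul p1) ftx f3,
      ← II_mul_add_sq hd hL hT g0 (p4.mul (p1.pow 3)) ft f2,
      ← II_add hd hL hT g0
        ((p4.mul p1).mul_rapidDecay g0 ((ftx.sq g0).add g0 (f3.sq g0)))
        ((p4.mul (p1.pow 3)).mul_rapidDecay g0 ((ft.sq g0).add g0 (f2.sq g0)))]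
    simp only [mul_add, mul_assoc]
  rw [II_add hd hL hT g0 (r4.add g0 r3) r2, II_add hd hL hT g0 r4 r3, split4, splitσ,
    II_mul_add_sq hd hL hT g0 p1 ftx f3, II_mul_add_sq hd hL hT g0 (p1.pow 3) ft f2] at hP
  rw [split4, II_mul_add_sq hd hL hT g0 p1 ftx f3, II_mul_add_sq hd hL hT g0 (p1.pow 3) f2 ft]
  have nonneg : ∀ {κ G : ℝ → ℝ → ℝ}, (∀ x, ∀ t ∈ Ioo (0:ℝ) T, 0 ≤ κ x t) →
      0 ≤ II d L T (fun x t => κ x t * G x t ^ 2) := fun hκ =>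
    II_nonneg hd hL hT fun x _ t ht => mul_nonneg (hκ x t ht) (sq_nonneg _)
  have hρ : ∀ k : ℕ, ∀ x, ∀ t ∈ Ioo (0:ℝ) T, 0 ≤ w.ρ x t ^ k := fun k x t ht =>
    pow_nonneg (w.ρ_pos x t ht).le k
  have hρ1 : ∀ x, ∀ t ∈ Ioo (0:ℝ) T, 0 ≤ w.ρ x t := fun x t ht => (w.ρ_pos x t ht).le
  have hρi : ∀ x, ∀ t ∈ Ioo (0:ℝ) T, 0 ≤ (w.ρ x t)⁻¹ := fun x t ht =>
    inv_nonneg.2 (w.ρ_pos x t ht).le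
  have hσρ : ∀ k : ℕ, ∀ x, ∀ t ∈ Ioo (0:ℝ) T, 0 ≤ w.σ x * w.ρ x t ^ k := fun k x t ht =>
    mul_nonneg (w.σ_nonneg x) (hρ k x t ht)
  have n4a := nonneg (G := w.hat (pdt (pdt ψ))) hρi
  have n4b := nonneg (G := w.hat (pdt (pdx (pdx ψ)))) hρi
  have n4c := nonneg (G := w.hat (pdx (pdx (pdx (pdx ψ))))) hρi
  have n3a := nonneg (G := w.hat (pdt (pdx ψ))) hρ1
  have n3b := nonneg (G := w.hat (pdx (pdx (pdx ψ)))) hρ1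
  have n2a := nonneg (G := w.hat (pdt ψ)) (hρ 3)
  have n2b := nonneg (G := w.hat (pdx (pdx ψ))) (hρ 3)
  have m1 := nonneg (G := w.hat (pdx ψ)) (hσρ 5)
  have m0 := nonneg (G := w.hat ψ) (hσρ 7)
  have mF : 0 ≤ II d L T (fun x t => (w.hat (pdt (pdt ψ)) x t + w.hat (pdt (pdx (pdx ψ))) x t
            + w.hat (pdx (pdx (pdx (pdx ψ)))) x t) ^ 2) :=
    II_nonneg hd hL hT fun x _ t _ => sq_nonneg _
  norm_num only [Nat.reduceAdd] at a3t a3x a2x a1 s0 s1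
  generalize II d L T (fun x t => (w.ρ x t)⁻¹ * w.hat (pdt (pdt ψ)) x t ^ 2) = z4a at *
  generalize II d L T (fun x t => (w.ρ x t)⁻¹ * w.hat (pdt (pdx (pdx ψ))) x t ^ 2) = z4b at *
  generalize II d L T (fun x t => (w.ρ x t)⁻¹ * w.hat (pdx (pdx (pdx (pdx ψ)))) x t ^ 2) = z4c at *
  generalize II d L T (fun x t => w.ρ x t * w.hat (pdt (pdx ψ)) x t ^ 2) = z3a at *
  generalize II d L T (fun x t => w.ρ x t * w.hat (pdx (pdx (pdx ψ))) x t ^ 2) = z3b at *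
  generalize II d L T (fun x t => w.ρ x t ^ 3 * w.hat (pdt ψ) x t ^ 2) = z2a at *
  generalize II d L T (fun x t => w.ρ x t ^ 3 * w.hat (pdx (pdx ψ)) x t ^ 2) = z2b at *
  generalize II d L T (fun x t => w.ρ x t ^ 5 * w.hat (pdx ψ) x t ^ 2) = z1 at *
  generalize II d L T (fun x t => w.ρ x t ^ 7 * w.hat ψ x t ^ 2) = z0 at *
  generalize II d L T (fun x t => w.σ x * w.ρ x t ^ 7 * w.hat ψ x t ^ 2) = l0 at *
  generalize II d L T (fun x t => w.σ x * w.ρ x t ^ 5 * w.hat (pdx ψ) x t ^ 2) = l1 at *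
  generalize II d L T (fun x t => w.σ x * w.ρ x t ^ 3 * w.hat (pdt ψ) x t ^ 2) = l2a at *
  generalize II d L T (fun x t => w.σ x * w.ρ x t ^ 3 * w.hat (pdx (pdx ψ)) x t ^ 2) = l2b at *
  generalize II d L T (fun x t => w.σ x * w.ρ x t * w.hat (pdt (pdx ψ)) x t ^ 2) = l3a at *
  generalize II d L T (fun x t => w.σ x * w.ρ x t * w.hat (pdx (pdx (pdx ψ))) x t ^ 2) = l3b at *
  generalize II d L T (fun x t => (w.hat (pdt (pdt ψ)) x t + w.hat (pdt (pdx (pdx ψ))) x t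
            + w.hat (pdx (pdx (pdx (pdx ψ)))) x t) ^ 2) = F at *
  have hZ : z4a + z4b + z4c + (z3a + z3b) + (z2a + z2b)
      ≤ A * (F / lam + (l3a + l3b) + (l2a + l2b)) := by
    refine le_of_mul_le_mul_left (hP.trans_eq ?_) hlam0
    rw [← hAdef]
    field_simp
    ring
  have key := H z0 z1 _ l0 l1 (l2a + l2b) (l3a + l3b) (F / lam) (by positivity) m0 m1
    (by positivity) hZ s0
    (s1.trans (by gcongr; linarith))
    (by
      have := mul_nonneg (by positivity : 0 ≤ 1 / (8 * A))
        (by positivity : 0 ≤ z4a + z2a + z2b)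
      linarith)
    (by
      have := mul_nonneg hε₂0.le
        (by positivity : 0 ≤ z4a + z4b + z4c + z4b + z4c + (z3a + z3a + z3b) + (z2a + z2b))
      linarith)
    (by
      have := mul_nonneg hε₃0.le
        (by positivity : 0 ≤ z4a + z4b + z4c + (z3a + z3b) + z2a)
      linarith)
  have := mul_le_mul_of_nonneg_left key hlam0.le
  have e : lam * (D * (F / lam + l0)) = D * (F + lam * l0) := by field_simp
  linarith

end CarlemanWeight

end BeamEstimate

section Cutoff

theorem hasDerivAt_max_zero_sq (y : ℝ) :
    HasDerivAt (fun y : ℝ => max y 0 ^ 2) (2 * max y 0) y := by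
  rcases lt_trichotomy y 0 with hy | rfl | hy
  · rw [max_eq_right hy.le, mul_zero]
    refine (hasDerivAt_const y (0:ℝ)).congr_of_eventuallyEq ?_
    filter_upwards [Iio_mem_nhds hy] with z hz
    simp [max_eq_right (le_of_lt (mem_Iio.1 hz))]
  · have h : (fun z : ℝ => max z 0 ^ 2) =o[𝓝 0] fun z : ℝ => z := by
      refine Asymptotics.IsBigO.trans_isLittleO (g := fun z : ℝ => z ^ 2) ?_
        (Asymptotics.isLittleO_pow_id one_lt_two)
      refine Asymptotics.IsBigO.of_bound 1 (Eventually.of_forall fun z => ?_)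
      rw [norm_pow, norm_pow, one_mul, Real.norm_eq_abs, Real.norm_eq_abs]
      refine pow_le_pow_left₀ (abs_nonneg _) ?_ 2
      rw [abs_of_nonneg (le_max_right _ _)]
      exact max_le (le_abs_self z) (abs_nonneg z)
    rw [hasDerivAt_iff_isLittleO_nhds_zero]
    simpa using h
  · rw [max_eq_left hy.le]
    refine (((hasDerivAt_id y).pow 2).congr_deriv (by simp)).congr_of_eventuallyEq ?_
    filter_upwards [Ioi_mem_nhds hy] with z hz
    simp [max_eq_left (le_of_lt (mem_Ioi.1 hz))]

/-- A periodic cutoff that vanishes on `[0, d]` and is positive on the rest of a period. -/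
theorem exists_cutoff {d L : ℝ} (hd : 0 < d) (hL : 0 < L) :
    ∃ σ σ1 : ℝ → ℝ, ∃ K : ℝ, Continuous σ ∧ Continuous σ1 ∧ (∀ x, HasDerivAt σ (σ1 x) x) ∧
      σ (-L) = σ (d + L) ∧ (∀ x, 0 ≤ σ x) ∧ (∀ x, σ x ≤ 4) ∧ (∀ x, σ1 x ^ 2 ≤ K * σ x) ∧
      (∀ x ∈ Icc 0 d, σ x = 0) ∧ ∀ x ∈ Icc (-L) (d + L), x ∉ Icc 0 d → 0 < σ x := by
  set P := d + 2 * L with hP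
  have hP0 : 0 < P := by positivity
  set a := 2 * π / P with ha
  have ha0 : 0 < a := by have := Real.pi_pos; positivity
  have had : a * (d / 2) ≤ π := by
    rw [ha, div_mul_eq_mul_div, div_le_iff₀ hP0]
    nlinarith [Real.pi_pos]
  set g : ℝ → ℝ := fun x => Real.cos (a * (d / 2)) - Real.cos (a * (x - d / 2)) with hg
  have hgx : ∀ x, HasDerivAt g (a * Real.sin (a * (x - d / 2))) x := fun x => by
    have h1 : HasDerivAt (fun y : ℝ => a * (y - d / 2)) a x := by
      simpa using ((hasDerivAt_id x).sub_const (d / 2)).const_mul a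
    refine ((h1.cos).const_sub _).congr_deriv ?_
    ring
  have hgc : Continuous g := by fun_prop
  have hcos : ∀ x, Real.cos (a * (x - d / 2)) = Real.cos (a * |x - d / 2|) := fun x => by
    rw [← Real.cos_abs, abs_mul, abs_of_pos ha0]
  refine ⟨fun x => max (g x) 0 ^ 2, fun x => 2 * max (g x) 0 * (a * Real.sin (a * (x - d / 2))),
    4 * a ^ 2, by fun_prop, by fun_prop, fun x => ?_, ?_, fun x => sq_nonneg _, fun x => ?_,
    fun x => ?_, fun x hx => ?_, fun x hx hx' => ?_⟩
  · exact (hasDerivAt_max_zero_sq (g x)).comp x (hgx x)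
  · have : g (-L) = g (d + L) := by
      simp only [hg, hcos]
      rw [show |(-L) - d / 2| = |d + L - d / 2| by
        rw [abs_of_neg (by linarith), abs_of_pos (by linarith)]; ring]
    simp only [this]
  · have h1 : max (g x) 0 ≤ 2 := by
      refine max_le ?_ zero_le_two
      simp only [hg]
      linarith [Real.cos_le_one (a * (d / 2)), Real.neg_one_le_cos (a * (x - d / 2))]
    calc max (g x) 0 ^ 2 ≤ 2 ^ 2 := pow_le_pow_left₀ (le_max_right _ _) h1 2
      _ = 4 := by norm_num
  · have h1 := Real.sin_sq_le_one (a * (x - d / 2))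
    have h2 : 0 ≤ 4 * a ^ 2 * max (g x) 0 ^ 2 := by positivity
    nlinarith [mul_le_mul_of_nonneg_left h1 h2]
  · have : g x ≤ 0 := by
      simp only [hg, hcos, sub_nonpos]
      refine Real.cos_le_cos_of_nonneg_of_le_pi (by positivity) had ?_
      refine mul_le_mul_of_nonneg_left (abs_le.2 ⟨?_, ?_⟩) ha0.le <;> linarith [hx.1, hx.2]
    simp only [max_eq_right this, ne_eq, OfNat.ofNat_ne_zero, not_false_eq_true, zero_pow]
  · have h1 : d / 2 < |x - d / 2| := by
      rcases lt_or_ge x 0 with h | h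
      · exact lt_abs.2 (Or.inr (by linarith))
      · refine lt_abs.2 (Or.inl ?_)
        have : d < x := by by_contra! h'; exact hx' ⟨h, h'⟩
        linarith
    have h2 : a * |x - d / 2| ≤ π := by
      have : |x - d / 2| ≤ P / 2 := abs_le.2 ⟨by linarith [hx.1], by linarith [hx.2]⟩
      calc a * |x - d / 2| ≤ a * (P / 2) := mul_le_mul_of_nonneg_left this ha0.le
        _ = π := by rw [ha]; field_simp
    have : 0 < g x := by
      simp only [hg, hcos, sub_pos]
      exact Real.cos_lt_cos_of_nonneg_of_le_pi (by positivity) h2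
        (mul_lt_mul_of_pos_left h1 ha0)
    exact pow_pos (lt_max_of_lt_left this) 2

end Cutoff

section TimeWeight

variable {T T₀ T₁ : ℝ} {θ : ℝ → ℝ}

theorem one_le_timeWeight (hT₀ : 0 < T₀) (hT₁ : 0 < T₁) (hTT : 2 * T₀ + 2 * T₁ < T)
    (hθa : ∀ t ∈ Ioc (0:ℝ) T₀, θ t = 1 / t ^ 2)
    (hθb : StrictAntiOn θ (Icc T₀ (2 * T₀)))
    (hθc : ∀ t ∈ Icc (2 * T₀) (T - 2 * T₁), θ t = 1)
    (hθd : StrictMonoOn θ (Icc (T - 2 * T₁) (T - T₁)))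
    (hθe : ∀ t ∈ Ico (T - T₁) T, θ t = 1 / (T - t) ^ 2) {t : ℝ} (ht : t ∈ Ioo 0 T) :
    1 ≤ θ t := by
  have h1 : ∀ t ∈ Icc T₀ (2 * T₀), 1 ≤ θ t := fun t ht => by
    rw [← hθc (2 * T₀) ⟨le_rfl, by linarith⟩]
    exact hθb.antitoneOn ht ⟨by linarith, le_rfl⟩ ht.2
  have h2 : ∀ t ∈ Icc (T - 2 * T₁) (T - T₁), 1 ≤ θ t := fun t ht => by
    rw [← hθc (T - 2 * T₁) ⟨by linarith, le_rfl⟩]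
    exact hθd.monotoneOn ⟨le_rfl, by linarith⟩ ht ht.1
  rcases le_total t T₀ with h | h
  · refine (h1 T₀ ⟨le_rfl, by linarith⟩).trans ?_
    rw [hθa t ⟨ht.1, h⟩, hθa T₀ ⟨hT₀, le_rfl⟩]
    have := ht.1
    gcongr
  rcases le_total t (2 * T₀) with h' | h'
  · exact h1 t ⟨h, h'⟩
  rcases le_total t (T - 2 * T₁) with h'' | h''
  · exact (hθc t ⟨h', h''⟩).ge
  rcases le_total t (T - T₁) with h''' | h'''
  · exact h2 t ⟨h'', h'''⟩
  · refine (h2 (T - T₁) ⟨by linarith, le_rfl⟩).trans ?_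
    rw [hθe t ⟨h''', ht.2⟩, hθe (T - T₁) ⟨le_rfl, by linarith⟩]
    have := ht.2
    have : 0 < T - t := by linarith
    gcongr

theorem tendsto_timeWeight_zero (hT₀ : 0 < T₀) (hθa : ∀ t ∈ Ioc (0:ℝ) T₀, θ t = 1 / t ^ 2) :
    Tendsto θ (𝓝[>] 0) atTop := by
  have h : Tendsto (fun t : ℝ => t⁻¹ ^ 2) (𝓝[>] 0) atTop :=
    (tendsto_pow_atTop two_ne_zero).comp tendsto_inv_nhdsGT_zero
  refine h.congr' ?_
  filter_upwards [Ioc_mem_nhdsGT hT₀] with t ht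
  rw [hθa t ht, inv_pow, one_div]

theorem tendsto_timeWeight_end (hT₁ : 0 < T₁)
    (hθe : ∀ t ∈ Ico (T - T₁) T, θ t = 1 / (T - t) ^ 2) : Tendsto θ (𝓝[<] T) atTop := by
  have h : Tendsto (fun t : ℝ => T - t) (𝓝[<] T) (𝓝[>] 0) := by
    refine tendsto_nhdsWithin_iff.2 ⟨?_, ?_⟩
    · have : Tendsto (fun t : ℝ => T - t) (𝓝 T) (𝓝 (T - T)) := tendsto_const_nhds.sub tendsto_id
      rw [sub_self] at this
      exact this.mono_left nhdsWithin_le_nhds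
    · filter_upwards [self_mem_nhdsWithin] with t ht
      exact sub_pos.2 (mem_Iio.1 ht)
  refine ((tendsto_timeWeight_zero (θ := fun t => 1 / t ^ 2) one_pos fun _ _ => rfl).comp
    h).congr' ?_
  filter_upwards [Ico_mem_nhdsLT (by linarith : T - T₁ < T)] with t ht
  simp only [Function.comp_apply, hθe t ht]

theorem exists_deriv_timeWeight_le (hT₀ : 0 < T₀) (hT₁ : 0 < T₁)
    (hθC : ContDiffOn ℝ 4 θ (Ioo 0 T)) (h1 : ∀ t ∈ Ioo 0 T, 1 ≤ θ t)
    (hθa : ∀ t ∈ Ioc (0:ℝ) T₀, θ t = 1 / t ^ 2)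
    (hθe : ∀ t ∈ Ico (T - T₁) T, θ t = 1 / (T - t) ^ 2) :
    ∃ K, 1 ≤ K ∧ ∀ t ∈ Ioo 0 T, deriv θ t ^ 2 ≤ K * θ t ^ 3 := by
  have h0 : ∀ r : ℝ, 0 < r → HasDerivAt (fun z : ℝ => 1 / z ^ 2) (-2 / r ^ 3) r := fun r hr => by
    have h := (hasDerivAt_pow 2 r).fun_inv (pow_ne_zero 2 hr.ne')
    simp only [← one_div] at h
    refine h.congr_deriv ?_
    have := hr.ne'
    field_simp
    push_cast
    ring
  have hc : ContinuousOn (deriv θ) (Icc T₀ (T - T₁)) :=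
    (hθC.continuousOn_deriv_of_isOpen isOpen_Ioo (by norm_num)).mono fun t ht =>
      ⟨hT₀.trans_le ht.1, by linarith [ht.2]⟩
  obtain ⟨B, hB⟩ := isCompact_Icc.exists_bound_of_continuousOn hc
  refine ⟨max 4 (B ^ 2), le_max_of_le_left (by norm_num), fun t ht => ?_⟩
  have hθ := h1 t ht
  have hθ3 : 1 ≤ θ t ^ 3 := one_le_pow₀ hθ
  rcases lt_or_ge t T₀ with h | h
  · have hd : HasDerivAt θ (-2 / t ^ 3) t :=
      (h0 t ht.1).congr_of_eventuallyEq (by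
        filter_upwards [Ioo_mem_nhds ht.1 h] with z hz
        exact hθa z ⟨hz.1, hz.2.le⟩)
    refine le_trans (le_of_eq ?_) (mul_le_mul_of_nonneg_right (le_max_left _ _) (by positivity))
    rw [hd.deriv, hθa t ⟨ht.1, h.le⟩]
    have := ht.1.ne'
    field_simp
    norm_num
  rcases le_or_gt t (T - T₁) with h' | h'
  · have h2 : deriv θ t ^ 2 ≤ B ^ 2 := by
      rw [← sq_abs]
      exact pow_le_pow_left₀ (abs_nonneg _) (hB t ⟨h, h'⟩) 2
    calc deriv θ t ^ 2 ≤ max 4 (B ^ 2) := h2.trans (le_max_right _ _)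
      _ ≤ _ := le_mul_of_one_le_right (le_max_of_le_left (by norm_num)) hθ3
  · have hTt : 0 < T - t := by linarith [ht.2]
    have hd : HasDerivAt θ (-(-2 / (T - t) ^ 3)) t :=
      ((h0 (T - t) hTt).comp_const_sub T t).congr_of_eventuallyEq (by
        filter_upwards [Ioo_mem_nhds h' ht.2] with z hz
        exact hθe z ⟨hz.1.le, hz.2⟩)
    refine le_trans (le_of_eq ?_) (mul_le_mul_of_nonneg_right (le_max_left _ _) (by positivity))
    rw [hd.deriv, hθe t ⟨h'.le, ht.2⟩]
    have := hTt.ne'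
    field_simp
    norm_num

end TimeWeight

section BuildWeight

variable {d L T : ℝ} {θ : ℝ → ℝ}

theorem Function.Periodic.deriv_real {f : ℝ → ℝ} {P : ℝ} (hf : Function.Periodic f P) :
    Function.Periodic (deriv f) P := fun x => by
  rw [← deriv_comp_add_const]
  exact congrArg (fun g => deriv g x) (funext hf)

theorem PolyGrowth.of_time {g : ℝ → ℝ} (hg : ContinuousOn g (Ioo 0 T)) {K : ℝ} (hK : 0 ≤ K)
    (m : ℕ) (h : ∀ t ∈ Ioo 0 T, |g t| ≤ K * θ t ^ m) :
    PolyGrowth d L T θ (fun _ t => g t) :=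
  ⟨hg.comp continuous_snd.continuousOn fun _ hp => hp.2, K, hK, m, fun _ _ t ht => h t ht⟩

theorem RapidDecay.exp_neg {F : ℝ → ℝ → ℝ} {κ : ℝ} (hκ : 0 < κ)
    (hθ : ∀ t ∈ Ioo (0:ℝ) T, 1 ≤ θ t)
    (hF : ContinuousOn (fun p : ℝ × ℝ => F p.1 p.2) (univ ×ˢ Ioo 0 T))
    (h : ∀ x ∈ Icc (-L) (d + L), ∀ t ∈ Ioo (0:ℝ) T, κ * θ t ≤ F x t) :
    RapidDecay d L T θ (fun x t => Real.exp (-F x t)) := by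
  refine ⟨hF.neg.rexp, fun m => ⟨m.factorial / κ ^ m, by positivity, fun x hx t ht => ?_⟩⟩
  have hθ0 : 0 ≤ θ t := zero_le_one.trans (hθ t ht)
  have h1 := Real.pow_div_factorial_le_exp (κ * θ t) (by positivity) m
  rw [abs_of_pos (Real.exp_pos _), le_div_iff₀ (by positivity)]
  calc Real.exp (-F x t) * θ t ^ m * κ ^ m
      ≤ Real.exp (-(κ * θ t)) * θ t ^ m * κ ^ m := by
        gcongr
        exact h x hx t ht
    _ = Real.exp (-(κ * θ t)) * ((κ * θ t) ^ m / m.factorial) * m.factorial := by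
        rw [mul_pow]
        have : (m.factorial : ℝ) ≠ 0 := by positivity
        field_simp
    _ ≤ Real.exp (-(κ * θ t)) * Real.exp (κ * θ t) * m.factorial := by gcongr
    _ = m.factorial := by rw [← Real.exp_add]; simp

/-- The weights built from `θ` and `η` satisfy the requirements of `CarlemanWeight` uniformly in
the parameters `s` and `lam`. -/
theorem exists_carlemanWeight (hd : 0 < d) (hL : 0 < L) {η : ℝ → ℝ} {M : ℝ}
    (hη : ContDiff ℝ 6 η) (hηper : Function.Periodic η (d + 2 * L)) (hηpos : ∀ x, 0 < η x)
    (hη' : ∃ c₀ > 0, ∀ x ∈ Icc (0:ℝ) d, c₀ ≤ |deriv η x|) (hM : ∀ x, η x ≤ M)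
    (hθC : ContDiffOn ℝ 4 θ (Ioo 0 T)) (hθ : ∀ t ∈ Ioo (0:ℝ) T, 1 ≤ θ t)
    (hθ0 : Tendsto θ (𝓝[>] 0) atTop) (hθT : Tendsto θ (𝓝[<] T) atTop)
    {Kθ : ℝ} (hKθ : 1 ≤ Kθ) (hθ' : ∀ t ∈ Ioo 0 T, deriv θ t ^ 2 ≤ Kθ * θ t ^ 3) :
    ∃ K c : ℝ, 1 ≤ K ∧ 0 < c ∧ c ≤ 1 ∧ ∀ s lam : ℝ, 1 ≤ s → 1 ≤ lam →
      ∃ w : CarlemanWeight d L T K c s lam, w.θ = θ ∧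
        (∀ x t, w.W x t = Real.exp (-(s * phiW θ η M lam x t))) ∧
        (∀ x t, w.ρ x t = s * lam * xiW θ η M lam x t) ∧
        (∀ x ∈ Icc 0 d, w.σ x = 0) ∧ ∀ x, w.σ x ≤ 4 := by
  obtain ⟨σ, σ1, Kσ, hσ, hσ1, hσx, hσper, hσ0, hσ4, hσ1K, hσd, hσpos⟩ := exists_cutoff hd hL
  have c1 : ContDiff ℝ 5 (deriv η) :=
    ((contDiff_succ_iff_deriv (n := 5)).1 (hη.of_le (by norm_num))).2.2
  have c2 : ContDiff ℝ 4 (deriv (deriv η)) :=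
    ((contDiff_succ_iff_deriv (n := 4)).1 (c1.of_le (by norm_num))).2.2
  have c3 : ContDiff ℝ 3 (deriv (deriv (deriv η))) :=
    ((contDiff_succ_iff_deriv (n := 3)).1 (c2.of_le (by norm_num))).2.2
  have hηx : ∀ x, HasDerivAt η (deriv η x) x := fun x =>
    (hη.differentiable (by norm_num) x).hasDerivAt
  obtain ⟨B1, hB1⟩ := (isCompact_Icc (a := -L) (b := d + L)).exists_bound_of_continuousOn
    c1.continuous.continuousOn
  obtain ⟨B2, hB2⟩ := (isCompact_Icc (a := -L) (b := d + L)).exists_bound_of_continuousOn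
    c2.continuous.continuousOn
  obtain ⟨B3, hB3⟩ := (isCompact_Icc (a := -L) (b := d + L)).exists_bound_of_continuousOn
    c3.continuous.continuousOn
  obtain ⟨c, hc, hc1, hcσ⟩ : ∃ c : ℝ, 0 < c ∧ c ≤ 1 ∧
      ∀ x ∈ Icc (-L) (d + L), c ≤ deriv η x ^ 2 + σ x := by
    obtain ⟨x₀, hx₀, hmin⟩ := (isCompact_Icc (a := -L) (b := d + L)).exists_isMinOn
      (nonempty_Icc.2 (by linarith))
      ((c1.continuous.pow 2).add hσ : Continuous fun x => deriv η x ^ 2 + σ x).continuousOn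
    refine ⟨min (deriv η x₀ ^ 2 + σ x₀) 1, lt_min ?_ one_pos, min_le_right _ _,
      fun x hx => (min_le_left _ _).trans (hmin hx)⟩
    by_cases h : x₀ ∈ Icc 0 d
    · obtain ⟨c₀, hc₀, hc₀'⟩ := hη'
      have : deriv η x₀ ≠ 0 := abs_pos.1 (hc₀.trans_le (hc₀' x₀ h))
      have := hσ0 x₀
      positivity
    · have := hσpos x₀ hx₀ h
      positivity
  set K := 4 + Kθ + |Kσ| + |B1| + |B2| + |B3| with hK
  have a1 := abs_nonneg Kσ
  have a2 := abs_nonneg B1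
  have a3 := abs_nonneg B2
  have a4 := abs_nonneg B3
  have a5 := le_abs_self Kσ
  have a6 := le_abs_self B1
  have a7 := le_abs_self B2
  have a8 := le_abs_self B3
  have hKK : Kθ ≤ K := by linarith
  refine ⟨K, c, by linarith, hc, hc1, fun s lam hs hlam => ?_⟩
  have hs0 : 0 < s := by linarith
  have hl0 : 0 < lam := by linarith
  have hM0 : 0 < M := (hηpos 0).trans_le (hM 0)
  set E : ℝ → ℝ := fun x => Real.exp (lam * (η x + 4 * M)) with hE
  set G := Real.exp (6 * lam * M) with hG
  have hEx : ∀ x, HasDerivAt E (lam * deriv η x * E x) x := fun x =>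
    (((hηx x).add_const _).const_mul lam).exp.congr_deriv (by ring)
  have hE0 : ∀ x, 0 < E x := fun x => Real.exp_pos _
  have hE1 : ∀ x, 1 ≤ E x := fun x => Real.one_le_exp (by have := hηpos x; positivity)
  have hEc : Continuous E := by have := hη.continuous; fun_prop
  have hEper : E (-L) = E (d + L) := by
    have := hηper (-L)
    rw [show -L + (d + 2 * L) = d + L by ring] at this
    simp only [hE, this]
  have hG2 : ∀ x, G ≤ E x ^ 2 := fun x => by
    rw [hE, hG, ← Real.exp_nat_mul]
    refine Real.exp_le_exp.2 ?_
    have := mul_pos hl0 (hηpos x)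
    have := mul_pos hl0 hM0
    push_cast
    nlinarith
  have hG3 : ∀ x, G ^ 2 ≤ E x ^ 3 := fun x => by
    rw [hE, hG, ← Real.exp_nat_mul, ← Real.exp_nat_mul]
    refine Real.exp_le_exp.2 ?_
    have := mul_pos hl0 (hηpos x)
    push_cast
    nlinarith
  have hκ : 0 < G - Real.exp (5 * lam * M) := by
    refine sub_pos.2 (Real.exp_lt_exp.2 ?_)
    have := mul_pos hl0 hM0
    linarith
  have hEκ : ∀ x, G - Real.exp (5 * lam * M) ≤ G - E x := fun x => by
    refine sub_le_sub_left (Real.exp_le_exp.2 ?_) _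
    have := mul_le_mul_of_nonneg_left (hM x) hl0.le
    linarith
  have hGE : ∀ x, 0 ≤ G - E x := fun x => hκ.le.trans (hEκ x)
  have hθd : ∀ t ∈ Ioo 0 T, HasDerivAt θ (deriv θ t) t := fun t ht =>
    ((hθC.differentiableOn (by norm_num)).differentiableAt (isOpen_Ioo.mem_nhds ht)).hasDerivAt
  have hθabs : ∀ t ∈ Ioo 0 T, |deriv θ t| ≤ Kθ * θ t ^ 2 := fun t ht => by
    have h1 := hθ t ht
    refine abs_le_of_sq_le_sq ?_ (by positivity)
    calc deriv θ t ^ 2 ≤ Kθ * θ t ^ 3 := hθ' t ht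
      _ ≤ Kθ ^ 2 * θ t ^ 4 := by
        refine mul_le_mul (le_self_pow₀ hKθ two_ne_zero) (pow_le_pow_right₀ h1 (by norm_num))
          (by positivity) (by positivity)
      _ = _ := by ring
  have gθ : PolyGrowth d L T θ (fun _ t => θ t) :=
    .of_time hθC.continuousOn zero_le_one 1 fun t ht => by
      rw [abs_of_nonneg (zero_le_one.trans (hθ t ht)), one_mul, pow_one]
  have gθ' : PolyGrowth d L T θ (fun _ t => deriv θ t) :=
    .of_time (hθC.continuousOn_deriv_of_isOpen isOpen_Ioo (by norm_num)) (by linarith) 2 hθabs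
  have gE : PolyGrowth d L T θ (fun x _ => E x) := .of_space hEc
  have gGE : PolyGrowth d L T θ (fun x _ => G - E x) := .of_space (by fun_prop)
  refine ⟨{
    θ := θ
    W := fun x t => Real.exp (-(s * (θ t * (G - E x))))
    ρ := fun x t => s * lam * (θ t * E x)
    rt := fun x t => s * lam * (deriv θ t * E x)
    lt := fun x t => s * (deriv θ t * (G - E x))
    h := deriv η
    h2 := deriv (deriv η)
    h3 := deriv (deriv (deriv η))
    σ := σ
    σ1 := σ1
    one_le_θ := hθ
    tendsto_zero := hθ0
    tendsto_T := hθT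
    decay := ?_
    growth_ρ := (PolyGrowth.const _).mul (gθ.mul gE)
    growth_rt := (PolyGrowth.const _).mul (gθ'.mul gE)
    growth_lt := (PolyGrowth.const _).mul (gθ'.mul gGE)
    cont_h := c1.continuous
    cont_h2 := c2.continuous
    cont_h3 := c3.continuous
    cont_σ := hσ
    cont_σ1 := hσ1
    W_x := fun x t ht => ((((hEx x).const_sub G).const_mul (θ t)).const_mul s).fun_neg.exp.congr_deriv
      (by ring)
    W_t := fun x t ht => (((hθd t ht).mul_const (G - E x)).const_mul s).fun_neg.exp.congr_deriv
      (by ring)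
    ρ_x := fun x t ht => (((hEx x).const_mul (θ t)).const_mul (s * lam)).congr_deriv (by ring)
    ρ_t := fun x t ht => ((hθd t ht).mul_const (E x)).const_mul (s * lam)
    lt_x := fun x t ht => ((((hEx x).const_sub G).const_mul (deriv θ t)).const_mul s).congr_deriv
      (by ring)
    h_x := fun x => (c1.differentiable (by norm_num) x).hasDerivAt
    h2_x := fun x => (c2.differentiable (by norm_num) x).hasDerivAt
    σ_x := hσx
    W_per := fun t => by rw [hEper]
    ρ_per := fun t => by rw [hEper]
    lt_per := fun t => by rw [hEper]
    h_per := ?_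
    h2_per := ?_
    σ_per := hσper
    lam_le := hlam
    s_le := hs
    ρ_ge := ?_
    ρ_pos := ?_
    rt_le := ?_
    lt_le := ?_
    lt_sq_le := ?_
    h_le := fun x hx => (hB1 x hx).trans (by linarith)
    h2_le := fun x hx => (hB2 x hx).trans (by linarith)
    h3_le := fun x hx => (hB3 x hx).trans (by linarith)
    σ_nonneg := hσ0
    σ_sq_le := ?_
    σ1_sq_le := ?_
    le_σ := hcσ }, rfl, fun _ _ => rfl, fun _ _ => rfl, hσd, hσ4⟩
  · refine RapidDecay.exp_neg (mul_pos hs0 hκ) hθ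
      ((PolyGrowth.const s).mul (gθ.mul gGE)).cont fun x _ t ht => ?_
    have := zero_le_one.trans (hθ t ht)
    rw [mul_assoc, mul_comm _ (θ t)]
    exact mul_le_mul_of_nonneg_left (mul_le_mul_of_nonneg_left (hEκ x) this) hs0.le
  · have := hηper.deriv_real (-L)
    rw [← this]
    congr 1
    ring
  · have := hηper.deriv_real.deriv_real (-L)
    rw [← this]
    congr 1
    ring
  · intro x _ t ht
    exact le_mul_of_one_le_right (by positivity)
      (one_le_mul_of_one_le_of_one_le (hθ t ht) (hE1 x))
  · intro x t ht
    have := hE0 x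
    have := zero_lt_one.trans_le (hθ t ht)
    positivity
  · intro x _ t ht
    have h1 := hE0 x
    have h2 : |deriv θ t| * E x ≤ K * θ t ^ 2 * E x ^ 2 := by
      have hp : 0 ≤ θ t ^ 2 := sq_nonneg _
      refine mul_le_mul ((hθabs t ht).trans (mul_le_mul_of_nonneg_right hKK hp))
        (le_self_pow₀ (hE1 x) two_ne_zero) h1.le (by positivity)
    rw [abs_mul, abs_mul (deriv θ t), abs_of_pos (mul_pos hs0 hl0), abs_of_pos h1]
    calc s * lam * (|deriv θ t| * E x) * (s * lam)
        = (s * lam) ^ 2 * (|deriv θ t| * E x) := by ring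
      _ ≤ (s * lam) ^ 2 * (K * θ t ^ 2 * E x ^ 2) := by gcongr
      _ = _ := by ring
  · intro x _ t ht
    have h1 := hE0 x
    have h2 : |deriv θ t| * (G - E x) ≤ K * θ t ^ 2 * E x ^ 2 := by
      have hp : 0 ≤ θ t ^ 2 := sq_nonneg _
      exact mul_le_mul ((hθabs t ht).trans (mul_le_mul_of_nonneg_right hKK hp))
        (by linarith [hG2 x]) (hGE x) (by positivity)
    rw [abs_mul, abs_mul, abs_of_pos hs0, abs_of_nonneg (hGE x)]
    have h3 : s ≤ (s * lam) ^ 2 :=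
      (le_mul_of_one_le_right hs0.le hlam).trans
        (le_self_pow₀ (one_le_mul_of_one_le_of_one_le hs hlam) two_ne_zero)
    calc s * (|deriv θ t| * (G - E x)) ≤ (s * lam) ^ 2 * (K * θ t ^ 2 * E x ^ 2) :=
          mul_le_mul h3 h2 (mul_nonneg (abs_nonneg _) (hGE x)) (by positivity)
      _ = _ := by ring
  · intro x _ t ht
    have h1 := hE0 x
    have hθp := zero_lt_one.trans_le (hθ t ht)
    have h2 : deriv θ t ^ 2 * (G - E x) ^ 2 ≤ K * θ t ^ 3 * E x ^ 3 := by
      refine mul_le_mul ((hθ' t ht).trans (mul_le_mul_of_nonneg_right hKK (by positivity)))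
        (le_trans ?_ (hG3 x)) (sq_nonneg _) (by positivity)
      exact pow_le_pow_left₀ (hGE x) (by linarith) 2
    have h3 : s ^ 3 ≤ (s * lam) ^ 3 :=
      pow_le_pow_left₀ hs0.le (le_mul_of_one_le_right hs0.le hlam) 3
    calc (s * (deriv θ t * (G - E x))) ^ 2 * s
        = s ^ 3 * (deriv θ t ^ 2 * (G - E x) ^ 2) := by ring
      _ ≤ (s * lam) ^ 3 * (K * θ t ^ 3 * E x ^ 3) := by gcongr
      _ = _ := by ring
  · intro x _
    have := hσ0 x
    rw [sq]
    exact mul_le_mul_of_nonneg_right ((hσ4 x).trans (by linarith)) this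
  · intro x _
    exact (hσ1K x).trans (mul_le_mul_of_nonneg_right (by linarith) (hσ0 x))

end BuildWeight

section LocalTerm

variable {d L T : ℝ} {θ : ℝ → ℝ} {F : ℝ → ℝ → ℝ}

theorem RapidDecay.intervalIntegrable_integral (hT : 0 < T) (hF : RapidDecay d L T θ F) {a b : ℝ}
    (ha : -L ≤ a) (hab : a ≤ b) (hb : b ≤ d + L) :
    IntervalIntegrable (fun t => ∫ x in a..b, F x t) volume 0 T := by
  rw [intervalIntegrable_iff_integrableOn_Ioo_of_le hT.le]
  have h : IntegrableOn (fun p : ℝ × ℝ => F p.1 p.2) (Ioc a b ×ˢ Ioo 0 T) (volume.prod volume) :=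
    hF.integrableOn.mono_set (prod_mono (Ioc_subset_Icc_self.trans (Icc_subset_Icc ha hb)) le_rfl)
  rw [IntegrableOn, ← Measure.prod_restrict] at h
  simp only [intervalIntegral.integral_of_le hab]
  exact h.integral_prod_right

theorem RapidDecay.intervalIntegrable_slice (hF : RapidDecay d L T θ F) {t : ℝ}
    (ht : t ∈ Ioo 0 T) (a b : ℝ) : IntervalIntegrable (fun x => F x t) volume a b :=
  (continuous_slice_space hF.cont ht).intervalIntegrable a b

theorem II_mul_le_IIω (hd : 0 < d) (hL : 0 < L) (hT : 0 < T)
    (hθ : ∀ t ∈ Ioo (0:ℝ) T, 1 ≤ θ t) {σ : ℝ → ℝ} (hσ : Continuous σ)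
    (hσd : ∀ x ∈ Icc 0 d, σ x = 0) (hσ4 : ∀ x, σ x ≤ 4) (hF : RapidDecay d L T θ F)
    (hF0 : ∀ x, ∀ t ∈ Ioo (0:ℝ) T, 0 ≤ F x t) :
    II d L T (fun x t => σ x * F x t) ≤ 4 * IIω d L T F := by
  have hσF : RapidDecay d L T θ (fun x t => σ x * F x t) :=
    (PolyGrowth.of_space hσ).mul_rapidDecay hθ hF
  have hi := (hF.intervalIntegrable_integral hT (a := -L) (b := 0) le_rfl (by linarith)
    (by linarith)).add (hF.intervalIntegrable_integral hT (a := d) (b := d + L) (by linarith)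
      (by linarith) le_rfl)
  rw [II, IIω, ← intervalIntegral.integral_const_mul]
  refine intervalIntegral.integral_mono_on_of_le_Ioo hT.le
    (hσF.intervalIntegrable_integral hT le_rfl (by linarith) le_rfl) (hi.const_mul 4)
    fun t ht => ?_
  have hint := hσF.intervalIntegrable_slice ht
  have h0 : ∫ x in (0:ℝ)..d, σ x * F x t = 0 := by
    rw [intervalIntegral.integral_congr (g := fun _ => 0), intervalIntegral.integral_zero]
    intro x hx
    rw [uIcc_of_le hd.le] at hx
    simp only [hσd x hx, zero_mul]
  have hle : ∀ a b : ℝ, a ≤ b → ∫ x in a..b, σ x * F x t ≤ 4 * ∫ x in a..b, F x t :=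
    fun a b hab => by
      rw [← intervalIntegral.integral_const_mul]
      exact intervalIntegral.integral_mono_on hab (hint a b)
        ((hF.intervalIntegrable_slice ht a b).const_mul 4)
        fun x _ => mul_le_mul_of_nonneg_right (hσ4 x) (hF0 x t ht)
  rw [← intervalIntegral.integral_add_adjacent_intervals (hint (-L) 0) (hint 0 (d + L)),
    ← intervalIntegral.integral_add_adjacent_intervals (hint 0 d) (hint d (d + L)), h0, zero_add]
  linarith [hle (-L) 0 (by linarith), hle d (d + L) (by linarith)]

theorem IIω_const_mul (r : ℝ) (F : ℝ → ℝ → ℝ) :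
    IIω d L T (fun x t => r * F x t) = r * IIω d L T F := by
  simp [IIω, intervalIntegral.integral_const_mul, ← mul_add]

end LocalTerm

/-- Theorem 1.1: Carleman estimate for the adjoint of the damped beam operator. -/
theorem carleman_adjoint_damped_beam
    (d L T T₀ T₁ : ℝ) (hd : 0 < d) (hL : 0 < L) (hT : 0 < T)
    (hT₀ : 0 < T₀) (hT₁ : 0 < T₁) (hTT : 2 * T₀ + 2 * T₁ < T)
    (η θ : ℝ → ℝ)
    (hη : ContDiff ℝ 6 η)
    (hηper : Function.Periodic η (d + 2 * L))
    (hηpos : ∀ x, 0 < η x)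
    (hη' : ∃ c₀ > 0, ∀ x ∈ Icc (0:ℝ) d, c₀ ≤ |deriv η x|)
    (hθC : ContDiffOn ℝ 4 θ (Ioo 0 T))
    (hθpos : ∀ t ∈ Ioo (0:ℝ) T, 0 < θ t)
    (hθa : ∀ t ∈ Ioc (0:ℝ) T₀, θ t = 1 / t ^ 2)
    (hθb : StrictAntiOn θ (Icc T₀ (2 * T₀)))
    (hθc : ∀ t ∈ Icc (2 * T₀) (T - 2 * T₁), θ t = 1)
    (hθd : StrictMonoOn θ (Icc (T - 2 * T₁) (T - T₁)))
    (hθe : ∀ t ∈ Ico (T - T₁) T, θ t = 1 / (T - t) ^ 2) :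
    ∃ C > 0, ∃ s₀ ≥ (1:ℝ), ∃ lam₀ ≥ (1:ℝ),
      ∀ ψ : ℝ → ℝ → ℝ,
        ContDiff ℝ (⊤ : ℕ∞) (fun p : ℝ × ℝ => ψ p.1 p.2) →
        (∀ t, Function.Periodic (fun x => ψ x t) (d + 2 * L)) →
        ∀ s ≥ s₀, ∀ lam ≥ lam₀,
          let M := ⨆ x : ℝ, |η x|
          let φ := phiW θ η M lam
          let ξ := xiW θ η M lam
          s ^ 7 * lam ^ 8 *
              II d L T (fun x t => ξ x t ^ 7 * ψ x t ^ 2 * Real.exp (-2 * s * φ x t))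
            + s ^ 5 * lam ^ 6 *
              II d L T (fun x t => ξ x t ^ 5 * pdx ψ x t ^ 2 * Real.exp (-2 * s * φ x t))
            + s ^ 3 * lam ^ 4 *
              II d L T (fun x t =>
                ξ x t ^ 3 * (pdx (pdx ψ) x t ^ 2 + pdt ψ x t ^ 2) * Real.exp (-2 * s * φ x t))
            + s * lam ^ 2 *
              II d L T (fun x t =>
                ξ x t * (pdt (pdx ψ) x t ^ 2 + pdx (pdx (pdx ψ)) x t ^ 2) *
                  Real.exp (-2 * s * φ x t))
            + s⁻¹ *
              II d L T (fun x t =>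
                (ξ x t)⁻¹ *
                  (pdt (pdt ψ) x t ^ 2 + pdt (pdx (pdx ψ)) x t ^ 2
                    + pdx (pdx (pdx (pdx ψ))) x t ^ 2) * Real.exp (-2 * s * φ x t))
          ≤ C *
              II d L T (fun x t =>
                (pdt (pdt ψ) x t + pdt (pdx (pdx ψ)) x t + pdx (pdx (pdx (pdx ψ))) x t) ^ 2 *
                  Real.exp (-2 * s * φ x t))
            + C * s ^ 7 * lam ^ 8 *
              IIω d L T (fun x t => ξ x t ^ 7 * ψ x t ^ 2 * Real.exp (-2 * s * φ x t)) := by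
  have hθ1 : ∀ t ∈ Ioo (0:ℝ) T, 1 ≤ θ t := fun t ht =>
    one_le_timeWeight hT₀ hT₁ hTT hθa hθb hθc hθd hθe ht
  obtain ⟨Kθ, hKθ, hθ'⟩ := exists_deriv_timeWeight_le hT₀ hT₁ hθC hθ1 hθa hθe
  have hbdd : BddAbove (range fun x => |η x|) := by
    have hP : 0 < d + 2 * L := by positivity
    have hper : Function.Periodic (fun x => |η x|) (d + 2 * L) := fun x => by
      simp only [hηper x]
    rw [← hper.image_Icc hP 0]
    exact (isCompact_Icc.image hη.continuous.abs).bddAbove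
  have hM : ∀ x, η x ≤ ⨆ x : ℝ, |η x| := fun x => (le_abs_self _).trans (le_ciSup hbdd x)
  obtain ⟨K, c, hK, hc, hc1, hw⟩ := exists_carlemanWeight hd hL hη hηper hηpos hη' hM hθC hθ1
    (tendsto_timeWeight_zero hT₀ hθa) (tendsto_timeWeight_end hT₁ hθe) hKθ hθ'
  obtain ⟨D, hD, H⟩ := CarlemanWeight.beam_estimate hd hL hT hK hc hc1
  refine ⟨4 * D, by positivity, max 1 (max (9 * K ^ 3 / c ^ 2) (2 * K / c)), le_max_left _ _,
    max 1 (8 * K ^ 3 / c ^ 2), le_max_left _ _, fun ψ hψ hψper s hs lam hlam => ?_⟩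
  have hs1 : 1 ≤ s := (le_max_left _ _).trans hs
  have hl1 : 1 ≤ lam := (le_max_left _ _).trans hlam
  have hs9 : 9 * K ^ 3 ≤ c ^ 2 * s := by
    rw [← div_le_iff₀' (by positivity)]
    exact (le_max_left _ _).trans ((le_max_right _ _).trans hs)
  have hs2 : 2 * K ≤ c * s := by
    rw [← div_le_iff₀' hc]
    exact (le_max_right _ _).trans ((le_max_right _ _).trans hs)
  have hl8 : 8 * K ^ 3 ≤ c ^ 2 * lam := by
    rw [← div_le_iff₀' (by positivity)]
    exact (le_max_right _ _).trans hlam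
  intro M φ ξ
  obtain ⟨w, hwθ, hW, hρ, hσd, hσ4⟩ := hw s lam hs1 hl1
  have hψ' : SmoothPeriodic (d + 2 * L) ψ := ⟨hψ, hψper⟩
  have key := H s lam w ψ hs9 hs2 hl8 hψ'
  have hloc := II_mul_le_IIω hd hL hT w.one_le_θ w.cont_σ hσd hσ4
    ((w.growth_ρ.pow 7).mul_rapidDecay w.one_le_θ ((w.rapid_hat hψ').sq w.one_le_θ))
    fun x t ht => mul_nonneg (pow_nonneg (w.ρ_pos x t ht).le 7) (sq_nonneg _)
  have hs0 : s ≠ 0 := by positivity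
  have hl0 : lam ≠ 0 := by positivity
  have hW2 : ∀ x t, Real.exp (-2 * s * φ x t) = w.W x t ^ 2 := fun x t => by
    rw [hW, ← Real.exp_nat_mul]
    congr 1
    push_cast
    ring
  have e7 : (fun x t => w.ρ x t ^ 7 * w.hat ψ x t ^ 2) = fun x t =>
      (s ^ 7 * lam ^ 7) * (ξ x t ^ 7 * ψ x t ^ 2 * Real.exp (-2 * s * φ x t)) := by
    funext x t
    rw [hW2, hρ, CarlemanWeight.hat]
    ring
  have e5 : (fun x t => w.ρ x t ^ 5 * w.hat (pdx ψ) x t ^ 2) = fun x t =>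
      (s ^ 5 * lam ^ 5) * (ξ x t ^ 5 * pdx ψ x t ^ 2 * Real.exp (-2 * s * φ x t)) := by
    funext x t
    rw [hW2, hρ, CarlemanWeight.hat]
    ring
  have e3 : (fun x t => w.ρ x t ^ 3 * (w.hat (pdx (pdx ψ)) x t ^ 2 + w.hat (pdt ψ) x t ^ 2))
      = fun x t => (s ^ 3 * lam ^ 3) *
        (ξ x t ^ 3 * (pdx (pdx ψ) x t ^ 2 + pdt ψ x t ^ 2) * Real.exp (-2 * s * φ x t)) := by
    funext x t
    simp only [hW2, hρ, CarlemanWeight.hat]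
    ring
  have e1 : (fun x t => w.ρ x t *
        (w.hat (pdt (pdx ψ)) x t ^ 2 + w.hat (pdx (pdx (pdx ψ))) x t ^ 2))
      = fun x t => (s * lam) *
        (ξ x t * (pdt (pdx ψ) x t ^ 2 + pdx (pdx (pdx ψ)) x t ^ 2) *
          Real.exp (-2 * s * φ x t)) := by
    funext x t
    simp only [hW2, hρ, CarlemanWeight.hat]
    ring
  have ei : (fun x t => (w.ρ x t)⁻¹ *
        (w.hat (pdt (pdt ψ)) x t ^ 2 + w.hat (pdt (pdx (pdx ψ))) x t ^ 2
          + w.hat (pdx (pdx (pdx (pdx ψ)))) x t ^ 2))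
      = fun x t => (s⁻¹ * lam⁻¹) * ((ξ x t)⁻¹ *
        (pdt (pdt ψ) x t ^ 2 + pdt (pdx (pdx ψ)) x t ^ 2
          + pdx (pdx (pdx (pdx ψ))) x t ^ 2) * Real.exp (-2 * s * φ x t)) := by
    funext x t
    simp only [hW2, hρ, CarlemanWeight.hat, mul_inv]
    ring
  have eF : (fun x t => (w.hat (pdt (pdt ψ)) x t + w.hat (pdt (pdx (pdx ψ))) x t
        + w.hat (pdx (pdx (pdx (pdx ψ)))) x t) ^ 2)
      = fun x t => (pdt (pdt ψ) x t + pdt (pdx (pdx ψ)) x t + pdx (pdx (pdx (pdx ψ))) x t) ^ 2 *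
        Real.exp (-2 * s * φ x t) := by
    funext x t
    simp only [hW2, CarlemanWeight.hat]
    ring
  simp only [← mul_assoc] at hloc
  rw [e7, IIω_const_mul] at hloc
  rw [e7, e5, e3, e1, ei, eF] at key
  simp only [II_const_mul] at key
  have hF0 : 0 ≤ D * II d L T (fun x t =>
      (pdt (pdt ψ) x t + pdt (pdx (pdx ψ)) x t + pdx (pdx (pdx (pdx ψ))) x t) ^ 2 *
        Real.exp (-2 * s * φ x t)) :=
    mul_nonneg hD.le (II_nonneg hd hL hT fun x _ t _ => by positivity)
  have hloc' := mul_le_mul_of_nonneg_left hloc (by positivity : 0 ≤ D * lam)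
  have hinv : lam * (s⁻¹ * lam⁻¹) = s⁻¹ := by field_simp
  rw [mul_add lam, ← mul_assoc lam (s⁻¹ * lam⁻¹), hinv] at key
  linarith
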